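/- Let N ≥ 2 and let Γ = Γ₁ * Γ₂ * ⋯ * Γ_N be the free product of nontrivial finitely generated groups, where Γ₁ is nilpotent and not virtually cyclic. Fix a finite generating set S_i for each Γ_i and let S = ⋃ S_i be the corresponding adapted generating set of Γ. Let μ be an admissible probability measure on Γ with finite super-exponential moment with respect to the word metric of S. Then there exist nonnegative real numbers h, l, v such that H(μ^{*n})/n → h, L(μ^{*n})/n → l, and (log b_n)/n → v as n → ∞, and moreover h < l·v. -/

import Mathlib

open scoped ENNReal
open Filter
open scoped Classical

/-- The word length of `g` with respect to a generating set `S`: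
the least `n` such that `g` is a product of `n` elements of `S ∪ S⁻¹`. -/
noncomputable def wordLength {G : Type*} [Group G] (S : Set G) (g : G) : ℕ :=
  sInf {n | ∃ l : List G, l.length = n ∧ (∀ x ∈ l, x ∈ S ∨ x⁻¹ ∈ S) ∧ l.prod = g}

/-- Convolution of two measures (given as `ℝ≥0∞`-valued functions) on a group. -/
noncomputable def conv {G : Type*} [Group G] (μ ν : G → ℝ≥0∞) : G → ℝ≥0∞ :=
  fun g => ∑' h, μ h * ν (h⁻¹ * g)

/-- `n`-fold convolution power, with `μ^{*0}` the point mass at the identity. -/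
noncomputable def convPow {G : Type*} [Group G] (μ : G → ℝ≥0∞) : ℕ → G → ℝ≥0∞
  | 0 => fun g => if g = 1 then 1 else 0
  | n + 1 => conv (convPow μ n) μ

/-- The entropy `H(μ) = -∑ μ(g) log μ(g)`, valued in `[0,∞]`. -/
noncomputable def entropy {G : Type*} (μ : G → ℝ≥0∞) : ℝ≥0∞ :=
  ∑' g, ENNReal.ofReal (-(μ g).toReal * Real.log (μ g).toReal)


set_option linter.all false

section Walk
variable {G : Type*} [Group G]

/-- One step Markov operator of the right random walk. -/
noncomputable def stepOp (μ : G → ℝ≥0∞) (F : G → ℝ≥0∞) : G → ℝ≥0∞ :=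
  fun y => ∑' g, μ g * F (y * g)

/-- `n` step Markov operator. -/
noncomputable def Ew (μ : G → ℝ≥0∞) (n : ℕ) (F : G → ℝ≥0∞) : G → ℝ≥0∞ :=
  (stepOp μ)^[n] F

/-- Indicator of a point. -/
noncomputable def pt (a : G) : G → ℝ≥0∞ := fun y => if y = a then 1 else 0

/-- Indicator of a set. -/
noncomputable def ind (A : Set G) : G → ℝ≥0∞ := fun y => if y ∈ A then 1 else 0

/-- Green function. -/
noncomputable def gr (μ : G → ℝ≥0∞) (t : G) : ℝ≥0∞ := ∑' n, convPow μ n t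

theorem Ew_zero (μ F : G → ℝ≥0∞) : Ew μ 0 F = F := rfl
theorem Ew_succ (μ F : G → ℝ≥0∞) (n : ℕ) : Ew μ (n + 1) F = Ew μ n (stepOp μ F) :=
  Function.iterate_succ_apply _ _ _
theorem Ew_succ' (μ F : G → ℝ≥0∞) (n : ℕ) : Ew μ (n + 1) F = stepOp μ (Ew μ n F) :=
  Function.iterate_succ_apply' _ _ _
theorem Ew_add (μ F : G → ℝ≥0∞) (m n : ℕ) : Ew μ (m + n) F = Ew μ m (Ew μ n F) :=
  Function.iterate_add_apply _ _ _ _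

theorem stepOp_mono (μ : G → ℝ≥0∞) {F F' : G → ℝ≥0∞} (h : ∀ y, F y ≤ F' y) (y : G) :
    stepOp μ F y ≤ stepOp μ F' y :=
  ENNReal.tsum_le_tsum fun g => mul_le_mul_right (h _) _

theorem Ew_mono (μ : G → ℝ≥0∞) (n : ℕ) {F F' : G → ℝ≥0∞} (h : ∀ y, F y ≤ F' y) :
    ∀ y, Ew μ n F y ≤ Ew μ n F' y := by
  induction n with
  | zero => exact h
  | succ n ih => intro y; rw [Ew_succ', Ew_succ']; exact stepOp_mono μ ih y

theorem stepOp_tsum {ι : Type*} (μ : G → ℝ≥0∞) (F : ι → G → ℝ≥0∞) :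
    stepOp μ (fun y => ∑' i, F i y) = fun y => ∑' i, stepOp μ (F i) y := by
  funext y
  simp only [stepOp, ← ENNReal.tsum_mul_left]
  rw [ENNReal.tsum_comm]

theorem Ew_tsum {ι : Type*} (μ : G → ℝ≥0∞) (n : ℕ) (F : ι → G → ℝ≥0∞) :
    Ew μ n (fun y => ∑' i, F i y) = fun y => ∑' i, Ew μ n (F i) y := by
  induction n with
  | zero => rfl
  | succ n ih => simp only [Ew_succ', ih, stepOp_tsum]

theorem stepOp_add (μ F F' : G → ℝ≥0∞) :
    stepOp μ (fun y => F y + F' y) = fun y => stepOp μ F y + stepOp μ F' y := by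
  funext y
  simp only [stepOp, mul_add]
  rw [ENNReal.tsum_add]

theorem Ew_add_fun (μ F F' : G → ℝ≥0∞) (n : ℕ) :
    Ew μ n (fun y => F y + F' y) = fun y => Ew μ n F y + Ew μ n F' y := by
  induction n with
  | zero => rfl
  | succ n ih => simp only [Ew_succ', ih, stepOp_add]

theorem stepOp_sum {ι : Type*} (s : Finset ι) (μ : G → ℝ≥0∞) (F : ι → G → ℝ≥0∞) :
    stepOp μ (fun y => ∑ i ∈ s, F i y) = fun y => ∑ i ∈ s, stepOp μ (F i) y := by
  funext y
  simp only [stepOp, Finset.mul_sum]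
  rw [Summable.tsum_finsetSum]
  intros; exact ENNReal.summable

theorem stepOp_smul (μ : G → ℝ≥0∞) (c : ℝ≥0∞) (F : G → ℝ≥0∞) :
    stepOp μ (fun y => c * F y) = fun y => c * stepOp μ F y := by
  funext y
  simp only [stepOp, ← ENNReal.tsum_mul_left]
  exact tsum_congr fun g => by ring

theorem Ew_smul (μ : G → ℝ≥0∞) (n : ℕ) (c : ℝ≥0∞) (F : G → ℝ≥0∞) :
    Ew μ n (fun y => c * F y) = fun y => c * Ew μ n F y := by
  induction n with
  | zero => rfl
  | succ n ih => simp only [Ew_succ', ih, stepOp_smul]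

theorem stepOp_trans (μ F : G → ℝ≥0∞) (w y : G) :
    stepOp μ F (w * y) = stepOp μ (fun z => F (w * z)) y := by
  simp only [stepOp, mul_assoc]

theorem Ew_trans (μ F : G → ℝ≥0∞) (n : ℕ) (w : G) :
    ∀ y, Ew μ n F (w * y) = Ew μ n (fun z => F (w * z)) y := by
  induction n with
  | zero => intro y; rfl
  | succ n ih =>
    intro y
    rw [Ew_succ', Ew_succ', stepOp_trans]
    congr 1; funext z; exact ih z

theorem stepOp_const {μ : G → ℝ≥0∞} (hμ : ∑' g, μ g = 1) (c : ℝ≥0∞) :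
    stepOp μ (fun _ => c) = fun _ => c := by
  funext y; simp only [stepOp, ENNReal.tsum_mul_right, hμ, one_mul]

theorem Ew_const {μ : G → ℝ≥0∞} (hμ : ∑' g, μ g = 1) (c : ℝ≥0∞) (n : ℕ) :
    Ew μ n (fun _ => c) = fun _ => c := by
  induction n with
  | zero => rfl
  | succ n ih => rw [Ew_succ', ih, stepOp_const hμ]

theorem tsum_mul_left_shift (F : G → ℝ≥0∞) (h : G) : ∑' g, F (h * g) = ∑' g, F g :=
  (Equiv.mulLeft h).tsum_eq F

theorem tsum_mul_right_shift (F : G → ℝ≥0∞) (h : G) : ∑' g, F (g * h) = ∑' g, F g :=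
  (Equiv.mulRight h).tsum_eq F

theorem tsum_conv (p q F : G → ℝ≥0∞) :
    ∑' g, conv p q g * F g = ∑' h, ∑' k, p h * q k * F (h * k) := by
  simp only [conv, ← ENNReal.tsum_mul_right]
  rw [ENNReal.tsum_comm]
  refine tsum_congr fun h => ?_
  rw [← tsum_mul_left_shift _ h]
  refine tsum_congr fun k => ?_
  simp

theorem Ew_eq (μ F : G → ℝ≥0∞) (n : ℕ) (y : G) :
    ∑' g, convPow μ n g * F (y * g) = Ew μ n F y := by
  induction n generalizing F y with
  | zero =>
    rw [tsum_eq_single 1]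
    · simp [convPow, Ew_zero]
    · intro b hb; simp [convPow, hb]
  | succ n ih =>
    rw [Ew_succ, ← ih]
    simp only [convPow]
    rw [tsum_conv]
    refine tsum_congr fun h => ?_
    simp only [stepOp, ← ENNReal.tsum_mul_left]
    exact tsum_congr fun k => by rw [mul_assoc, mul_assoc]

theorem Ew_one_eq (μ F : G → ℝ≥0∞) (n : ℕ) :
    ∑' g, convPow μ n g * F g = Ew μ n F 1 := by
  simpa using Ew_eq μ F n 1

theorem Ew_kernel (μ F : G → ℝ≥0∞) (n : ℕ) (y : G) :
    Ew μ n F y = ∑' z, convPow μ n (y⁻¹ * z) * F z := by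
  rw [← Ew_eq, ← tsum_mul_left_shift (fun z => convPow μ n (y⁻¹ * z) * F z) y]
  simp

theorem tsum_mul_pt (F : G → ℝ≥0∞) (a : G) : ∑' z, F z * pt a z = F a := by
  rw [tsum_eq_single a]
  · simp [pt]
  · intro b hb; simp [pt, hb]

theorem Ew_pt (μ : G → ℝ≥0∞) (n : ℕ) (a y : G) : Ew μ n (pt a) y = convPow μ n (y⁻¹ * a) := by
  rw [Ew_kernel, tsum_mul_pt]

theorem convPow_sum {μ : G → ℝ≥0∞} (hμ : ∑' g, μ g = 1) (n : ℕ) : ∑' g, convPow μ n g = 1 := by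
  have := Ew_one_eq μ (fun _ => 1) n
  rw [Ew_const hμ] at this
  simpa using this

theorem convPow_le_one {μ : G → ℝ≥0∞} (hμ : ∑' g, μ g = 1) (n : ℕ) (g : G) :
    convPow μ n g ≤ 1 := by
  rw [← convPow_sum hμ n]; exact ENNReal.le_tsum g

theorem convPow_one (μ : G → ℝ≥0∞) : convPow μ 1 = μ := by
  funext g
  have h := Ew_pt μ 1 g 1
  simp only [inv_one, one_mul] at h
  rw [← h, Ew_succ', Ew_zero]
  simp only [stepOp, one_mul]
  exact tsum_mul_pt μ g

theorem convPow_add (μ : G → ℝ≥0∞) (m n : ℕ) (a : G) :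
    convPow μ (m + n) a = ∑' x, convPow μ m x * convPow μ n (x⁻¹ * a) := by
  have h := Ew_pt μ (m + n) a 1
  simp only [inv_one, one_mul] at h
  rw [← h, Ew_add, ← Ew_one_eq]
  simp only [Ew_pt]

theorem convPow_mul_le (μ : G → ℝ≥0∞) (m n : ℕ) (a b : G) :
    convPow μ m a * convPow μ n b ≤ convPow μ (m + n) (a * b) := by
  rw [convPow_add]
  refine le_trans ?_ (ENNReal.le_tsum a)
  simp

/-- First entrance inequality. -/
theorem first_entrance (μ : G → ℝ≥0∞) (C : Set G) (F : G → ℝ≥0∞) (hF : ∀ y ∉ C, F y = 0)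
    (n : ℕ) : ∀ y ∉ C, Ew μ n F y ≤ ∑ k ∈ Finset.range n,
      Ew μ k (fun z => ind Cᶜ z * stepOp μ (fun z' => ind C z' * Ew μ (n - k - 1) F z') z) y := by
  induction n with
  | zero => intro y hy; simp [Ew_zero, hF y hy]
  | succ n ih =>
    intro y hy
    rw [Finset.sum_range_succ']
    have h1 : Ew μ (n + 1) F y = stepOp μ (fun z' => ind C z' * Ew μ n F z') y
        + stepOp μ (fun z' => ind Cᶜ z' * Ew μ n F z') y := by
      rw [Ew_succ']
      have := congrFun (stepOp_add μ (fun z' => ind C z' * Ew μ n F z')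
        (fun z' => ind Cᶜ z' * Ew μ n F z')) y
      rw [← this]
      congr 1; funext z
      by_cases hz : z ∈ C <;> simp [ind, hz]
    rw [h1, add_comm]
    refine add_le_add ?_ ?_
    rotate_left
    · simp [Ew_zero, ind, hy]
    · refine le_trans (stepOp_mono μ (F' := fun z => ∑ k ∈ Finset.range n,
        Ew μ k (fun z => ind Cᶜ z * stepOp μ (fun z' => ind C z' * Ew μ (n - k - 1) F z') z) z)
        ?_ y) ?_
      · intro z
        by_cases hz : z ∈ C
        · simp [ind, hz]
        · simpa [ind, hz] using ih z hz
      · rw [stepOp_sum]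
        refine Finset.sum_le_sum fun k hk => ?_
        rw [← Ew_succ']
        have : n + 1 - (k + 1) - 1 = n - k - 1 := by omega
        rw [this]

/-- First hitting probabilities. -/
noncomputable def hit (μ : G → ℝ≥0∞) : ℕ → G → G → ℝ≥0∞
  | 0, w => pt w
  | n + 1, w => fun y => if y = w then 0 else stepOp μ (hit μ n w) y

theorem hit_trans (μ : G → ℝ≥0∞) (n : ℕ) (w x : G) :
    ∀ y, hit μ n (w * x) (w * y) = hit μ n x y := by
  induction n with
  | zero => intro y; simp [hit, pt]
  | succ n ih =>
    intro y
    simp only [hit, mul_right_inj, stepOp_trans]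
    congr 2
    funext z; exact ih z

theorem hit_le (μ : G → ℝ≥0∞) (w : G) (F : G → ℝ≥0∞) (n : ℕ) :
    ∀ y, ∑ k ∈ Finset.range (n + 1), hit μ k w y * Ew μ (n - k) F w ≤ Ew μ n F y := by
  induction n with
  | zero => intro y; by_cases h : y = w <;> simp [hit, pt, h]
  | succ n ih =>
    intro y
    rw [Finset.sum_range_succ']
    by_cases h : y = w
    · subst h; simp [hit, pt]
    · simp only [hit, if_neg h, pt, zero_mul, add_zero]
      rw [Ew_succ']
      refine le_trans ?_ (stepOp_mono μ ih y)
      rw [stepOp_sum]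
      refine Finset.sum_le_sum fun k hk => ?_
      have : n + 1 - (k + 1) = n - k := by omega
      rw [this, mul_comm]
      have h2 := congrFun (stepOp_smul μ (Ew μ (n - k) F w) (hit μ k w)) y
      simp only [mul_comm (hit μ k w _)]
      rw [h2]

theorem hit_ge (μ : G → ℝ≥0∞) (w : G) (n : ℕ) :
    ∀ y, Ew μ n (pt w) y ≤ ∑ k ∈ Finset.range (n + 1), hit μ k w y * convPow μ (n - k) 1 := by
  induction n with
  | zero => intro y; by_cases h : y = w <;> simp [hit, pt, h, Ew_zero, convPow]
  | succ n ih =>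
    intro y
    rw [Finset.sum_range_succ']
    by_cases h : y = w
    · subst h; simp [hit, pt, Ew_pt]
    · simp only [hit, if_neg h, pt, zero_mul, add_zero]
      rw [Ew_succ']
      refine le_trans (stepOp_mono μ ih y) ?_
      rw [stepOp_sum]
      refine Finset.sum_le_sum fun k hk => ?_
      have : n + 1 - (k + 1) = n - k := by omega
      rw [this, mul_comm]
      have h2 := congrFun (stepOp_smul μ (convPow μ (n - k) 1) (hit μ k w)) y
      simp only [mul_comm (hit μ k w _)]
      rw [h2]

theorem hit_sum_ge (μ : G → ℝ≥0∞) (w y : G) (n : ℕ) :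
    ∑ k ∈ Finset.range n, Ew μ k (pt w) y ≤ (∑ k ∈ Finset.range n, hit μ k w y) * gr μ 1 := by
  calc ∑ k ∈ Finset.range n, Ew μ k (pt w) y
      ≤ ∑ k ∈ Finset.range n, ∑ i ∈ Finset.range (k + 1), hit μ i w y * convPow μ (k - i) 1 :=
        Finset.sum_le_sum fun k _ => hit_ge μ w k y
    _ = ∑ i ∈ Finset.range n, ∑ k ∈ Finset.Ico i n, hit μ i w y * convPow μ (k - i) 1 := by
        rw [Finset.sum_sigma', Finset.sum_sigma']
        refine Finset.sum_bij' (fun x _ => ⟨x.2, x.1⟩) (fun x _ => ⟨x.2, x.1⟩) ?_ ?_ ?_ ?_ ?_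
        · rintro ⟨a, b⟩ h
          simp only [Finset.mem_sigma, Finset.mem_range, Finset.mem_Ico] at h ⊢
          omega
        · rintro ⟨a, b⟩ h
          simp only [Finset.mem_sigma, Finset.mem_range, Finset.mem_Ico] at h ⊢
          omega
        · intros; rfl
        · intros; rfl
        · intros; rfl
    _ ≤ ∑ i ∈ Finset.range n, hit μ i w y * gr μ 1 := by
        refine Finset.sum_le_sum fun i _ => ?_
        rw [← Finset.mul_sum, Finset.sum_Ico_eq_sum_range]
        refine mul_le_mul_right ?_ _
        simp only [Nat.add_sub_cancel_left]
        exact ENNReal.sum_le_tsum _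
    _ = _ := by rw [Finset.sum_mul]

end Walk

section WL
variable {G : Type*} [Group G] {S : Set G}

theorem wl_le {l : List G} (hl : ∀ x ∈ l, x ∈ S ∨ x⁻¹ ∈ S) : wordLength S l.prod ≤ l.length :=
  Nat.sInf_le ⟨l, rfl, hl, rfl⟩

theorem wl_exists (hS : Subgroup.closure S = ⊤) (g : G) :
    ∃ l : List G, l.length = wordLength S g ∧ (∀ x ∈ l, x ∈ S ∨ x⁻¹ ∈ S) ∧ l.prod = g := by
  have hg : g ∈ Subgroup.closure S := by rw [hS]; trivial
  rw [← Subgroup.mem_toSubmonoid, Subgroup.closure_toSubmonoid] at hg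
  obtain ⟨l, hl, hp⟩ := Submonoid.exists_list_of_mem_closure hg
  simp only [Set.mem_union, Set.mem_inv] at hl
  exact Nat.sInf_mem (s := {n | ∃ l : List G, l.length = n ∧ (∀ x ∈ l, x ∈ S ∨ x⁻¹ ∈ S) ∧
    l.prod = g}) ⟨l.length, l, rfl, hl, hp⟩

theorem wl_one : wordLength S 1 = 0 := by
  have := wl_le (S := S) (l := []) (by simp)
  simpa using this

theorem wl_gen {s : G} (hs : s ∈ S ∨ s⁻¹ ∈ S) : wordLength S s ≤ 1 := by
  have := wl_le (S := S) (l := [s]) (by simpa using hs)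
  simpa using this

theorem wl_mul_le (hS : Subgroup.closure S = ⊤) (g h : G) :
    wordLength S (g * h) ≤ wordLength S g + wordLength S h := by
  obtain ⟨l, h1, h2, rfl⟩ := wl_exists hS g
  obtain ⟨l', h1', h2', rfl⟩ := wl_exists hS h
  rw [← h1, ← h1', ← List.length_append, ← List.prod_append]
  refine wl_le fun x hx => ?_
  rcases List.mem_append.1 hx with h | h
  · exact h2 x h
  · exact h2' x h

theorem wl_inv_le (hS : Subgroup.closure S = ⊤) (g : G) :
    wordLength S g⁻¹ ≤ wordLength S g := by
  obtain ⟨l, h1, h2, rfl⟩ := wl_exists hS g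
  rw [← h1, List.prod_inv_reverse]
  refine le_trans (wl_le ?_) (by simp)
  intro x hx
  simp only [List.mem_reverse, List.mem_map] at hx
  obtain ⟨y, hy, rfl⟩ := hx
  rw [inv_inv]
  exact (h2 y hy).symm

theorem wl_inv (hS : Subgroup.closure S = ⊤) (g : G) :
    wordLength S g⁻¹ = wordLength S g :=
  le_antisymm (wl_inv_le hS g) (by simpa using wl_inv_le hS g⁻¹)

theorem wl_pos (hS : Subgroup.closure S = ⊤) {g : G} (hg : g ≠ 1) : 1 ≤ wordLength S g := by
  by_contra h
  obtain ⟨l, h1, h2, h3⟩ := wl_exists hS g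
  have : l = [] := by
    rw [← List.length_eq_zero_iff]; omega
  subst this
  exact hg (by simpa using h3.symm)

theorem wl_pow_le (hS : Subgroup.closure S = ⊤) (g : G) (n : ℕ) :
    wordLength S (g ^ n) ≤ n * wordLength S g := by
  induction n with
  | zero => simp [wl_one]
  | succ n ih =>
    rw [pow_succ]
    refine le_trans (wl_mul_le hS _ _) ?_
    rw [Nat.succ_mul]; omega

theorem wl_split (hS : Subgroup.closure S = ⊤) {g : G} {m n : ℕ} (h : wordLength S g ≤ m + n) :
    ∃ a b, g = a * b ∧ wordLength S a ≤ m ∧ wordLength S b ≤ n := by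
  obtain ⟨l, h1, h2, rfl⟩ := wl_exists hS g
  refine ⟨(l.take m).prod, (l.drop m).prod, ?_, ?_, ?_⟩
  · rw [← List.prod_append, List.take_append_drop]
  · refine le_trans (wl_le fun x hx => h2 x (List.mem_of_mem_take hx)) (by simp)
  · refine le_trans (wl_le fun x hx => h2 x (List.mem_of_mem_drop hx)) ?_
    simp; omega

/-- The ball of radius `n`. -/
def wball (S : Set G) (n : ℕ) : Set G := {g | wordLength S g ≤ n}

theorem wball_succ (hS : Subgroup.closure S = ⊤) (m n : ℕ) :
    wball S (m + n) ⊆ Set.image2 (· * ·) (wball S m) (wball S n) := by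
  intro g hg
  obtain ⟨a, b, rfl, ha, hb⟩ := wl_split hS hg
  exact ⟨a, ha, b, hb, rfl⟩

theorem wball_one_finite (hS : Subgroup.closure S = ⊤) (hf : S.Finite) : (wball S 1).Finite := by
  refine ((hf.union hf.inv).union (Set.finite_singleton 1)).subset ?_
  intro g hg
  obtain ⟨l, h1, h2, rfl⟩ := wl_exists hS g
  change wordLength S _ ≤ 1 at hg
  rw [← h1] at hg
  match l, hg, h2 with
  | [], _, _ => right; simp
  | [x], _, h2 =>
    left
    have := h2 x (by simp)
    simpa using this
  | x :: y :: l, hg, _ => simp at hg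

theorem wball_finite (hS : Subgroup.closure S = ⊤) (hf : S.Finite) (n : ℕ) :
    (wball S n).Finite := by
  induction n with
  | zero =>
    refine (wball_one_finite hS hf).subset ?_
    intro g hg
    exact le_trans (show wordLength S g ≤ 0 from hg) zero_le_one
  | succ n ih => exact (ih.image2 _ (wball_one_finite hS hf)).subset (wball_succ hS n 1)

theorem ncard_wball_add (hS : Subgroup.closure S = ⊤) (hf : S.Finite) (m n : ℕ) :
    (wball S (m + n)).ncard ≤ (wball S m).ncard * (wball S n).ncard := by
  refine le_trans (Set.ncard_le_ncard (wball_succ hS m n)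
    ((wball_finite hS hf m).image2 _ (wball_finite hS hf n))) ?_
  rw [← Set.image_prod]
  refine le_trans (Set.ncard_image_le ((wball_finite hS hf m).prod (wball_finite hS hf n))) ?_
  rw [Set.ncard_prod]

theorem ncard_wball_pos (hS : Subgroup.closure S = ⊤) (hf : S.Finite) (n : ℕ) :
    1 ≤ (wball S n).ncard := by
  rw [Nat.one_le_iff_ne_zero, Ne, Set.ncard_eq_zero (wball_finite hS hf n)]
  rintro h
  have : (1 : G) ∈ wball S n := by simp [wball, wl_one]
  rw [h] at this; exact this

theorem ncard_wball_le (hS : Subgroup.closure S = ⊤) (hf : S.Finite) (n : ℕ) :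
    (wball S n).ncard ≤ (wball S 1).ncard ^ n := by
  induction n with
  | zero =>
    have : wball S 0 ⊆ {1} := by
      intro g hg
      by_contra hne
      have := wl_pos hS (g := g) hne
      change wordLength S g ≤ 0 at hg
      omega
    simpa using Set.ncard_le_ncard this
  | succ n ih =>
    refine le_trans (ncard_wball_add hS hf n 1) ?_
    rw [pow_succ]
    exact Nat.mul_le_mul_right _ ih

theorem tsum_ind {α : Type*} (A : Set α) (hA : A.Finite) :
    ∑' z, (if z ∈ A then (1 : ℝ≥0∞) else 0) = A.ncard := by
  rw [tsum_eq_sum (s := hA.toFinset)]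
  · rw [Set.ncard_eq_toFinset_card A hA, Finset.sum_congr rfl (g := fun _ => 1)]
    · simp
    · intro x hx
      rw [if_pos ((Set.Finite.mem_toFinset hA).1 hx)]
  · intro b hb
    rw [if_neg]
    rwa [Set.Finite.mem_toFinset] at hb

/-- moment generating constants are finite. -/
theorem moment_ball (hS : Subgroup.closure S = ⊤) (hf : S.Finite) (μ : G → ℝ≥0∞)
    (hmom : ∀ c : ℝ, 1 < c → ∑' g, μ g * ENNReal.ofReal (c ^ wordLength S g) ≠ ∞) (κ : ℕ) :
    ∑' g, μ g * (((wball S (wordLength S g)).ncard : ℝ≥0∞) * (κ : ℝ≥0∞) ^ wordLength S g) ≠ ∞ := by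
  refine ne_top_of_le_ne_top (hmom ((wball S 1).ncard * κ + 2)
    (by have : (0 : ℝ) ≤ (wball S 1).ncard * κ := by positivity
        linarith)) ?_
  refine ENNReal.tsum_le_tsum fun g => mul_le_mul_right ?_ _
  have h1 : ((wball S (wordLength S g)).ncard * κ ^ wordLength S g : ℕ) ≤
      ((wball S 1).ncard * κ + 2) ^ wordLength S g := by
    calc _ ≤ (wball S 1).ncard ^ wordLength S g * κ ^ wordLength S g :=
          Nat.mul_le_mul_right _ (ncard_wball_le hS hf _)
      _ = ((wball S 1).ncard * κ) ^ wordLength S g := by rw [mul_pow]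
      _ ≤ _ := Nat.pow_le_pow_left (by omega) _
  have h2 : ENNReal.ofReal (((wball S 1).ncard * κ + 2 : ℝ) ^ wordLength S g) =
      ((((wball S 1).ncard * κ + 2) ^ wordLength S g : ℕ) : ℝ≥0∞) := by
    rw [← ENNReal.ofReal_natCast]; push_cast; rfl
  rw [h2]
  exact_mod_cast h1

theorem moment_len (hS : Subgroup.closure S = ⊤) (hf : S.Finite) (μ : G → ℝ≥0∞)
    (hmom : ∀ c : ℝ, 1 < c → ∑' g, μ g * ENNReal.ofReal (c ^ wordLength S g) ≠ ∞) :
    ∑' g, μ g * (wordLength S g : ℝ≥0∞) ≠ ∞ := by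
  refine ne_top_of_le_ne_top (hmom 2 (by norm_num)) ?_
  refine ENNReal.tsum_le_tsum fun g => mul_le_mul_right ?_ _
  rw [← ENNReal.ofReal_natCast]
  refine ENNReal.ofReal_le_ofReal ?_
  exact_mod_cast (Nat.lt_two_pow_self (n := wordLength S g)).le

end WL

section FP
open Monoid
variable {ι : Type*} {M : ι → Type*} [∀ i, Group (M i)]

/-- Reduced lists of letters. -/
def Red (l : List (Σ i, M i)) : Prop := (∀ a ∈ l, a.2 ≠ 1) ∧ l.IsChain (fun a b => a.1 ≠ b.1)

/-- Product of a list of letters. -/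
def lprod (l : List (Σ i, M i)) : CoprodI M := (l.map fun a => CoprodI.of a.2).prod

/-- The reduced word of an element. -/
noncomputable def lett (g : CoprodI M) : List (Σ i, M i) := (CoprodI.Word.equiv g).toList

theorem lett_red (g : CoprodI M) : Red (lett g) :=
  ⟨fun a ha => (CoprodI.Word.equiv g).ne_one a ha, (CoprodI.Word.equiv g).chain_ne⟩

theorem lprod_lett (g : CoprodI M) : lprod (lett g) = g :=
  CoprodI.Word.equiv.symm_apply_apply g

theorem lett_lprod {l : List (Σ i, M i)} (h : Red l) : lett (lprod l) = l := by
  have := CoprodI.Word.equiv.apply_symm_apply (⟨l, h.1, h.2⟩ : CoprodI.Word M)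
  exact congrArg CoprodI.Word.toList this

theorem lett_inj {g h : CoprodI M} (e : lett g = lett h) : g = h := by
  rw [← lprod_lett g, ← lprod_lett h, e]

theorem lprod_append (l l' : List (Σ i, M i)) : lprod (l ++ l') = lprod l * lprod l' := by
  simp [lprod]

theorem lprod_singleton (a : Σ i, M i) : lprod [a] = CoprodI.of a.2 := by
  simp [lprod]

theorem lprod_nil : lprod ([] : List (Σ i, M i)) = 1 := by
  simp [lprod]

theorem Red.left {l l' : List (Σ i, M i)} (h : Red (l ++ l')) : Red l :=
  ⟨fun a ha => h.1 a (by simp [ha]), (List.isChain_append.1 h.2).1⟩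

theorem Red.right {l l' : List (Σ i, M i)} (h : Red (l ++ l')) : Red l' :=
  ⟨fun a ha => h.1 a (by simp [ha]), (List.isChain_append.1 h.2).2.1⟩

theorem Red.append {l l' : List (Σ i, M i)} (h : Red l) (h' : Red l')
    (hj : ∀ a ∈ l.getLast?, ∀ b ∈ l'.head?, a.1 ≠ b.1) : Red (l ++ l') := by
  refine ⟨fun a ha => ?_, List.isChain_append.2 ⟨h.2, h'.2, hj⟩⟩
  rcases List.mem_append.1 ha with h1 | h1
  · exact h.1 a h1
  · exact h'.1 a h1

theorem red_singleton {a : Σ i, M i} (h : a.2 ≠ 1) : Red [a] :=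
  ⟨by simpa using h, by simp⟩

theorem red_nil : Red ([] : List (Σ i, M i)) := ⟨by simp, by simp⟩

theorem lett_one : lett (1 : CoprodI M) = [] := by
  rw [← lprod_nil, lett_lprod red_nil]

theorem lett_of {i : ι} {x : M i} (hx : x ≠ 1) : lett (CoprodI.of x : CoprodI M) = [⟨i, x⟩] := by
  have := lett_lprod (red_singleton (a := (⟨i, x⟩ : Σ i, M i)) hx)
  rwa [lprod_singleton] at this

theorem lett_eq_of {g : CoprodI M} {l : List (Σ i, M i)} (h : Red l) (e : g = lprod l) :
    lett g = l := by rw [e, lett_lprod h]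

theorem lett_mul_of (g : CoprodI M) (i : ι) (s : M i) (hs : s ≠ 1) :
    (∃ p x, lett g = p ++ [⟨i, x⟩] ∧ x * s ≠ 1 ∧ lett (g * CoprodI.of s) = p ++ [⟨i, x * s⟩]) ∨
    (∃ p x, lett g = p ++ [⟨i, x⟩] ∧ x * s = 1 ∧ lett (g * CoprodI.of s) = p) ∨
    ((∀ a ∈ (lett g).getLast?, a.1 ≠ i) ∧ lett (g * CoprodI.of s) = lett g ++ [⟨i, s⟩]) := by
  by_cases h : ∀ a ∈ (lett g).getLast?, a.1 ≠ i
  · refine Or.inr (Or.inr ⟨h, lett_eq_of ?_ ?_⟩)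
    · exact (lett_red g).append (red_singleton hs) (fun a ha b hb => by
        simp at hb; subst hb; exact h a ha)
    · rw [lprod_append, lprod_lett, lprod_singleton]
  · push Not at h
    obtain ⟨⟨j, x⟩, ha, hj⟩ := h
    simp only at hj
    subst hj
    obtain ⟨p, hp⟩ := List.mem_getLast?_eq_getLast ha |>.elim fun h1 h2 =>
      (⟨(lett g).dropLast, by rw [h2, List.dropLast_append_getLast]⟩ :
        ∃ p, lett g = p ++ [⟨j, x⟩])
    have hr := lett_red g
    rw [hp] at hr
    have hg : g = lprod p * CoprodI.of x := by
      rw [← lprod_lett g, hp, lprod_append, lprod_singleton]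
    by_cases hxs : x * s = 1
    · refine Or.inr (Or.inl ⟨p, x, hp, hxs, lett_eq_of hr.left ?_⟩)
      rw [hg, mul_assoc, ← map_mul, hxs, map_one, mul_one]
    · refine Or.inl ⟨p, x, hp, hxs, lett_eq_of ?_ ?_⟩
      · refine hr.left.append (red_singleton hxs) ?_
        intro a ha b hb
        simp at hb; subst hb
        have := (List.isChain_append.1 hr.2).2.2 a ha ⟨j, x⟩ (by simp)
        exact this
      · rw [hg, mul_assoc, ← map_mul, lprod_append, lprod_singleton]

/-- The cone of `w`. -/
def cone (w : CoprodI M) : Set (CoprodI M) := {g | lett w <+: lett g}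

theorem cone_step {w y : CoprodI M} {i : ι} (s : M i) (hy : y ∉ cone w)
    (hs : y * CoprodI.of s ∈ cone w) : y * CoprodI.of s = w := by
  by_cases h1 : s = 1
  · subst h1; simp at hs; exact absurd hs hy
  simp only [cone, Set.mem_setOf_eq] at hy hs
  rcases lett_mul_of y i s h1 with ⟨p, x, e1, _, e2⟩ | ⟨p, x, e1, _, e2⟩ | ⟨_, e2⟩
  · rw [e2, List.prefix_concat_iff] at hs
    rcases hs with hs | hs
    · exact lett_inj (by rw [e2, hs])
    · exact absurd (by rw [e1]; exact hs.trans (List.prefix_append _ _)) hy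
  · rw [e2] at hs
    exact absurd (by rw [e1]; exact hs.trans (List.prefix_append _ _)) hy
  · rw [e2, List.prefix_concat_iff] at hs
    rcases hs with hs | hs
    · exact lett_inj (by rw [e2, hs])
    · exact absurd hs hy

theorem cone_path {w : CoprodI M} (l : List (CoprodI M))
    (hl : ∀ x ∈ l, ∃ i, ∃ s : M i, x = CoprodI.of s) : ∀ z, z ∉ cone w → z * l.prod ∈ cone w →
    ∃ l1 l2, l = l1 ++ l2 ∧ z * l1.prod = w := by
  induction l with
  | nil => intro z hz hz'; simp at hz'; exact absurd hz' hz
  | cons x l ih =>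
    intro z hz hz'
    by_cases h : z * x ∈ cone w
    · obtain ⟨i, s, rfl⟩ := hl x (by simp)
      exact ⟨[CoprodI.of s], l, rfl, by simpa using cone_step s hz h⟩
    · rw [List.prod_cons, ← mul_assoc] at hz'
      obtain ⟨l1, l2, e, hee⟩ := ih (fun y hy => hl y (by simp [hy])) _ h hz'
      exact ⟨x :: l1, l2, by rw [e]; rfl, by rw [List.prod_cons, ← mul_assoc, hee]⟩

/-- elements whose last letter is not of type `i`. -/
def VV (i : ι) : Set (CoprodI M) := {g | ∀ a ∈ (lett g).getLast?, a.1 ≠ i}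
/-- elements whose first letter is not of type `i`. -/
def TT (i : ι) : Set (CoprodI M) := {g | ∀ a ∈ (lett g).head?, a.1 ≠ i}

theorem lett_VV {i : ι} {w : CoprodI M} (hw : w ∈ VV i) {x : M i} (hx : x ≠ 1) :
    lett (w * CoprodI.of x) = lett w ++ [⟨i, x⟩] := by
  refine lett_eq_of ((lett_red w).append (red_singleton hx) fun a ha b hb => ?_) ?_
  · simp at hb; subst hb; exact hw a ha
  · rw [lprod_append, lprod_lett, lprod_singleton]

theorem mem_cone_VT {i : ι} {w g : CoprodI M} (hw : w ∈ VV i) (hg : g ∈ TT i) {x : M i}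
    (hx : x ≠ 1) : lett w ++ [⟨i, x⟩] <+: lett (w * CoprodI.of x * g) := by
  have h : lett (w * CoprodI.of x * g) = lett w ++ [⟨i, x⟩] ++ lett g := by
    refine lett_eq_of (Red.append (lett_VV hw hx ▸ lett_red _) (lett_red g) fun a ha b hb => ?_) ?_
    · simp at ha; subst ha; exact (hg b hb).symm
    · rw [lprod_append, lprod_append, lprod_lett, lprod_lett, lprod_singleton]
  rw [h]; exact List.prefix_append _ _

theorem not_VV {i : ι} {w g : CoprodI M} (hw : w ∉ VV i) {x : M i} :
    ¬ lett w ++ [⟨i, x⟩] <+: lett g := by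
  rintro ⟨t, ht⟩
  simp only [VV, Set.mem_setOf_eq, not_forall, not_not] at hw
  obtain ⟨a, ha, e⟩ := hw
  have h := (ht ▸ lett_red g).left
  exact (List.isChain_append.1 h.2).2.2 a ha ⟨i, x⟩ (by simp) e

theorem prefix_translate {i : ι} {w g : CoprodI M} {x : M i} (hx : x ≠ 1)
    (h : lett w ++ [⟨i, x⟩] <+: lett g) : w⁻¹ * g ∈ cone (CoprodI.of x : CoprodI M) := by
  obtain ⟨t, ht⟩ := h
  have hr := (ht ▸ lett_red g : Red (lett w ++ [⟨i, x⟩] ++ t))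
  rw [List.append_assoc] at hr ht
  have : lett (w⁻¹ * g) = [⟨i, x⟩] ++ t := by
    refine lett_eq_of hr.right ?_
    rw [← lprod_lett g, ← ht, lprod_append, lprod_lett, inv_mul_cancel_left]
  rw [cone, Set.mem_setOf_eq, lett_of hx, this]
  exact List.prefix_append _ _

theorem mul_mem_VV {i j : ι} (hij : j ≠ i) {b : M j} (hb : b ≠ 1) {w : CoprodI M}
    (hw : w ∉ VV i) : w * CoprodI.of b ∈ VV i := by
  have hw' := hw
  simp only [VV, Set.mem_setOf_eq, not_forall, not_not] at hw'
  obtain ⟨a, ha, e⟩ := hw'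
  have : w ∈ VV j := by
    intro a' ha' e'
    rw [Option.mem_unique ha' ha] at e'
    exact hij (e'.symm.trans e)
  intro c hc
  rw [lett_VV this hb] at hc
  simp at hc; subst hc; exact hij

theorem mul_mem_TT {i j : ι} (hij : j ≠ i) {b : M j} (hb : b ≠ 1) {g : CoprodI M}
    (hg : g ∉ TT i) : CoprodI.of b * g ∈ TT i := by
  simp only [TT, Set.mem_setOf_eq, not_forall, not_not] at hg
  obtain ⟨a, ha, e⟩ := hg
  have : lett (CoprodI.of b * g) = [⟨j, b⟩] ++ lett g := by
    refine lett_eq_of ((red_singleton hb).append (lett_red g) fun c hc d hd => ?_) ?_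
    · rw [Option.mem_unique hd ha, e]
      simp at hc; subst hc; exact hij
    · rw [lprod_append, lprod_lett, lprod_singleton]
  intro c hc
  rw [this] at hc
  simp at hc; subst hc; exact hij

theorem tsum_prefix (a : Σ i, M i) (L : List (Σ i, M i)) (hL : Red L) :
    ∑' w : CoprodI M, (if lett w ++ [a] <+: L then (1 : ℝ≥0∞) else 0) = L.count a := by
  induction L using List.reverseRecOn with
  | nil => simp
  | append_singleton L c ih =>
    have h1 : ∀ w : CoprodI M, (if lett w ++ [a] <+: L ++ [c] then (1 : ℝ≥0∞) else 0) =
        (if lett w ++ [a] <+: L then (1 : ℝ≥0∞) else 0) +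
          (if w = lprod L then (if c = a then 1 else 0) else 0) := by
      intro w
      simp only [List.prefix_concat_iff]
      by_cases h2 : lett w ++ [a] = L ++ [c]
      · obtain ⟨e1, e2⟩ := List.append_inj' h2 rfl
        have e3 : w = lprod L := by rw [← e1, lprod_lett]
        have h3 : ¬ lett w ++ [a] <+: L := by
          intro h
          have := h.length_le
          rw [h2] at this
          simp at this
        simp only [List.cons.injEq, and_true] at e2
        rw [if_pos (Or.inl h2), if_neg h3, if_pos e3, if_pos e2.symm, zero_add]
      · have h3 : (if w = lprod L then (if c = a then (1 : ℝ≥0∞) else 0) else 0) = 0 := by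
          split_ifs with h4 h5
          · exact absurd (by rw [h4, h5, lett_lprod hL.left]) h2
          · rfl
          · rfl
        rw [h3, add_zero]
        simp only [h2, false_or]
    simp only [h1]
    rw [ENNReal.tsum_add, ih hL.left, tsum_ite_eq, List.count_append]
    by_cases h5 : c = a <;> simp [h5]

/-- ends with the letter `a` -/
def endsW (a : Σ i, M i) : Set (CoprodI M) := {g | (lett g).getLast? = some a}

theorem endsW_mul {i j : ι} (hij : j ≠ i) {b : M j} (hb : b ≠ 1) {c : M i} (hc : c ≠ 1)
    {y : CoprodI M} (hy : y ∉ endsW (⟨i, c⟩ : Σ i, M i)) :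
    y * (CoprodI.of c⁻¹ * CoprodI.of b * CoprodI.of c) ∈ endsW (⟨i, c⟩ : Σ i, M i) := by
  have h1 : y * CoprodI.of c⁻¹ ∈ VV j := by
    have key : ∃ p z, lett (y * CoprodI.of c⁻¹) = p ++ [⟨i, z⟩] := by
      rcases lett_mul_of y i c⁻¹ (by simpa using hc) with
        ⟨p, x, e1, _, e2⟩ | ⟨p, x, e1, e0, e2⟩ | ⟨_, e2⟩
      · exact ⟨_, _, e2⟩
      · exfalso; apply hy
        have : x = c := mul_inv_eq_one.1 e0
        subst this
        simp [endsW, e1]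
      · exact ⟨_, _, e2⟩
    obtain ⟨p, z, e⟩ := key
    intro a ha
    rw [e] at ha; simp at ha; subst ha; exact hij.symm
  have h2 : y * CoprodI.of c⁻¹ * CoprodI.of b ∈ VV i := by
    intro a ha
    rw [lett_VV h1 hb] at ha; simp at ha; subst ha; exact hij
  rw [← mul_assoc, ← mul_assoc]
  rw [endsW, Set.mem_setOf_eq, lett_VV h2 hc]
  simp

end FP

section FPlen
open Monoid
variable {ι : Type*} {M : ι → Type*} [∀ i, Group (M i)] {Si : ∀ i, Set (M i)} {S : Set (CoprodI M)}

/-- the sum of lengths of letters -/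
noncomputable def lamL (Si : ∀ i, Set (M i)) (l : List (Σ i, M i)) : ℕ :=
  (l.map fun a => wordLength (Si a.1) a.2).sum

theorem lamL_append (l l' : List (Σ i, M i)) : lamL Si (l ++ l') = lamL Si l + lamL Si l' := by
  simp [lamL]
theorem lamL_singleton (a : Σ i, M i) : lamL Si [a] = wordLength (Si a.1) a.2 := by
  simp [lamL]

theorem fp_gen
    (hSgen : ∀ i, Subgroup.closure (Si i) = ⊤)
    (hS : S = ⋃ i, (CoprodI.of : M i →* CoprodI M) '' Si i) : Subgroup.closure S = ⊤ := by
  rw [eq_top_iff]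
  intro g _
  induction g using CoprodI.induction_on with
  | one => exact one_mem _
  | of i m =>
    have h : m ∈ Subgroup.closure (Si i) := by rw [hSgen i]; trivial
    have h2 := Subgroup.mem_map_of_mem (CoprodI.of : M i →* CoprodI M) h
    rw [MonoidHom.map_closure] at h2
    refine Subgroup.closure_mono ?_ h2
    rw [hS]
    exact Set.subset_iUnion (fun i => (CoprodI.of : M i →* CoprodI M) '' Si i) i
  | mul x y hx hy => exact mul_mem (hx trivial) (hy trivial)

theorem fp_fin [Finite ι]
    (hS : S = ⋃ i, (CoprodI.of : M i →* CoprodI M) '' Si i) (hSfin : ∀ i, (Si i).Finite) : S.Finite := by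
  rw [hS]; exact Set.finite_iUnion fun i => (hSfin i).image _

theorem fp_gen_form
    (hS : S = ⋃ i, (CoprodI.of : M i →* CoprodI M) '' Si i) {x : CoprodI M} (hx : x ∈ S ∨ x⁻¹ ∈ S) :
    ∃ i, ∃ s : M i, x = CoprodI.of s ∧ (s ∈ Si i ∨ s⁻¹ ∈ Si i) := by
  rw [hS] at hx
  simp only [Set.mem_iUnion, Set.mem_image] at hx
  rcases hx with ⟨i, s, h, rfl⟩ | ⟨i, s, h, e⟩
  · exact ⟨i, s, rfl, Or.inl h⟩
  · exact ⟨i, s⁻¹, by rw [map_inv, e, inv_inv], Or.inr (by simpa using h)⟩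

theorem fp_of_le
    (hSgen : ∀ i, Subgroup.closure (Si i) = ⊤)
    (hS : S = ⋃ i, (CoprodI.of : M i →* CoprodI M) '' Si i) {i : ι} (x : M i) :
    wordLength S (CoprodI.of x : CoprodI M) ≤ wordLength (Si i) x := by
  obtain ⟨l, h1, h2, rfl⟩ := wl_exists (hSgen i) x
  rw [← h1, map_list_prod]
  refine le_trans (wl_le ?_) (by simp)
  intro y hy
  simp only [List.mem_map] at hy
  obtain ⟨z, hz, rfl⟩ := hy
  rw [hS]
  rcases h2 z hz with h | h
  · left; exact Set.mem_iUnion.2 ⟨i, z, h, rfl⟩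
  · right; exact Set.mem_iUnion.2 ⟨i, z⁻¹, h, by simp⟩

theorem lam_step
    (hSgen : ∀ i, Subgroup.closure (Si i) = ⊤) (y : CoprodI M) {i : ι} (s : M i) (hs : s ∈ Si i ∨ s⁻¹ ∈ Si i) :
    lamL Si (lett (y * CoprodI.of s)) ≤ lamL Si (lett y) + 1 := by
  by_cases h1 : s = 1
  · subst h1; simp
  rcases lett_mul_of y i s h1 with ⟨p, x, e1, _, e2⟩ | ⟨p, x, e1, _, e2⟩ | ⟨_, e2⟩
  · rw [e1, e2, lamL_append, lamL_append, lamL_singleton, lamL_singleton]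
    have := wl_mul_le (hSgen i) x s
    have := wl_gen hs
    simp only; omega
  · rw [e1, e2, lamL_append]; omega
  · rw [e2, lamL_append, lamL_singleton]
    have := wl_gen hs
    simp only; omega

theorem fp_len
    (hSgen : ∀ i, Subgroup.closure (Si i) = ⊤)
    (hS : S = ⋃ i, (CoprodI.of : M i →* CoprodI M) '' Si i) (g : CoprodI M) : wordLength S g = lamL Si (lett g) := by
  apply le_antisymm
  · have : ∀ l : List (Σ i, M i), wordLength S (lprod l) ≤ lamL Si l := by
      intro l
      induction l with
      | nil => simp [lprod, wl_one]
      | cons a l ih =>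
        have e : a :: l = [a] ++ l := rfl
        rw [e, lprod_append, lamL_append, lprod_singleton, lamL_singleton]
        refine le_trans (wl_mul_le (fp_gen hSgen hS) _ _) ?_
        have := fp_of_le hSgen hS a.2
        omega
    simpa [lprod_lett] using this (lett g)
  · obtain ⟨l, h1, h2, rfl⟩ := wl_exists (fp_gen hSgen hS) g
    rw [← h1]
    clear h1
    induction l using List.reverseRecOn with
    | nil => simp [lett_one, lamL]
    | append_singleton l x ih =>
      obtain ⟨i, s, rfl, hs⟩ := fp_gen_form hS (h2 x (by simp))
      rw [List.prod_append, List.prod_singleton, List.length_append]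
      refine le_trans (lam_step hSgen _ s hs) ?_
      have := ih (fun x hx => h2 x (by simp [hx]))
      simpa using this

theorem fp_len_of
    (hSgen : ∀ i, Subgroup.closure (Si i) = ⊤)
    (hS : S = ⋃ i, (CoprodI.of : M i →* CoprodI M) '' Si i) {i : ι} (x : M i) :
    wordLength S (CoprodI.of x : CoprodI M) = wordLength (Si i) x := by
  by_cases hx : x = 1
  · subst hx; rw [map_one, wl_one, wl_one]
  · rw [fp_len hSgen hS, lett_of hx, lamL_singleton]

theorem cone_len
    (hSgen : ∀ i, Subgroup.closure (Si i) = ⊤)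
    (hS : S = ⋃ i, (CoprodI.of : M i →* CoprodI M) '' Si i) {w g : CoprodI M} (h : g ∈ cone w) : wordLength S w ≤ wordLength S g := by
  rw [fp_len hSgen hS, fp_len hSgen hS]
  obtain ⟨t, ht⟩ := (h : lett w <+: lett g)
  rw [← ht, lamL_append]; omega

theorem cone_cross
    (hSgen : ∀ i, Subgroup.closure (Si i) = ⊤)
    (hS : S = ⋃ i, (CoprodI.of : M i →* CoprodI M) '' Si i) {w z z' : CoprodI M} (hz : z ∉ cone w) (hz' : z' ∈ cone w) :
    wordLength S (z⁻¹ * w) ≤ wordLength S (z⁻¹ * z') ∧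
    wordLength S (w⁻¹ * z') ≤ wordLength S (z⁻¹ * z') := by
  obtain ⟨l, h1, h2, h3⟩ := wl_exists (fp_gen hSgen hS) (z⁻¹ * z')
  have e : z' = z * l.prod := by rw [h3]; group
  rw [e] at hz'
  obtain ⟨l1, l2, rfl, e'⟩ := cone_path l (fun x hx => by
    obtain ⟨i, s, e, _⟩ := fp_gen_form hS (h2 x hx); exact ⟨i, s, e⟩) z hz hz'
  rw [← h1, List.length_append]
  have e1 : z⁻¹ * w = l1.prod := by rw [← e']; group
  have e2 : w⁻¹ * z' = l2.prod := by rw [e, ← e', List.prod_append]; group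
  rw [e1, e2]
  have a1 := wl_le (S := S) (l := l1) (fun x hx => h2 x (by simp [hx]))
  have a2 := wl_le (S := S) (l := l2) (fun x hx => h2 x (by simp [hx]))
  omega

end FPlen

section Decay
variable {G : Type*} [Group G]

/-- sum of squares -/
noncomputable def qf (F : G → ℝ≥0∞) : ℝ≥0∞ := ∑' y, F y ^ 2

theorem enn_two_mul_le (a b : ℝ≥0∞) : 2 * (a * b) ≤ a ^ 2 + b ^ 2 := by
  rcases eq_or_ne a ∞ with rfl | ha
  · simp
  rcases eq_or_ne b ∞ with rfl | hb
  · simp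
  lift a to NNReal using ha
  lift b to NNReal using hb
  norm_cast
  rw [← NNReal.coe_le_coe]
  push_cast
  nlinarith [sq_nonneg ((a : ℝ) - b)]

theorem enn_six_mul_le (a b : ℝ≥0∞) : 6 * (a * b) ≤ a ^ 2 + 9 * b ^ 2 := by
  rcases eq_or_ne a ∞ with rfl | ha
  · simp
  rcases eq_or_ne b ∞ with rfl | hb
  · simp
  lift a to NNReal using ha
  lift b to NNReal using hb
  norm_cast
  rw [← NNReal.coe_le_coe]
  push_cast
  nlinarith [sq_nonneg ((a : ℝ) - 3 * b)]

theorem corr_triv (F F' : G → ℝ≥0∞) (g : G) :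
    2 * ∑' y, F (y * g) * F' y ≤ qf F + qf F' := by
  rw [qf, qf, ← tsum_mul_right_shift (fun y => F y ^ 2) g, ← ENNReal.tsum_add,
    ← ENNReal.tsum_mul_left]
  exact ENNReal.tsum_le_tsum fun y => enn_two_mul_le _ _

theorem corr_nine (g : Fin 9 → G) (A : Fin 9 → Set G) (hdis : ∀ i j, i ≠ j → Disjoint (A i) (A j))
    (hA : ∀ i y, y ∉ A i → y * g i ∈ A i) (F F' : G → ℝ≥0∞) :
    2 * ∑ i, ∑' y, F (y * g i) * F' y ≤ 6 * (qf F + qf F') := by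
  have hind : ∀ y, ∑ i, (ind (A i) y : ℝ≥0∞) ≤ 1 := by
    intro y
    by_cases h : ∃ i, y ∈ A i
    · obtain ⟨i, hi⟩ := h
      rw [Finset.sum_eq_single i]
      · simp [ind, hi]
      · intro j _ hj
        have : y ∉ A j := fun h => Set.disjoint_left.1 (hdis j i hj) h hi
        simp [ind, this]
      · simp
    · push Not at h
      simp [ind, h]
  have hQ : ∀ F : G → ℝ≥0∞, ∑ i, ∑' y, 9 * (ind (A i) y * F y ^ 2) ≤ 9 * qf F := by
    intro F
    rw [← Summable.tsum_finsetSum (fun _ _ => ENNReal.summable), qf, ← ENNReal.tsum_mul_left]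
    refine ENNReal.tsum_le_tsum fun y => ?_
    rw [← Finset.mul_sum, ← Finset.sum_mul]
    refine mul_le_mul_right ?_ _
    calc _ ≤ 1 * F y ^ 2 := mul_le_mul_left (hind y) _
      _ = _ := one_mul _
  have h1 : ∀ i, 6 * ∑' y, F (y * g i) * F' y ≤
      qf F + qf F' + (∑' y, 9 * (ind (A i) y * F y ^ 2) + ∑' y, 9 * (ind (A i) y * F' y ^ 2)) := by
    intro i
    rw [qf, qf, ← tsum_mul_right_shift (fun y => F y ^ 2) (g i), ← ENNReal.tsum_add,
      ← tsum_mul_right_shift (fun y => 9 * (ind (A i) y * F y ^ 2)) (g i), ← ENNReal.tsum_add,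
      ← ENNReal.tsum_mul_left, ← ENNReal.tsum_add]
    refine ENNReal.tsum_le_tsum fun y => ?_
    by_cases hy : y ∈ A i
    · refine (enn_six_mul_le _ _).trans ?_
      have : (ind (A i) y : ℝ≥0∞) = 1 := by simp [ind, hy]
      rw [this, one_mul]
      refine add_le_add le_self_add le_add_self
    · rw [mul_comm (F _)]
      refine (enn_six_mul_le _ _).trans ?_
      have : (ind (A i) (y * g i) : ℝ≥0∞) = 1 := by simp [ind, hA i y hy]
      rw [this, one_mul]
      refine add_le_add le_add_self le_self_add
  have h2 := Finset.sum_le_sum fun i (_ : i ∈ Finset.univ) => h1 i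
  rw [Finset.sum_add_distrib, Finset.sum_add_distrib, Finset.sum_add_distrib, ← Finset.mul_sum] at h2
  have h3 := h2.trans (add_le_add_right (add_le_add (hQ F) (hQ F')) _)
  simp only [Finset.sum_const, Finset.card_univ, Fintype.card_fin, nsmul_eq_mul] at h3
  have h4 : (9 : ℕ) * qf F + (9 : ℕ) * qf F' + (9 * qf F + 9 * qf F') = 3 * (6 * (qf F + qf F')) := by
    push_cast; ring
  have h5 : (6 : ℝ≥0∞) * ∑ i, ∑' y, F (y * g i) * F' y = 3 * (2 * ∑ i, ∑' y, F (y * g i) * F' y) := by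
    ring
  rw [h4, h5] at h3
  exact (ENNReal.mul_le_mul_iff_right (by norm_num) (by norm_num)).1 h3

theorem inner_step (ν F F' : G → ℝ≥0∞) :
    ∑' y, stepOp ν F y * F' y = ∑' g, ν g * ∑' y, F (y * g) * F' y := by
  simp only [stepOp, ← ENNReal.tsum_mul_right, ← ENNReal.tsum_mul_left]
  rw [ENNReal.tsum_comm]
  refine tsum_congr fun g => tsum_congr fun y => by ring

/-- the averaging operator contracts -/
theorem inner_contr (g : Fin 9 → G) (A : Fin 9 → Set G)
    (hdis : ∀ i j, i ≠ j → Disjoint (A i) (A j))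
    (hA : ∀ i y, y ∉ A i → y * g i ∈ A i) (ν : G → ℝ≥0∞) (hν : ∑' g, ν g = 1)
    (hpos : ∀ g, ν g ≠ 0) : ∃ r : ℝ≥0∞, 0 < r ∧ r < 1 ∧ ∀ F F' : G → ℝ≥0∞,
      2 * ∑' y, stepOp ν F y * F' y ≤ r * (qf F + qf F') := by
  have hνtop : ∀ g, ν g ≤ 1 := fun g => by rw [← hν]; exact ENNReal.le_tsum g
  set c : ℝ≥0∞ := (Finset.univ.inf' ⟨0, Finset.mem_univ _⟩ fun i => ν (g i)) / 9 with hc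
  have hc0 : c ≠ 0 := by
    rw [hc, Ne, ENNReal.div_eq_zero_iff]
    push Not
    refine ⟨?_, by norm_num⟩
    obtain ⟨i, _, hi⟩ := Finset.exists_mem_eq_inf' (s := (Finset.univ : Finset (Fin 9)))
      ⟨0, Finset.mem_univ _⟩ (fun i => ν (g i))
    rw [hi]; exact hpos _
  have hci : ∀ i, 9 * c ≤ ν (g i) := by
    intro i
    rw [hc, ENNReal.mul_div_cancel (by norm_num) (by norm_num)]
    exact Finset.inf'_le _ (Finset.mem_univ i)
  have hc9 : 9 * c ≤ 1 := (hci 0).trans (hνtop _)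
  have hcle : ∀ x, c * ∑ i, pt (g i) x ≤ ν x := by
    intro x
    by_cases hx : ∃ i, x = g i
    · obtain ⟨i, rfl⟩ := hx
      refine le_trans ?_ (hci i)
      rw [mul_comm]
      refine mul_le_mul_left ?_ _
      calc ∑ j, pt (g j) (g i) ≤ ∑ j : Fin 9, (1 : ℝ≥0∞) :=
            Finset.sum_le_sum fun j _ => by unfold pt; split_ifs <;> simp
        _ = 9 := by simp
    · push Not at hx
      have : ∑ i, pt (g i) x = 0 := Finset.sum_eq_zero fun i _ => by simp [pt, hx i]
      rw [this, mul_zero]; exact zero_le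
  set ν' : G → ℝ≥0∞ := fun x => ν x - c * ∑ i, pt (g i) x with hν'
  have hsplit : ∀ x, ν x = ν' x + c * ∑ i, pt (g i) x := fun x =>
    (tsub_add_cancel_of_le (hcle x)).symm
  have hsumpt : ∀ H : G → ℝ≥0∞, ∑' x, (c * ∑ i, pt (g i) x) * H x = c * ∑ i, H (g i) := by
    intro H
    simp only [mul_assoc, ENNReal.tsum_mul_left, Finset.sum_mul]
    rw [Summable.tsum_finsetSum (fun _ _ => ENNReal.summable)]
    congr 1
    refine Finset.sum_congr rfl fun i _ => ?_
    simp only [mul_comm (pt _ _)]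
    exact tsum_mul_pt H _
  have hmass : ∑' x, ν' x + 9 * c = 1 := by
    rw [← hν]
    have := hsumpt (fun _ => 1)
    simp only [mul_one, Finset.sum_const, Finset.card_univ, Fintype.card_fin, nsmul_eq_mul] at this
    rw [tsum_congr hsplit, ENNReal.tsum_add, this]
    push_cast; ring
  have hctop : c ≠ ∞ := by
    rintro h; rw [h] at hc9; simp at hc9
  refine ⟨∑' x, ν' x + 6 * c, ?_, ?_, ?_⟩
  · exact lt_of_lt_of_le (pos_iff_ne_zero.2 (mul_ne_zero (by norm_num) hc0)) le_add_self
  · rw [← hmass]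
    refine ENNReal.add_lt_add_left ?_ ?_
    · intro h; rw [h] at hmass; simp at hmass
    · exact ENNReal.mul_lt_mul_left hc0 hctop (by norm_num)
  · intro F F'
    rw [inner_step]
    simp only [hsplit, add_mul]
    rw [ENNReal.tsum_add, hsumpt, mul_add]
    refine add_le_add ?_ ?_
    · rw [← ENNReal.tsum_mul_left, ← ENNReal.tsum_mul_right]
      refine ENNReal.tsum_le_tsum fun x => ?_
      rw [mul_left_comm]
      exact mul_le_mul_right (corr_triv F F' x) _
    · rw [mul_left_comm]
      calc _ ≤ c * (6 * (qf F + qf F')) := mul_le_mul_right (corr_nine g A hdis hA F F') _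
        _ = _ := by ring

theorem stepOp_count (ν F : G → ℝ≥0∞) (hν : ∑' g, ν g = 1) : ∑' y, stepOp ν F y = ∑' y, F y := by
  have := inner_step ν F (fun _ => 1)
  simp only [mul_one, tsum_mul_right_shift] at this
  rw [this, ENNReal.tsum_mul_right, hν, one_mul]

theorem Ew_count (ν F : G → ℝ≥0∞) (hν : ∑' g, ν g = 1) (n : ℕ) :
    ∑' y, Ew ν n F y = ∑' y, F y := by
  induction n with
  | zero => rfl
  | succ n ih => rw [Ew_succ', stepOp_count ν _ hν, ih]

theorem qf_contr {ν F : G → ℝ≥0∞} {r : ℝ≥0∞} (hr0 : 0 < r) (hr1 : r < 1)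
    (h : ∀ F F' : G → ℝ≥0∞, 2 * ∑' y, stepOp ν F y * F' y ≤ r * (qf F + qf F'))
    (hfin : qf (stepOp ν F) ≠ ∞) : qf (stepOp ν F) ≤ r ^ 2 * qf F := by
  have hrt : r ≠ ∞ := ne_top_of_lt hr1
  have h1 := h F (fun y => r⁻¹ * stepOp ν F y)
  have h2 : ∑' y, stepOp ν F y * (r⁻¹ * stepOp ν F y) = r⁻¹ * qf (stepOp ν F) := by
    rw [qf, ← ENNReal.tsum_mul_left]
    exact tsum_congr fun y => by ring
  have h3 : qf (fun y => r⁻¹ * stepOp ν F y) = r⁻¹ * (r⁻¹ * qf (stepOp ν F)) := by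
    rw [qf, qf, ← ENNReal.tsum_mul_left, ← ENNReal.tsum_mul_left]
    exact tsum_congr fun y => by ring
  rw [h2, h3, mul_add, ← mul_assoc r r⁻¹, ENNReal.mul_inv_cancel hr0.ne' hrt, one_mul, two_mul] at h1
  have h4 : r⁻¹ * qf (stepOp ν F) ≤ r * qf F :=
    (ENNReal.add_le_add_iff_right (ENNReal.mul_ne_top (ENNReal.inv_ne_top.2 hr0.ne') hfin)).1 h1
  calc qf (stepOp ν F) = r * (r⁻¹ * qf (stepOp ν F)) := by
        rw [← mul_assoc, ENNReal.mul_inv_cancel hr0.ne' hrt, one_mul]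
    _ ≤ r * (r * qf F) := mul_le_mul_right h4 _
    _ = _ := by ring

theorem Ew_decay {ν : G → ℝ≥0∞} (hν : ∑' g, ν g = 1) {r : ℝ≥0∞} (hr0 : 0 < r) (hr1 : r < 1)
    (h : ∀ F F' : G → ℝ≥0∞, 2 * ∑' y, stepOp ν F y * F' y ≤ r * (qf F + qf F'))
    (a : G) (j : ℕ) (y : G) : Ew ν j (pt a) y ≤ r ^ j := by
  have hle : ∀ j y, Ew ν j (pt a) y ≤ 1 := fun j y => by
    rw [Ew_pt]; exact convPow_le_one hν _ _
  have hfin : ∀ j, qf (Ew ν j (pt a)) ≠ ∞ := by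
    intro j
    have : qf (Ew ν j (pt a)) ≤ 1 := by
      have e : ∑' y, pt a y = (1 : ℝ≥0∞) := by simpa using tsum_mul_pt (fun _ => 1) a
      rw [← e, ← Ew_count ν _ hν j, qf]
      refine ENNReal.tsum_le_tsum fun y => ?_
      rw [sq]
      calc _ ≤ 1 * Ew ν j (pt a) y := mul_le_mul_left (hle j y) _
        _ = _ := one_mul _
    exact ne_top_of_le_ne_top ENNReal.one_ne_top this
  have hq : qf (Ew ν j (pt a)) ≤ (r ^ j) ^ 2 := by
    induction j with
    | zero =>
      rw [Ew_zero, qf, tsum_eq_single a]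
      · simp [pt]
      · intro b hb; simp [pt, hb]
    | succ j ih =>
      have := qf_contr (F := Ew ν j (pt a)) hr0 hr1 h (by rw [← Ew_succ']; exact hfin _)
      rw [← Ew_succ'] at this
      refine this.trans ?_
      calc _ ≤ r ^ 2 * (r ^ j) ^ 2 := mul_le_mul_right ih _
        _ = _ := by ring
  have h2 : Ew ν j (pt a) y ^ 2 ≤ (r ^ j) ^ 2 :=
    le_trans (ENNReal.le_tsum (f := fun y => Ew ν j (pt a) y ^ 2) y) hq
  exact (ENNReal.pow_le_pow_left_iff two_ne_zero).1 h2

/-- lazy resolvent measure -/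
noncomputable def rmeas (μ : G → ℝ≥0∞) (g : G) : ℝ≥0∞ := ∑' k : ℕ, 2⁻¹ ^ (k + 1) * convPow μ k g

theorem rmeas_step (μ F : G → ℝ≥0∞) :
    stepOp (rmeas μ) F = fun y => ∑' k : ℕ, 2⁻¹ ^ (k + 1) * Ew μ k F y := by
  funext y
  simp only [stepOp, rmeas, ← Ew_eq, ← ENNReal.tsum_mul_left, ← ENNReal.tsum_mul_right]
  rw [ENNReal.tsum_comm]
  exact tsum_congr fun k => tsum_congr fun g => by ring

theorem rmeas_ident (μ F : G → ℝ≥0∞) (y : G) :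
    stepOp μ (stepOp (rmeas μ) F) y + F y = 2 * stepOp (rmeas μ) F y := by
  have h1 : stepOp μ (stepOp (rmeas μ) F) y = ∑' k : ℕ, 2⁻¹ ^ (k + 1) * Ew μ (k + 1) F y := by
    rw [rmeas_step, stepOp_tsum]
    simp only [stepOp_smul, Ew_succ']
  have h2 : stepOp (rmeas μ) F y = ∑' k : ℕ, 2⁻¹ ^ (k + 1) * Ew μ k F y := by rw [rmeas_step]
  rw [h1, h2, tsum_eq_zero_add' (f := fun k : ℕ => 2⁻¹ ^ (k + 1) * Ew μ k F y) ENNReal.summable,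
    mul_add, ← ENNReal.tsum_mul_left, add_comm]
  congr 1
  · rw [Ew_zero, zero_add, pow_one, ← mul_assoc, ENNReal.mul_inv_cancel (by norm_num) (by norm_num),
      one_mul]
  · refine tsum_congr fun k => ?_
    rw [pow_succ' (2⁻¹ : ℝ≥0∞) (k + 1), ← mul_assoc, ← mul_assoc,
      ENNReal.mul_inv_cancel (by norm_num) (by norm_num), one_mul]

theorem rmeas_sum {μ : G → ℝ≥0∞} (hμ : ∑' g, μ g = 1) : ∑' g, rmeas μ g = 1 := by
  simp only [rmeas]
  rw [ENNReal.tsum_comm]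
  simp only [ENNReal.tsum_mul_left, convPow_sum hμ, mul_one]
  simp only [pow_succ, ENNReal.tsum_mul_right, ENNReal.tsum_geometric, ENNReal.one_sub_inv_two,
    inv_inv]
  exact ENNReal.mul_inv_cancel (by norm_num) (by norm_num)

theorem exp_decay (g : Fin 9 → G) (A : Fin 9 → Set G)
    (hdis : ∀ i j, i ≠ j → Disjoint (A i) (A j))
    (hA : ∀ i y, y ∉ A i → y * g i ∈ A i) (μ : G → ℝ≥0∞) (hμ : ∑' g, μ g = 1)
    (hadm : ∀ g, ∃ n, 0 < convPow μ n g) :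
    ∃ C ρ : ℝ≥0∞, C ≠ ∞ ∧ ρ < 1 ∧ ∀ n a, convPow μ n a ≤ C * ρ ^ n := by
  have hpos : ∀ g, rmeas μ g ≠ 0 := by
    intro g h
    obtain ⟨n, hn⟩ := hadm g
    have := ENNReal.tsum_eq_zero.1 h n
    rcases mul_eq_zero.1 this with h | h
    · exact absurd h (by simp)
    · exact hn.ne' h
  obtain ⟨r, hr0, hr1, hr⟩ := inner_contr g A hdis hA (rmeas μ) (rmeas_sum hμ) hpos
  have hr2 : 1 < min r⁻¹ 2 := lt_min (ENNReal.one_lt_inv.2 hr1) (by norm_num)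
  obtain ⟨t, ht1, ht2⟩ := exists_between hr2
  have htr : t * r < 1 := by
    have := (lt_min_iff.1 ht2).1
    have h3 := ENNReal.mul_lt_mul_left hr0.ne' (ne_top_of_lt hr1) this
    exact lt_of_lt_of_le h3 (ENNReal.inv_mul_le_one r)
  have ht2' : t < 2 := (lt_min_iff.1 ht2).2
  refine ⟨2 * (1 - t * r)⁻¹, 2 - t, ?_, ?_, ?_⟩
  · refine ENNReal.mul_ne_top (by norm_num) (ENNReal.inv_ne_top.2 ?_)
    exact (tsub_pos_of_lt htr).ne'
  · rw [ENNReal.sub_lt_iff_lt_right (ne_top_of_lt ht2') ht2'.le]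
    calc (2 : ℝ≥0∞) = 1 + 1 := by norm_num
      _ < 1 + t := ENNReal.add_lt_add_left (by norm_num) ht1
  intro n a
  set V := fun j => Ew (rmeas μ) j (pt a) with hV
  set f : G → ℝ≥0∞ := fun y => ∑' j : ℕ, t ^ j * V (j + 1) y with hf
  have hfb : ∀ y, f y ≤ (1 - t * r)⁻¹ := by
    intro y
    rw [← ENNReal.tsum_geometric]
    refine ENNReal.tsum_le_tsum fun j => ?_
    rw [mul_pow]
    refine mul_le_mul_right ?_ _
    refine (Ew_decay (rmeas_sum hμ) hr0 hr1 hr a (j + 1) y).trans ?_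
    exact pow_le_pow_of_le_one (zero_le) hr1.le (Nat.le_succ j)
  have hftop : ∀ y, f y ≠ ∞ := fun y => ne_top_of_le_ne_top
    (ENNReal.inv_ne_top.2 (tsub_pos_of_lt htr).ne') (hfb y)
  have hUf : ∀ y, stepOp μ f y ≤ (2 - t) * f y := by
    intro y
    have h1 : stepOp μ f y + ∑' j : ℕ, t ^ j * V j y = 2 * f y := by
      rw [hf, stepOp_tsum]
      simp only [stepOp_smul]
      rw [← ENNReal.tsum_add, ← ENNReal.tsum_mul_left]
      refine tsum_congr fun j => ?_
      rw [← mul_add, mul_left_comm]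
      congr 1
      simp only [hV, Ew_succ']
      exact rmeas_ident μ _ y
    have h2 : t * f y ≤ ∑' j : ℕ, t ^ j * V j y := by
      rw [tsum_eq_zero_add' (f := fun j : ℕ => t ^ j * V j y) ENNReal.summable, hf,
        ← ENNReal.tsum_mul_left]
      refine le_trans (le_of_eq ?_) le_add_self
      exact tsum_congr fun j => by ring
    have h3 : stepOp μ f y + t * f y ≤ (2 - t) * f y + t * f y := by
      rw [← add_mul, tsub_add_cancel_of_le ht2'.le, ← h1]
      exact add_le_add_right h2 _
    exact (ENNReal.add_le_add_iff_right
      (ENNReal.mul_ne_top (ne_top_of_lt ht2') (hftop y))).1 h3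
  have hEf : ∀ y, Ew μ n f y ≤ (2 - t) ^ n * f y := by
    induction n with
    | zero => intro y; simp [Ew_zero]
    | succ n ih =>
      intro y
      rw [Ew_succ']
      refine (stepOp_mono μ ih y).trans ?_
      rw [stepOp_smul, pow_succ, mul_assoc]
      exact mul_le_mul_right (hUf y) _
  have hpt : ∀ y, pt a y ≤ 2 * f y := by
    intro y
    have h1 : stepOp (rmeas μ) (pt a) y ≤ f y := by
      have := ENNReal.le_tsum (f := fun j : ℕ => t ^ j * V (j + 1) y) 0
      simpa [hf, hV, Ew_succ', Ew_zero] using this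
    refine le_trans ?_ (mul_le_mul_right h1 2)
    rw [← rmeas_ident]; exact le_add_self
  have h1 := Ew_mono μ n hpt 1
  rw [Ew_smul] at h1
  have h2 := Ew_pt μ n a 1
  simp only [inv_one, one_mul] at h2
  rw [← h2]
  refine h1.trans ?_
  calc 2 * Ew μ n f 1 ≤ 2 * ((2 - t) ^ n * (1 - t * r)⁻¹) :=
        mul_le_mul_right ((hEf 1).trans (mul_le_mul_right (hfb 1) _)) _
    _ = _ := by ring

end Decay

section Harnack
variable {G : Type*} [Group G] {S : Set G}

theorem gr_mul_le (μ : G → ℝ≥0∞) (m : ℕ) (h t : G) :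
    convPow μ m h⁻¹ * gr μ (h * t) ≤ gr μ t := by
  rw [gr, gr, ← ENNReal.tsum_mul_left]
  calc _ ≤ ∑' n, convPow μ (m + n) t := ENNReal.tsum_le_tsum fun n => by
        refine (convPow_mul_le μ m n _ _).trans (le_of_eq ?_)
        rw [inv_mul_cancel_left]
    _ ≤ _ := ENNReal.tsum_comp_le_tsum_of_injective (add_right_injective m) (fun n => convPow μ n t)

theorem gr_mul_le' (μ : G → ℝ≥0∞) (m : ℕ) (h t : G) :
    convPow μ m h⁻¹ * gr μ (t * h) ≤ gr μ t := by
  rw [gr, gr, ← ENNReal.tsum_mul_left]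
  calc _ ≤ ∑' n, convPow μ (n + m) t := ENNReal.tsum_le_tsum fun n => by
        rw [mul_comm]
        refine (convPow_mul_le μ n m _ _).trans (le_of_eq ?_)
        rw [mul_inv_cancel_right]
    _ ≤ _ := ENNReal.tsum_comp_le_tsum_of_injective (add_left_injective m) (fun n => convPow μ n t)

theorem harnack (hS : Subgroup.closure S = ⊤) (hf : S.Finite) (μ : G → ℝ≥0∞)
    (hμ : ∑' g, μ g = 1) (hadm : ∀ g, ∃ n, 0 < convPow μ n g) :
    ∃ κ : ℕ, 1 ≤ κ ∧ ∀ h t, gr μ (h * t) ≤ (κ : ℝ≥0∞) ^ wordLength S h * gr μ t ∧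
      gr μ (t * h) ≤ (κ : ℝ≥0∞) ^ wordLength S h * gr μ t := by
  choose m hm using hadm
  have h1 : ∀ h : G, ∃ k : ℕ, (convPow μ (m h⁻¹) h⁻¹)⁻¹ ≤ k := by
    intro h
    obtain ⟨k, hk⟩ := ENNReal.exists_nat_gt (ENNReal.inv_ne_top.2 (hm h⁻¹).ne')
    exact ⟨k, hk.le⟩
  choose k hk using h1
  obtain ⟨κ, hκ⟩ := ((wball_one_finite hS hf).image k).bddAbove
  have hstep : ∀ s ∈ wball S 1, ∀ t, gr μ (s * t) ≤ ((κ + 1 : ℕ) : ℝ≥0∞) * gr μ t ∧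
      gr μ (t * s) ≤ ((κ + 1 : ℕ) : ℝ≥0∞) * gr μ t := by
    intro s hs t
    have hc : (convPow μ (m s⁻¹) s⁻¹)⁻¹ ≤ ((κ + 1 : ℕ) : ℝ≥0∞) := by
      refine (hk s).trans ?_
      have : k s ≤ κ := hκ ⟨s, hs, rfl⟩
      exact_mod_cast this.trans (Nat.le_succ κ)
    have h0 := (hm s⁻¹).ne'
    have ht : convPow μ (m s⁻¹) s⁻¹ ≠ ∞ :=
      ne_top_of_le_ne_top ENNReal.one_ne_top (convPow_le_one hμ _ _)
    have aux : ∀ a b : ℝ≥0∞, convPow μ (m s⁻¹) s⁻¹ * a ≤ b → a ≤ ((κ + 1 : ℕ) : ℝ≥0∞) * b := by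
      intro a b hab
      calc a = (convPow μ (m s⁻¹) s⁻¹)⁻¹ * (convPow μ (m s⁻¹) s⁻¹ * a) := by
            rw [← mul_assoc, ENNReal.inv_mul_cancel h0 ht, one_mul]
        _ ≤ _ := mul_le_mul' hc hab
    exact ⟨aux _ _ (gr_mul_le μ _ s t), aux _ _ (gr_mul_le' μ _ s t)⟩
  refine ⟨κ + 1, by omega, ?_⟩
  intro h
  obtain ⟨l, h1, h2, rfl⟩ := wl_exists hS h
  rw [← h1]
  clear h1
  induction l with
  | nil => intro t; simp
  | cons x l ih =>
    intro t
    have hx : x ∈ wball S 1 := wl_gen (h2 x (by simp))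
    have ih' := ih (fun y hy => h2 y (by simp [hy]))
    rw [List.prod_cons, List.length_cons, pow_succ]
    constructor
    · rw [mul_assoc]
      refine ((hstep x hx _).1).trans ?_
      rw [mul_comm _ (((κ + 1 : ℕ) : ℝ≥0∞)), mul_assoc]
      exact mul_le_mul_right (ih' t).1 _
    · rw [← mul_assoc]
      refine ((ih' _).2).trans ?_
      rw [mul_assoc]
      exact mul_le_mul_right (hstep x hx t).2 _

theorem one_le_gr (μ : G → ℝ≥0∞) : 1 ≤ gr μ 1 := by
  have := ENNReal.le_tsum (f := fun n => convPow μ n (1 : G)) 0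
  simpa [convPow, gr] using this

theorem one_le_kgr {μ : G → ℝ≥0∞} {κ : ℕ} (hS : Subgroup.closure S = ⊤)
    (hH : ∀ h t, gr μ (h * t) ≤ (κ : ℝ≥0∞) ^ wordLength S h * gr μ t ∧
      gr μ (t * h) ≤ (κ : ℝ≥0∞) ^ wordLength S h * gr μ t) (x : G) :
    1 ≤ (κ : ℝ≥0∞) ^ wordLength S x * gr μ x := by
  refine (one_le_gr μ).trans ?_
  have := (hH x⁻¹ x).1
  rwa [inv_mul_cancel, wl_inv hS] at this

theorem tsum_len_ind (hS : Subgroup.closure S = ⊤) (hf : S.Finite) (z : G) (n : ℕ) :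
    ∑' w : G, (if wordLength S (z⁻¹ * w) ≤ n then (1 : ℝ≥0∞) else 0) = (wball S n).ncard := by
  rw [← tsum_ind _ (wball_finite hS hf n), ← tsum_mul_left_shift (fun w =>
    (if wordLength S (z⁻¹ * w) ≤ n then (1 : ℝ≥0∞) else 0)) z]
  simp only [inv_mul_cancel_left, wball, Set.mem_setOf_eq]

theorem gr_sum_ball (hS : Subgroup.closure S = ⊤) (hf : S.Finite) {μ : G → ℝ≥0∞} {κ : ℕ}
    (hκ : 1 ≤ κ) (hH : ∀ h t, gr μ (h * t) ≤ (κ : ℝ≥0∞) ^ wordLength S h * gr μ t ∧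
      gr μ (t * h) ≤ (κ : ℝ≥0∞) ^ wordLength S h * gr μ t) (y w : G) (n : ℕ) :
    ∑' z, gr μ (y⁻¹ * z) * (if wordLength S (z⁻¹ * w) ≤ n then (1 : ℝ≥0∞) else 0) ≤
      (κ : ℝ≥0∞) ^ wordLength S y * gr μ w * ((wball S n).ncard * (κ : ℝ≥0∞) ^ n) := by
  have hκ' : (1 : ℝ≥0∞) ≤ κ := by exact_mod_cast hκ
  have h1 : ∀ z, gr μ (y⁻¹ * z) * (if wordLength S (z⁻¹ * w) ≤ n then (1 : ℝ≥0∞) else 0) ≤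
      (κ : ℝ≥0∞) ^ wordLength S y * gr μ w * κ ^ n *
        (if wordLength S (w⁻¹ * z) ≤ n then (1 : ℝ≥0∞) else 0) := by
    intro z
    have e : wordLength S (w⁻¹ * z) = wordLength S (z⁻¹ * w) := by
      rw [← wl_inv hS]; congr 1; group
    rw [e]
    split_ifs with h
    · rw [mul_one, mul_one]
      refine ((hH _ _).1).trans ?_
      rw [wl_inv hS, mul_assoc]
      refine mul_le_mul_right ?_ _
      have h2 := (hH (w⁻¹ * z) w).2
      rw [mul_inv_cancel_left] at h2
      refine h2.trans ?_
      rw [mul_comm]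
      refine mul_le_mul_right (pow_le_pow_right₀ hκ' (e ▸ h)) _
    · simp
  refine (ENNReal.tsum_le_tsum h1).trans ?_
  rw [ENNReal.tsum_mul_left, tsum_len_ind hS hf]
  apply le_of_eq; ring

end Harnack

section Upper
open Monoid
variable {ι : Type*} {M : ι → Type*} [∀ i, Group (M i)] {Si : ∀ i, Set (M i)}
  {S : Set (CoprodI M)}

theorem ind_le_one {α : Type*} (A : Set α) (z : α) : (ind A z : ℝ≥0∞) ≤ 1 := by
  unfold ind; split_ifs <;> simp

theorem sum_Ew_le_gr {G : Type*} [Group G] (μ Φ : G → ℝ≥0∞) (n : ℕ) (y : G) :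
    ∑ k ∈ Finset.range n, Ew μ k Φ y ≤ ∑' z, gr μ (y⁻¹ * z) * Φ z := by
  simp only [Ew_kernel, gr, ← ENNReal.tsum_mul_right]
  rw [ENNReal.tsum_comm]
  exact ENNReal.sum_le_tsum _

theorem cone_upper (hSgen : ∀ i, Subgroup.closure (Si i) = ⊤)
    (hS : S = ⋃ i, (CoprodI.of : M i →* CoprodI M) '' Si i) (hf : S.Finite)
    {μ : CoprodI M → ℝ≥0∞} (hμ : ∑' g, μ g = 1) {κ : ℕ}
    (hκ : 1 ≤ κ) (hH : ∀ h t, gr μ (h * t) ≤ (κ : ℝ≥0∞) ^ wordLength S h * gr μ t ∧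
      gr μ (t * h) ≤ (κ : ℝ≥0∞) ^ wordLength S h * gr μ t) (w : CoprodI M) (m : ℕ)
    (y : CoprodI M) :
    Ew μ m (ind (cone w)) y ≤
      (1 + ∑' g, μ g * (((wball S (wordLength S g)).ncard : ℝ≥0∞) * (κ : ℝ≥0∞) ^ wordLength S g)) *
      ((κ : ℝ≥0∞) ^ wordLength S y * gr μ w) := by
  have hgen := fp_gen hSgen hS
  have hκ' : (1 : ℝ≥0∞) ≤ κ := by exact_mod_cast hκ
  rw [add_mul, one_mul]
  by_cases hy : y ∈ cone w
  · refine le_trans ?_ le_self_add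
    have h1 : Ew μ m (ind (cone w)) y ≤ 1 := by
      have := Ew_mono μ m (F' := fun _ => 1) (ind_le_one (cone w)) y
      rwa [Ew_const hμ] at this
    refine h1.trans ((one_le_kgr hgen hH w).trans ?_)
    exact mul_le_mul_left (pow_le_pow_right₀ hκ' (cone_len hSgen hS hy)) _
  · refine le_trans ?_ le_add_self
    refine (first_entrance μ (cone w) _ (fun z hz => by simp [ind, hz]) m y hy).trans ?_
    set Φ : CoprodI M → ℝ≥0∞ := fun z =>
      ∑' g, μ g * (if wordLength S (z⁻¹ * w) ≤ wordLength S g then (1 : ℝ≥0∞) else 0) with hΦ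
    refine le_trans (Finset.sum_le_sum fun k _ => Ew_mono μ k (F' := Φ) ?_ y) ?_
    · intro z
      by_cases hz : z ∈ cone w
      · simp [ind, hz]
      · refine le_trans (mul_le_of_le_one_left' (ind_le_one _ _)) ?_
        refine ENNReal.tsum_le_tsum fun g => mul_le_mul_right ?_ _
        by_cases hz' : z * g ∈ cone w
        · have := (cone_cross hSgen hS hz hz').1
          rw [inv_mul_cancel_left] at this
          rw [if_pos this]
          refine le_trans (mul_le_of_le_one_left' (ind_le_one _ _)) ?_
          have := Ew_mono μ (m - k - 1) (F' := fun _ => 1) (ind_le_one (cone w)) (z * g)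
          rwa [Ew_const hμ] at this
        · simp [ind, hz']
    · refine (sum_Ew_le_gr μ Φ m y).trans ?_
      simp only [hΦ, ← ENNReal.tsum_mul_left]
      rw [ENNReal.tsum_comm, ← ENNReal.tsum_mul_right]
      refine ENNReal.tsum_le_tsum fun g => ?_
      simp only [mul_left_comm _ (μ g)]
      rw [ENNReal.tsum_mul_left, mul_assoc]
      refine mul_le_mul_right ?_ _
      refine (gr_sum_ball hgen hf hκ hH y w _).trans (le_of_eq ?_)
      ring

/-- number of letters equal to `x` -/
noncomputable def nlet {i : ι} (x : M i) (g : CoprodI M) : ℝ≥0∞ :=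
  ((lett g).count ⟨i, x⟩ : ℕ)

/-- words with initial part `w x` -/
def pset {i : ι} (x : M i) (w : CoprodI M) : Set (CoprodI M) :=
  {g | lett w ++ [⟨i, x⟩] <+: lett g}

theorem nlet_eq {i : ι} (x : M i) :
    nlet x = fun g : CoprodI M => ∑' w : CoprodI M, ind (pset x w) g := by
  funext g
  rw [nlet, ← tsum_prefix _ _ (lett_red g)]
  refine tsum_congr fun w => ?_
  simp only [ind, pset, Set.mem_setOf_eq]

theorem nlet_upper (hSgen : ∀ i, Subgroup.closure (Si i) = ⊤)
    (hS : S = ⋃ i, (CoprodI.of : M i →* CoprodI M) '' Si i) (hf : S.Finite)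
    {μ : CoprodI M → ℝ≥0∞} (hμ : ∑' g, μ g = 1) {κ : ℕ}
    (hκ : 1 ≤ κ) (hH : ∀ h t, gr μ (h * t) ≤ (κ : ℝ≥0∞) ^ wordLength S h * gr μ t ∧
      gr μ (t * h) ≤ (κ : ℝ≥0∞) ^ wordLength S h * gr μ t) {i : ι} (x : M i) (hx : x ≠ 1) (n : ℕ) :
    Ew μ n (nlet x) 1 ≤ (n + 1) *
      ((1 + ∑' g, μ g * (((wball S (wordLength S g)).ncard : ℝ≥0∞) *
        (κ : ℝ≥0∞) ^ wordLength S g)) ^ 2 * gr μ (CoprodI.of x)) := by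
  have hgen := fp_gen hSgen hS
  set B := ∑' g, μ g * (((wball S (wordLength S g)).ncard : ℝ≥0∞) *
        (κ : ℝ≥0∞) ^ wordLength S g) with hB
  have hup := cone_upper hSgen hS hf hμ hκ hH (CoprodI.of x : CoprodI M)
  rw [← hB] at hup
  set g0 := gr μ (CoprodI.of x : CoprodI M) with hg0
  have hps : ∀ w m z, Ew μ m (ind (pset x w)) z ≤
      (1 + B) * ((κ : ℝ≥0∞) ^ wordLength S (w⁻¹ * z) * g0) := by
    intro w m z
    refine le_trans ?_ (hup m (w⁻¹ * z))
    rw [Ew_trans]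
    refine Ew_mono μ m ?_ z
    intro g
    by_cases hg : g ∈ pset x w
    · have := prefix_translate hx hg
      simp [ind, hg, this]
    · simp [ind, hg]
  set Φ : CoprodI M → CoprodI M → ℝ≥0∞ := fun w z =>
      ∑' g, μ g * ((if wordLength S (z⁻¹ * w) ≤ wordLength S g then (1 : ℝ≥0∞) else 0) *
        ((1 + B) * ((κ : ℝ≥0∞) ^ wordLength S g * g0))) with hΦ
  have hw : ∀ w, Ew μ n (ind (pset x w)) 1 ≤
      (if w = 1 then (1 + B) * g0 else 0) + ∑ k ∈ Finset.range n, Ew μ k (Φ w) 1 := by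
    intro w
    by_cases hw1 : w = 1
    · subst hw1
      rw [if_pos rfl]
      refine le_trans ?_ le_self_add
      simpa [wl_one] using hps 1 n 1
    · rw [if_neg hw1, zero_add]
      have h1 : (1 : CoprodI M) ∉ cone w := by
        intro h
        have h2 : lett w <+: lett (1 : CoprodI M) := h
        rw [lett_one, List.prefix_nil] at h2
        exact hw1 (lett_inj (by rw [h2, lett_one]))
      have hsub : ∀ z ∉ cone w, ind (pset x w) z = (0 : ℝ≥0∞) := by
        intro z hz
        have : z ∉ pset x w := fun h => hz ((List.prefix_append _ _).trans h)
        simp [ind, this]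
      refine (first_entrance μ (cone w) _ hsub n 1 h1).trans ?_
      refine Finset.sum_le_sum fun k _ => Ew_mono μ k ?_ 1
      intro z
      by_cases hz : z ∈ cone w
      · simp [ind, hz]
      · refine le_trans (mul_le_of_le_one_left' (ind_le_one _ _)) ?_
        refine ENNReal.tsum_le_tsum fun g => mul_le_mul_right ?_ _
        by_cases hz' : z * g ∈ cone w
        · obtain ⟨h3, h4⟩ := cone_cross hSgen hS hz hz'
          rw [inv_mul_cancel_left] at h3 h4
          rw [if_pos h3, one_mul]
          refine le_trans (mul_le_of_le_one_left' (ind_le_one _ _)) ?_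
          refine (hps w _ _).trans ?_
          have hκ' : (1 : ℝ≥0∞) ≤ κ := by exact_mod_cast hκ
          gcongr
        · simp [ind, hz']
  have hsumΦ : ∀ z, ∑' w, Φ w z ≤ (1 + B) * B * g0 := by
    intro z
    simp only [hΦ]
    rw [ENNReal.tsum_comm]
    simp only [ENNReal.tsum_mul_left, ENNReal.tsum_mul_right, tsum_len_ind hgen hf]
    rw [mul_assoc, mul_comm B, ← mul_assoc, hB, ← ENNReal.tsum_mul_left]
    exact ENNReal.tsum_le_tsum fun g => le_of_eq (by ring)
  rw [nlet_eq, Ew_tsum]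
  refine (ENNReal.tsum_le_tsum hw).trans ?_
  rw [ENNReal.tsum_add, tsum_ite_eq, Summable.tsum_finsetSum (fun _ _ => ENNReal.summable)]
  have h5 : ∀ k, ∑' w, Ew μ k (Φ w) 1 ≤ (1 + B) * B * g0 := by
    intro k
    have h6 := congrFun (Ew_tsum μ k Φ) 1
    rw [← h6]
    have := Ew_mono μ k (F' := fun _ => (1 + B) * B * g0) hsumΦ 1
    rwa [Ew_const hμ] at this
  calc _ ≤ (1 + B) * g0 + ∑ k ∈ Finset.range n, (1 + B) * B * g0 :=
        add_le_add_right (Finset.sum_le_sum fun k _ => h5 k) _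
    _ = (1 + B) * g0 * (1 + n * B) := by simp; ring
    _ ≤ (1 + B) * g0 * ((n + 1) * (1 + B)) := by
        refine mul_le_mul_right ?_ _
        have : ((n : ℝ≥0∞) + 1) * (1 + B) = (1 + n * B) + (n + B) := by ring
        rw [this]; exact le_self_add
    _ = _ := by ring

end Upper

section Lower
open Monoid
variable {ι : Type*} {M : ι → Type*} [∀ i, Group (M i)]

theorem Ew_ge_single {G : Type*} [Group G] (μ F : G → ℝ≥0∞) (m : ℕ) (y b : G) :
    convPow μ m b * F (y * b) ≤ Ew μ m F y := by
  rw [← Ew_eq]; exact ENNReal.le_tsum (f := fun g => convPow μ m g * F (y * g)) b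

theorem T_lower {μ : CoprodI M → ℝ≥0∞} (hμ : ∑' g, μ g = 1) {i j : ι} (hij : j ≠ i) {b : M j}
    (hb : b ≠ 1) (m k : ℕ) :
    convPow μ m (CoprodI.of b) ≤ Ew μ k (ind (TT i)) 1 + Ew μ (m + k) (ind (TT i)) 1 := by
  set c := convPow μ m (CoprodI.of b : CoprodI M) with hc
  have hc1 : c ≤ 1 := convPow_le_one hμ _ _
  have h1 : c * Ew μ k (ind (TT i)) (CoprodI.of b) ≤ Ew μ (m + k) (ind (TT i)) 1 := by
    rw [Ew_add]
    simpa using Ew_ge_single μ (Ew μ k (ind (TT i))) m 1 (CoprodI.of b)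
  have h2 : (1 : ℝ≥0∞) ≤ Ew μ k (ind (TT i)) 1 + Ew μ k (ind (TT i)) (CoprodI.of b) := by
    have e := Ew_trans μ (ind (TT i)) k (CoprodI.of b : CoprodI M) 1
    rw [mul_one] at e
    rw [e]
    have := congrFun (Ew_add_fun μ (ind (TT i)) (fun z => ind (TT i) (CoprodI.of b * z)) k) 1
    rw [← this]
    have h3 := Ew_mono μ k (F := fun _ => 1) (F' := fun y => ind (TT i) y +
      ind (TT i) (CoprodI.of b * y)) (fun y => by
        by_cases hy : y ∈ TT i
        · simp [ind, hy]
        · have := mul_mem_TT hij hb hy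
          simp [ind, this]) 1
    rwa [Ew_const hμ] at h3
  calc c ≤ c * (Ew μ k (ind (TT i)) 1 + Ew μ k (ind (TT i)) (CoprodI.of b)) :=
        le_mul_of_one_le_right' h2
    _ ≤ _ := by rw [mul_add]; exact add_le_add (mul_le_of_le_one_left' hc1) h1

theorem V_lower {μ : CoprodI M → ℝ≥0∞} (hμ : ∑' g, μ g = 1) {i j : ι} (hij : j ≠ i) {b : M j}
    (hb : b ≠ 1) (m k : ℕ) :
    convPow μ m (CoprodI.of b) ≤ Ew μ k (ind (VV i)) 1 + Ew μ (k + m) (ind (VV i)) 1 := by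
  set c := convPow μ m (CoprodI.of b : CoprodI M) with hc
  have hc1 : c ≤ 1 := convPow_le_one hμ _ _
  rw [Ew_add]
  have := congrFun (Ew_add_fun μ (ind (VV i)) (Ew μ m (ind (VV i))) k) (1 : CoprodI M)
  rw [← this]
  have h3 := Ew_mono μ k (F := fun _ => c) (F' := fun y => ind (VV i) y +
      Ew μ m (ind (VV i)) y) (fun y => by
        by_cases hy : y ∈ VV i
        · refine le_trans hc1 ?_
          simp [ind, hy]
        · have h1 := mul_mem_VV hij hb hy
          have h2 := Ew_ge_single μ (ind (VV i)) m y (CoprodI.of b)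
          refine le_trans ?_ (le_trans h2 le_add_self)
          simp [ind, h1, hc]) 1
  rwa [Ew_const hμ] at h3

theorem pset_lower {μ : CoprodI M → ℝ≥0∞} {i : ι} {a : M i}
    (ha : a ≠ 1) {w : CoprodI M} (hw : w ∈ VV i) (n : ℕ) :
    ∑ k ∈ Finset.range (n + 1), hit μ k w 1 * ∑ l ∈ Finset.range (n - k + 1),
      hit μ l (CoprodI.of a) 1 * Ew μ (n - k - l) (ind (TT i)) 1 ≤ Ew μ n (ind (pset a w)) 1 := by
  refine le_trans (Finset.sum_le_sum fun k _ => mul_le_mul_right ?_ _) (hit_le μ w _ n 1)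
  have e := Ew_trans μ (ind (pset a w)) (n - k) w 1
  rw [mul_one] at e
  rw [e]
  refine le_trans (Finset.sum_le_sum fun l _ => mul_le_mul_right ?_ _)
    (hit_le μ (CoprodI.of a) _ (n - k) 1)
  have e2 := Ew_trans μ (fun z => ind (pset a w) (w * z)) (n - k - l) (CoprodI.of a : CoprodI M) 1
  rw [mul_one] at e2
  rw [e2]
  refine Ew_mono μ _ ?_ 1
  intro g
  by_cases hg : g ∈ TT i
  · have : w * (CoprodI.of a * g) ∈ pset a w := by
      rw [← mul_assoc]; exact mem_cone_VT hw hg ha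
    simp [ind, hg, this]
  · simp [ind, hg]

theorem pset_lower2 {μ : CoprodI M → ℝ≥0∞} (hμ : ∑' g, μ g = 1) {i j : ι} (hij : j ≠ i) {b : M j}
    (hb : b ≠ 1) (m : ℕ) {a : M i} (ha : a ≠ 1) {w : CoprodI M} (hw : w ∈ VV i) (J I : ℕ) :
    convPow μ m (CoprodI.of b) * ((∑ k ∈ Finset.range (J + 1), convPow μ k w) *
      ∑ l ∈ Finset.range (I + 1), convPow μ l (CoprodI.of a)) ≤
    (Ew μ (J + I) (ind (pset a w)) 1 + Ew μ (J + I + m) (ind (pset a w)) 1) * gr μ 1 ^ 2 := by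
  set c := convPow μ m (CoprodI.of b : CoprodI M) with hc
  have key : c * ((∑ k ∈ Finset.range (J + 1), hit μ k w 1) *
      ∑ l ∈ Finset.range (I + 1), hit μ l (CoprodI.of a : CoprodI M) 1) ≤
      Ew μ (J + I) (ind (pset a w)) 1 + Ew μ (J + I + m) (ind (pset a w)) 1 := by
    have h1 : ∀ N ≥ J + I, ∑ k ∈ Finset.range (J + 1), ∑ l ∈ Finset.range (I + 1),
        hit μ k w 1 * (hit μ l (CoprodI.of a) 1 * Ew μ (N - k - l) (ind (TT i)) 1) ≤
        Ew μ N (ind (pset a w)) 1 := by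
      intro N hN
      refine le_trans ?_ (pset_lower ha hw N)
      refine le_trans (Finset.sum_le_sum fun k hk => ?_)
        (Finset.sum_le_sum_of_subset (Finset.range_mono (by omega : J + 1 ≤ N + 1)))
      rw [← Finset.mul_sum]
      refine mul_le_mul_right ?_ _
      refine Finset.sum_le_sum_of_subset (Finset.range_mono ?_)
      have := Finset.mem_range.1 hk
      omega
    refine le_trans ?_ (add_le_add (h1 (J + I) le_rfl) (h1 (J + I + m) (by omega)))
    rw [← Finset.sum_add_distrib, Finset.sum_mul, Finset.mul_sum]
    refine Finset.sum_le_sum fun k hk => ?_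
    rw [← Finset.sum_add_distrib, Finset.mul_sum, Finset.mul_sum]
    refine Finset.sum_le_sum fun l hl => ?_
    have hk' := Finset.mem_range.1 hk
    have hl' := Finset.mem_range.1 hl
    have e : J + I + m - k - l = m + (J + I - k - l) := by omega
    rw [← mul_add, ← mul_add, e, mul_left_comm]
    refine mul_le_mul_right ?_ _
    rw [mul_comm]
    exact mul_le_mul_right (T_lower hμ hij hb m _) _
  have hs : ∀ (x : CoprodI M) (n : ℕ), ∑ k ∈ Finset.range n, convPow μ k x ≤
      (∑ k ∈ Finset.range n, hit μ k x 1) * gr μ 1 := by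
    intro x n
    have := hit_sum_ge μ x 1 n
    simpa [Ew_pt] using this
  calc _ ≤ c * (((∑ k ∈ Finset.range (J + 1), hit μ k w 1) * gr μ 1) *
      ((∑ l ∈ Finset.range (I + 1), hit μ l (CoprodI.of a : CoprodI M) 1) * gr μ 1)) :=
        mul_le_mul_right (mul_le_mul' (hs _ _) (hs _ _)) _
    _ = c * ((∑ k ∈ Finset.range (J + 1), hit μ k w 1) *
      ∑ l ∈ Finset.range (I + 1), hit μ l (CoprodI.of a : CoprodI M) 1) * gr μ 1 ^ 2 := by ring
    _ ≤ _ := mul_le_mul_left key _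

theorem nlet_lower {μ : CoprodI M → ℝ≥0∞} (hμ : ∑' g, μ g = 1) {i j : ι} (hij : j ≠ i) {b : M j}
    (hb : b ≠ 1) (m : ℕ) {a : M i} (ha : a ≠ 1) (J I : ℕ) :
    convPow μ m (CoprodI.of b) ^ 2 * ((J + 1) *
      ∑ l ∈ Finset.range (I + 1), convPow μ l (CoprodI.of a)) ≤
    2 * gr μ 1 ^ 2 * (Ew μ (J + m + I) (nlet a) 1 + Ew μ (J + m + I + m) (nlet a) 1) := by
  set c := convPow μ m (CoprodI.of b : CoprodI M) with hc
  set A := ∑ l ∈ Finset.range (I + 1), convPow μ l (CoprodI.of a : CoprodI M) with hA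
  have h1 : c * ((∑ k ∈ Finset.range (J + m + 1), Ew μ k (ind (VV i)) 1) * A) ≤
      (Ew μ (J + m + I) (nlet a) 1 + Ew μ (J + m + I + m) (nlet a) 1) * gr μ 1 ^ 2 := by
    rw [nlet_eq, Ew_tsum, Ew_tsum]
    simp only []
    rw [← ENNReal.tsum_add, ← ENNReal.tsum_mul_right]
    simp only [← Ew_one_eq μ (ind (VV i))]
    rw [← Summable.tsum_finsetSum (fun _ _ => ENNReal.summable), ← ENNReal.tsum_mul_right,
      ← ENNReal.tsum_mul_left]
    refine ENNReal.tsum_le_tsum fun w => ?_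
    by_cases hw : w ∈ VV i
    · have := pset_lower2 hμ hij hb m ha hw (J + m) I
      simpa [ind, hw] using this
    · simp [ind, hw]
  have h2 : c * (J + 1) ≤ 2 * ∑ k ∈ Finset.range (J + m + 1), Ew μ k (ind (VV i)) 1 := by
    have h3 : c * (J + 1) ≤ ∑ k ∈ Finset.range (J + 1),
        (Ew μ k (ind (VV i)) 1 + Ew μ (k + m) (ind (VV i)) 1) := by
      refine le_trans (le_of_eq ?_) (Finset.sum_le_sum fun k _ => V_lower hμ hij hb m k)
      simp only [Finset.sum_const, Finset.card_range, nsmul_eq_mul]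
      push_cast; rw [mul_comm]
    refine h3.trans ?_
    rw [Finset.sum_add_distrib, two_mul]
    refine add_le_add (Finset.sum_le_sum_of_subset (Finset.range_mono (by omega))) ?_
    have e := Finset.sum_image (s := Finset.range (J + 1)) (g := fun k => k + m)
      (f := fun k => Ew μ k (ind (VV i)) 1) (fun x _ y _ h => by simpa using h)
    rw [← e]
    refine Finset.sum_le_sum_of_subset ?_
    intro x hx
    simp only [Finset.mem_image, Finset.mem_range] at hx ⊢
    omega
  calc c ^ 2 * ((J + 1) * A) = c * ((c * (J + 1)) * A) := by ring
    _ ≤ c * ((2 * ∑ k ∈ Finset.range (J + m + 1), Ew μ k (ind (VV i)) 1) * A) := by gcongr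
    _ = 2 * (c * ((∑ k ∈ Finset.range (J + m + 1), Ew μ k (ind (VV i)) 1) * A)) := by ring
    _ ≤ 2 * ((Ew μ (J + m + I) (nlet a) 1 + Ew μ (J + m + I + m) (nlet a) 1) * gr μ 1 ^ 2) :=
        mul_le_mul_right h1 _
    _ = _ := by ring

end Lower

section Gibbs
variable {G : Type*}

theorem entropy_eq {p : G → ℝ≥0∞} (hp : ∀ g, p g ≤ 1) :
    entropy p = ∑' g, p g * ENNReal.ofReal (-Real.log (p g).toReal) := by
  refine tsum_congr fun g => ?_
  rw [neg_mul_comm, ENNReal.ofReal_mul ENNReal.toReal_nonneg,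
    ENNReal.ofReal_toReal (ne_top_of_le_ne_top ENNReal.one_ne_top (hp g))]

theorem gibbs {p : G → ℝ≥0∞} (hp : ∑' g, p g = 1) (q : G → ℝ) (hq0 : ∀ g, 0 < q g)
    (hq : ∑' g, ENNReal.ofReal (q g) ≤ 1) :
    entropy p ≤ ∑' g, p g * ENNReal.ofReal (-Real.log (q g)) := by
  have hp1 : ∀ g, p g ≤ 1 := fun g => by rw [← hp]; exact ENNReal.le_tsum g
  have hq1 : ∀ g, q g ≤ 1 := fun g => by
    have := (ENNReal.le_tsum (f := fun g => ENNReal.ofReal (q g)) g).trans hq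
    exact ENNReal.ofReal_le_one.1 this
  have key : ∀ g, ENNReal.ofReal (-(p g).toReal * Real.log (p g).toReal) + p g ≤
      p g * ENNReal.ofReal (-Real.log (q g)) + ENNReal.ofReal (q g) := by
    intro g
    have hpt : p g ≠ ∞ := ne_top_of_le_ne_top ENNReal.one_ne_top (hp1 g)
    obtain ⟨x, hx⟩ : ∃ x : ℝ, x = (p g).toReal := ⟨_, rfl⟩
    have hx0 : 0 ≤ x := hx ▸ ENNReal.toReal_nonneg
    have hx1 : x ≤ 1 := by
      rw [hx]; exact ENNReal.toReal_le_of_le_ofReal zero_le_one (by simpa using hp1 g)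
    have e : p g = ENNReal.ofReal x := by rw [hx, ENNReal.ofReal_toReal hpt]
    rw [← hx, e, ← ENNReal.ofReal_mul hx0]
    have hlx : Real.log x ≤ 0 := Real.log_nonpos hx0 hx1
    have hlq : Real.log (q g) ≤ 0 := Real.log_nonpos (hq0 g).le (hq1 g)
    rw [← ENNReal.ofReal_add (by nlinarith) hx0, ← ENNReal.ofReal_add (by nlinarith) (hq0 g).le]
    refine ENNReal.ofReal_le_ofReal ?_
    rcases hx0.eq_or_lt with h0 | h0
    · rw [← h0]; simp; exact (hq0 g).le
    · have h1 := Real.log_le_sub_one_of_pos (div_pos (hq0 g) h0)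
      rw [Real.log_div (hq0 g).ne' h0.ne'] at h1
      have h2 : x * (Real.log (q g) - Real.log x) ≤ x * (q g / x - 1) :=
        mul_le_mul_of_nonneg_left h1 hx0
      have h3 : x * (q g / x - 1) = q g - x := by field_simp
      nlinarith
  have h2 := ENNReal.tsum_le_tsum key
  rw [ENNReal.tsum_add, ENNReal.tsum_add, hp] at h2
  have h3 := h2.trans (add_le_add_right hq _)
  exact (ENNReal.add_le_add_iff_right ENNReal.one_ne_top).1 h3

theorem entropy_conv_le [Group G] {p q : G → ℝ≥0∞} (hp : ∑' g, p g = 1) (hq : ∑' g, q g = 1) :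
    entropy (conv p q) ≤ entropy p + entropy q := by
  have hp1 : ∀ g, p g ≤ 1 := fun g => by rw [← hp]; exact ENNReal.le_tsum g
  have hq1 : ∀ g, q g ≤ 1 := fun g => by rw [← hq]; exact ENNReal.le_tsum g
  have hr : ∑' g, conv p q g = 1 := by
    have := tsum_conv p q (fun _ => 1)
    simpa [ENNReal.tsum_mul_left, hq, hp] using this
  have hr1 : ∀ g, conv p q g ≤ 1 := fun g => by rw [← hr]; exact ENNReal.le_tsum g
  rw [entropy_eq hr1, entropy_eq hp1, entropy_eq hq1, tsum_conv]
  have key : ∀ h k, p h * q k * ENNReal.ofReal (-Real.log (conv p q (h * k)).toReal) ≤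
      q k * (p h * ENNReal.ofReal (-Real.log (p h).toReal)) +
        p h * (q k * ENNReal.ofReal (-Real.log (q k).toReal)) := by
    intro h k
    by_cases h0 : p h = 0
    · simp [h0]
    by_cases k0 : q k = 0
    · simp [k0]
    have e : q k * (p h * ENNReal.ofReal (-Real.log (p h).toReal)) +
        p h * (q k * ENNReal.ofReal (-Real.log (q k).toReal)) = p h * q k *
        (ENNReal.ofReal (-Real.log (p h).toReal) + ENNReal.ofReal (-Real.log (q k).toReal)) := by
      ring
    rw [e]
    refine mul_le_mul_right ?_ _
    refine le_trans ?_ ENNReal.ofReal_add_le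
    refine ENNReal.ofReal_le_ofReal ?_
    have hpt : p h ≠ ∞ := ne_top_of_le_ne_top ENNReal.one_ne_top (hp1 h)
    have hqt : q k ≠ ∞ := ne_top_of_le_ne_top ENNReal.one_ne_top (hq1 k)
    have hp' := ENNReal.toReal_pos h0 hpt
    have hq' := ENNReal.toReal_pos k0 hqt
    have h1 : p h * q k ≤ conv p q (h * k) := by
      have := ENNReal.le_tsum (f := fun x => p x * q (x⁻¹ * (h * k))) h
      simpa [conv] using this
    have h2 := ENNReal.toReal_mono (ne_top_of_le_ne_top ENNReal.one_ne_top (hr1 _)) h1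
    rw [ENNReal.toReal_mul] at h2
    have h3 := Real.log_le_log (mul_pos hp' hq') h2
    rw [Real.log_mul hp'.ne' hq'.ne'] at h3
    linarith
  refine (ENNReal.tsum_le_tsum fun h => ENNReal.tsum_le_tsum fun k => key h k).trans ?_
  simp only [ENNReal.tsum_add, ENNReal.tsum_mul_left, ENNReal.tsum_mul_right, hp, hq, one_mul]
  exact le_rfl

theorem convPow_add' [Group G] (μ : G → ℝ≥0∞) (m n : ℕ) :
    convPow μ (m + n) = conv (convPow μ m) (convPow μ n) := by
  funext a; rw [convPow_add]; rfl

end Gibbs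

section Limits
variable {G : Type*} [Group G] {S : Set G}

/-- drift -/
noncomputable def drf (S : Set G) (p : G → ℝ≥0∞) : ℝ≥0∞ := ∑' g, p g * (wordLength S g : ℝ≥0∞)

theorem drf_conv_le (hS : Subgroup.closure S = ⊤) {p q : G → ℝ≥0∞} (hp : ∑' g, p g = 1)
    (hq : ∑' g, q g = 1) : drf S (conv p q) ≤ drf S p + drf S q := by
  rw [drf, tsum_conv]
  have key : ∀ h k, p h * q k * (wordLength S (h * k) : ℝ≥0∞) ≤
      q k * (p h * (wordLength S h : ℝ≥0∞)) + p h * (q k * (wordLength S k : ℝ≥0∞)) := by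
    intro h k
    have e : q k * (p h * (wordLength S h : ℝ≥0∞)) + p h * (q k * (wordLength S k : ℝ≥0∞)) =
      p h * q k * ((wordLength S h : ℝ≥0∞) + wordLength S k) := by ring
    rw [e]
    refine mul_le_mul_right ?_ _
    exact_mod_cast wl_mul_le hS h k
  refine (ENNReal.tsum_le_tsum fun h => ENNReal.tsum_le_tsum fun k => key h k).trans ?_
  simp only [ENNReal.tsum_add, ENNReal.tsum_mul_left, ENNReal.tsum_mul_right, hp, hq, one_mul]
  exact le_rfl

theorem drf_pow_le (hS : Subgroup.closure S = ⊤) {μ : G → ℝ≥0∞} (hμ : ∑' g, μ g = 1) (n : ℕ) :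
    drf S (convPow μ n) ≤ n * drf S μ := by
  induction n with
  | zero =>
    simp only [drf, convPow]
    rw [tsum_eq_single 1]
    · simp [wl_one]
    · intro b hb; simp [hb]
  | succ n ih =>
    rw [convPow_add', convPow_one]
    refine (drf_conv_le hS (convPow_sum hμ n) hμ).trans ?_
    push_cast
    rw [add_mul, one_mul]
    exact add_le_add_left ih _

/-- partition function -/
noncomputable def zf (S : Set G) (s : ℝ) : ℝ≥0∞ :=
  ∑' g : G, ENNReal.ofReal (Real.exp (-s * wordLength S g))

theorem zf_le (hS : Subgroup.closure S = ⊤) (hf : S.Finite) (s : ℝ) :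
    zf S s ≤ ∑' n : ℕ, ((wball S n).ncard : ℝ≥0∞) * ENNReal.ofReal (Real.exp (-s * n)) := by
  have h1 : ∀ g : G, ENNReal.ofReal (Real.exp (-s * wordLength S g)) ≤
      ∑' n : ℕ, (if g ∈ wball S n then (1 : ℝ≥0∞) else 0) * ENNReal.ofReal (Real.exp (-s * n)) := by
    intro g
    refine le_trans ?_ (ENNReal.le_tsum (wordLength S g))
    rw [if_pos (by simp [wball] : g ∈ wball S (wordLength S g)), one_mul]
  refine (ENNReal.tsum_le_tsum h1).trans ?_
  rw [ENNReal.tsum_comm]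
  simp only [ENNReal.tsum_mul_right, tsum_ind _ (wball_finite hS hf _)]
  exact le_rfl

theorem growth_tendsto (hS : Subgroup.closure S = ⊤) (hf : S.Finite) :
    ∃ v : ℝ, 0 ≤ v ∧
      Tendsto (fun n : ℕ => Real.log ((wball S n).ncard : ℝ) / n) atTop (nhds v) := by
  have hsub : Subadditive (fun n : ℕ => Real.log ((wball S n).ncard : ℝ)) := by
    intro m n
    have h1 : (0 : ℝ) < (wball S m).ncard := by exact_mod_cast ncard_wball_pos hS hf m
    have h2 : (0 : ℝ) < (wball S n).ncard := by exact_mod_cast ncard_wball_pos hS hf n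
    have h3 : (0 : ℝ) < (wball S (m + n)).ncard := by exact_mod_cast ncard_wball_pos hS hf (m + n)
    simp only
    rw [← Real.log_mul h1.ne' h2.ne']
    exact Real.log_le_log h3 (by exact_mod_cast ncard_wball_add hS hf m n)
  have hnn : ∀ n : ℕ, 0 ≤ Real.log ((wball S n).ncard : ℝ) / n := fun n =>
    div_nonneg (Real.log_natCast_nonneg _) (Nat.cast_nonneg _)
  have hb : BddBelow (Set.range fun n : ℕ => Real.log ((wball S n).ncard : ℝ) / n) :=
    ⟨0, by rintro _ ⟨n, rfl⟩; exact hnn n⟩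
  have ht := hsub.tendsto_lim hb
  exact ⟨_, ge_of_tendsto' ht hnn, ht⟩

theorem zf_ne_top (hS : Subgroup.closure S = ⊤) (hf : S.Finite) {v s : ℝ}
    (hv : Tendsto (fun n : ℕ => Real.log ((wball S n).ncard : ℝ) / n) atTop (nhds v))
    (hs : v < s) : zf S s ≠ ∞ := by
  refine ne_top_of_le_ne_top ?_ (zf_le hS hf s)
  have hsum : Summable fun n : ℕ => ((wball S n).ncard : ℝ) * Real.exp (-s * n) := by
    obtain ⟨r, hr1, hr2⟩ := exists_between hs
    have hgeo : Summable fun n : ℕ => (Real.exp (r - s)) ^ n :=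
      summable_geometric_of_lt_one (Real.exp_pos _).le (by rw [← Real.exp_zero]; exact Real.exp_lt_exp.2 (by linarith))
    refine Summable.of_norm_bounded_eventually_nat hgeo ?_
    filter_upwards [hv.eventually_lt_const hr1, eventually_gt_atTop 0] with n hn hn0
    have hn0' : (0 : ℝ) < n := by exact_mod_cast hn0
    have h1 : (0 : ℝ) < (wball S n).ncard := by exact_mod_cast ncard_wball_pos hS hf n
    rw [div_lt_iff₀ hn0'] at hn
    rw [Real.norm_of_nonneg (by positivity), ← Real.exp_nat_mul]
    calc ((wball S n).ncard : ℝ) * Real.exp (-s * n)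
        = Real.exp (Real.log ((wball S n).ncard : ℝ)) * Real.exp (-s * n) := by
          rw [Real.exp_log h1]
      _ = Real.exp (Real.log ((wball S n).ncard : ℝ) + -s * n) := by rw [Real.exp_add]
      _ ≤ _ := Real.exp_le_exp.2 (by nlinarith)
  have h2 : ∀ n : ℕ, ((wball S n).ncard : ℝ≥0∞) * ENNReal.ofReal (Real.exp (-s * n)) =
      ENNReal.ofReal (((wball S n).ncard : ℝ) * Real.exp (-s * n)) := by
    intro n
    rw [ENNReal.ofReal_mul (Nat.cast_nonneg _), ENNReal.ofReal_natCast]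
  simp only [h2]
  rw [← ENNReal.ofReal_tsum_of_nonneg (fun n => by positivity) hsum]
  exact ENNReal.ofReal_ne_top

theorem one_le_zf (s : ℝ) : 1 ≤ zf S s := by
  have := ENNReal.le_tsum (f := fun g : G => ENNReal.ofReal (Real.exp (-s * wordLength S g))) 1
  simpa [wl_one, zf] using this

theorem entropy_ne_top (hS : Subgroup.closure S = ⊤) (hf : S.Finite) {μ : G → ℝ≥0∞}
    (hμ : ∑' g, μ g = 1) (hL : drf S μ ≠ ∞) : entropy μ ≠ ∞ := by
  obtain ⟨v, hv0, hv⟩ := growth_tendsto hS hf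
  have hZ := zf_ne_top hS hf hv (lt_add_one v)
  set Z := (zf S (v + 1)).toReal with hZd
  have hZ1 : 1 ≤ Z := by
    have := ENNReal.toReal_mono hZ (one_le_zf (S := S) (v + 1))
    simpa using this
  have hZ0 : 0 < Z := by linarith
  have h := gibbs hμ (fun g => Real.exp (-(v + 1) * wordLength S g) / Z)
    (fun g => by positivity) (by
      simp only [div_eq_mul_inv]
      simp only [ENNReal.ofReal_mul (Real.exp_pos _).le]
      rw [ENNReal.tsum_mul_right, ENNReal.ofReal_inv_of_pos hZ0, hZd, ENNReal.ofReal_toReal hZ]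
      exact ENNReal.mul_inv_le_one _)
  refine ne_top_of_le_ne_top ?_ h
  have h2 : ∀ g, μ g * ENNReal.ofReal (-Real.log (Real.exp (-(v + 1) * wordLength S g) / Z)) =
      ENNReal.ofReal (v + 1) * (μ g * wordLength S g) + μ g * ENNReal.ofReal (Real.log Z) := by
    intro g
    rw [Real.log_div (Real.exp_pos _).ne' hZ0.ne', Real.log_exp]
    have : -(-(v + 1) * (wordLength S g : ℝ) - Real.log Z) =
      (v + 1) * wordLength S g + Real.log Z := by ring
    rw [this, ENNReal.ofReal_add (by positivity) (Real.log_nonneg hZ1),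
      ENNReal.ofReal_mul (by linarith), ENNReal.ofReal_natCast]
    ring
  simp only [h2]
  rw [ENNReal.tsum_add, ENNReal.tsum_mul_left, ENNReal.tsum_mul_right, hμ, one_mul]
  exact ENNReal.add_ne_top.2 ⟨ENNReal.mul_ne_top ENNReal.ofReal_ne_top hL, ENNReal.ofReal_ne_top⟩

theorem drf_pow_ne_top (hS : Subgroup.closure S = ⊤) {μ : G → ℝ≥0∞}
    (hμ : ∑' g, μ g = 1) (hL : drf S μ ≠ ∞) (n : ℕ) : drf S (convPow μ n) ≠ ∞ :=
  ne_top_of_le_ne_top (ENNReal.mul_ne_top (ENNReal.natCast_ne_top n) hL) (drf_pow_le hS hμ n)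

theorem entropy_tendsto (hS : Subgroup.closure S = ⊤) (hf : S.Finite) {μ : G → ℝ≥0∞}
    (hμ : ∑' g, μ g = 1) (hL : drf S μ ≠ ∞) : ∃ h : ℝ, 0 ≤ h ∧
      Tendsto (fun n : ℕ => (entropy (convPow μ n)).toReal / n) atTop (nhds h) := by
  have hfin : ∀ n, entropy (convPow μ n) ≠ ∞ := fun n =>
    entropy_ne_top hS hf (convPow_sum hμ n) (drf_pow_ne_top hS hμ hL n)
  have hsub : Subadditive (fun n : ℕ => (entropy (convPow μ n)).toReal) := by
    intro m n
    simp only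
    rw [← ENNReal.toReal_add (hfin m) (hfin n)]
    refine ENNReal.toReal_mono (ENNReal.add_ne_top.2 ⟨hfin m, hfin n⟩) ?_
    rw [convPow_add']
    exact entropy_conv_le (convPow_sum hμ m) (convPow_sum hμ n)
  have hnn : ∀ n : ℕ, 0 ≤ (entropy (convPow μ n)).toReal / n := fun n =>
    div_nonneg ENNReal.toReal_nonneg (Nat.cast_nonneg _)
  have ht := hsub.tendsto_lim ⟨0, by rintro _ ⟨n, rfl⟩; exact hnn n⟩
  exact ⟨_, ge_of_tendsto' ht hnn, ht⟩

theorem drf_tendsto (hS : Subgroup.closure S = ⊤) {μ : G → ℝ≥0∞}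
    (hμ : ∑' g, μ g = 1) (hL : drf S μ ≠ ∞) : ∃ h : ℝ, 0 ≤ h ∧
      Tendsto (fun n : ℕ => (drf S (convPow μ n)).toReal / n) atTop (nhds h) := by
  have hfin : ∀ n, drf S (convPow μ n) ≠ ∞ := drf_pow_ne_top hS hμ hL
  have hsub : Subadditive (fun n : ℕ => (drf S (convPow μ n)).toReal) := by
    intro m n
    simp only
    rw [← ENNReal.toReal_add (hfin m) (hfin n)]
    refine ENNReal.toReal_mono (ENNReal.add_ne_top.2 ⟨hfin m, hfin n⟩) ?_
    rw [convPow_add']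
    exact drf_conv_le hS (convPow_sum hμ m) (convPow_sum hμ n)
  have hnn : ∀ n : ℕ, 0 ≤ (drf S (convPow μ n)).toReal / n := fun n =>
    div_nonneg ENNReal.toReal_nonneg (Nat.cast_nonneg _)
  have ht := hsub.tendsto_lim ⟨0, by rintro _ ⟨n, rfl⟩; exact hnn n⟩
  exact ⟨_, ge_of_tendsto' ht hnn, ht⟩

end Limits

section Partition
open Monoid
variable {ι : Type*} {M : ι → Type*} [∀ i, Group (M i)]

/-- Partition function of reduced lists of given length. -/
noncomputable def YY (W : (Σ i, M i) → ℝ≥0∞) (k : ℕ) (o : Option ι) : ℝ≥0∞ :=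
  ∑' l : List (Σ i, M i), if Red l ∧ l.length = k ∧ (∀ a ∈ l.head?, some a.1 ≠ o)
    then (l.map W).prod else 0

theorem red_cons {a : Σ i, M i} {l : List (Σ i, M i)} :
    Red (a :: l) ↔ a.2 ≠ 1 ∧ Red l ∧ ∀ b ∈ l.head?, a.1 ≠ b.1 := by
  simp only [Red, List.isChain_cons, List.mem_cons, forall_eq_or_imp]
  tauto

theorem YY_zero (W : (Σ i, M i) → ℝ≥0∞) (o : Option ι) : YY W 0 o = 1 := by
  rw [YY, tsum_eq_single []]
  · rw [if_pos]
    · simp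
    · exact ⟨red_nil, rfl, by simp⟩
  · intro l hl
    rw [if_neg]
    rintro ⟨-, h, -⟩
    exact hl (List.length_eq_zero_iff.1 h)

theorem YY_succ (W : (Σ i, M i) → ℝ≥0∞) (k : ℕ) (o : Option ι) :
    YY W (k + 1) o = ∑' i : ι, (if some i ≠ o then 1 else 0) *
      ((∑' x : M i, if x ≠ 1 then W ⟨i, x⟩ else 0) * YY W k (some i)) := by
  have hinj : Function.Injective
      (fun p : (Σ i, M i) × List (Σ i, M i) => p.1 :: p.2) := by
    rintro ⟨a, l⟩ ⟨b, l'⟩ h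
    simpa using h
  rw [YY, ← hinj.tsum_eq]
  · rw [ENNReal.tsum_prod', ENNReal.tsum_sigma']
    refine tsum_congr fun i => ?_
    rw [← ENNReal.tsum_mul_right, ← ENNReal.tsum_mul_left]
    refine tsum_congr fun x => ?_
    rw [YY, ← ENNReal.tsum_mul_left, ← ENNReal.tsum_mul_left]
    refine tsum_congr fun l => ?_
    have e : (∀ b ∈ l.head?, some b.1 ≠ some i) ↔ (∀ b ∈ l.head?, i ≠ b.1) := by
      constructor
      · intro h b hb hh; exact h b hb (by rw [hh])
      · intro h b hb hh; exact h b hb (Option.some.inj hh).symm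
    simp only [red_cons, e, List.length_cons, List.head?_cons, Option.mem_some_iff,
      forall_eq', List.map_cons, List.prod_cons, Nat.add_right_cancel_iff]
    by_cases h1 : x ≠ 1 <;> by_cases h2 : some i ≠ o <;>
      by_cases h3 : Red l <;> by_cases h4 : l.length = k <;>
      by_cases h5 : (∀ b ∈ l.head?, i ≠ b.1) <;> simp only [h1, h2, h3, h4, h5, and_true, true_and,
        and_false, false_and, if_true, if_false, mul_zero, zero_mul, one_mul, not_true_eq_false, not_false_eq_true, implies_true]
    rw [if_pos ⟨⟨h1, h5⟩, h2⟩, if_pos h2, if_pos h1, if_pos h5, one_mul]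
  · intro l hl
    rw [Function.mem_support] at hl
    have : l.length = k + 1 := by
      by_contra hne
      apply hl
      rw [if_neg]; tauto
    match l, this with
    | a :: l, _ => exact ⟨(a, l), rfl⟩

theorem YY_congr (W W' : (Σ i, M i) → ℝ≥0∞)
    (h : ∀ i, (∑' x : M i, if x ≠ 1 then W ⟨i, x⟩ else 0) =
      ∑' x : M i, if x ≠ 1 then W' ⟨i, x⟩ else 0) (k : ℕ) (o : Option ι) :
    YY W k o = YY W' k o := by
  induction k generalizing o with
  | zero => rw [YY_zero, YY_zero]
  | succ k ih =>
    rw [YY_succ, YY_succ]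
    refine tsum_congr fun i => ?_
    rw [h i, ih]

theorem part_eq (W : (Σ i, M i) → ℝ≥0∞) :
    ∑' g : CoprodI M, ((lett g).map W).prod = ∑' k, YY W k none := by
  have hinj : Function.Injective (lett : CoprodI M → _) := fun g h e => lett_inj e
  have h1 : ∑' g : CoprodI M, ((lett g).map W).prod =
      ∑' l : List (Σ i, M i), if Red l then (l.map W).prod else 0 := by
    rw [← hinj.tsum_eq]
    · refine tsum_congr fun g => ?_
      rw [if_pos (lett_red g)]
    · intro l hl
      rw [Function.mem_support] at hl
      have : Red l := by
        by_contra hne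
        exact hl (if_neg hne)
      exact ⟨lprod l, lett_lprod this⟩
  rw [h1]
  simp only [YY]
  rw [ENNReal.tsum_comm]
  refine tsum_congr fun l => ?_
  rw [tsum_eq_single l.length]
  · simp
  · intro k hk
    rw [if_neg]; rintro ⟨-, h, -⟩; exact hk h.symm

theorem part_congr (W W' : (Σ i, M i) → ℝ≥0∞)
    (h : ∀ i, (∑' x : M i, if x ≠ 1 then W ⟨i, x⟩ else 0) =
      ∑' x : M i, if x ≠ 1 then W' ⟨i, x⟩ else 0) :
    ∑' g : CoprodI M, ((lett g).map W).prod = ∑' g : CoprodI M, ((lett g).map W').prod := by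
  rw [part_eq, part_eq]
  exact tsum_congr fun k => YY_congr W W' h k none
end Partition

section DV
open Monoid
variable {ι : Type*} {M : ι → Type*} [∀ i, Group (M i)] {Si : ∀ i, Set (M i)}
  {S : Set (CoprodI M)}

/-- The perturbation factor. -/
noncomputable def tau (A B : Σ i, M i) (δ δ' : ℝ) (c : Σ i, M i) : ℝ :=
  if c = A then 1 + δ else if c = B then 1 - δ' else 1

theorem tau_pos {A B : Σ i, M i} {δ δ' : ℝ} (h : 0 ≤ δ) (h' : δ' < 1) (c : Σ i, M i) :
    0 < tau A B δ δ' c := by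
  unfold tau; split_ifs <;> linarith

/-- The perturbed weight. -/
noncomputable def fwt (Si : ∀ i, Set (M i)) (s : ℝ) (A B : Σ i, M i) (δ δ' : ℝ)
    (c : Σ i, M i) : ℝ := Real.exp (-s * wordLength (Si c.1) c.2) * tau A B δ δ' c

theorem fwt_pos {s : ℝ} {A B : Σ i, M i} {δ δ' : ℝ} (h : 0 ≤ δ) (h' : δ' < 1) (c : Σ i, M i) :
    0 < fwt Si s A B δ δ' c := mul_pos (Real.exp_pos _) (tau_pos h h' c)

theorem fwt_prod_pos {s : ℝ} {A B : Σ i, M i} {δ δ' : ℝ} (h : 0 ≤ δ) (h' : δ' < 1)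
    (l : List (Σ i, M i)) : 0 < (l.map (fwt Si s A B δ δ')).prod := by
  induction l with
  | nil => simp
  | cons c l ih => simp only [List.map_cons, List.prod_cons]; exact mul_pos (fwt_pos h h' c) ih

theorem log_fwt {s : ℝ} {A B : Σ i, M i} (hAB : A ≠ B) {δ δ' : ℝ} (h : 0 ≤ δ) (h' : δ' < 1)
    (l : List (Σ i, M i)) : Real.log ((l.map (fwt Si s A B δ δ')).prod) =
      -s * lamL Si l + (l.count A : ℝ) * Real.log (1 + δ) + (l.count B : ℝ) * Real.log (1 - δ') := by
  induction l with
  | nil => simp [lamL]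
  | cons c l ih =>
    simp only [List.map_cons, List.prod_cons]
    rw [Real.log_mul (fwt_pos h h' c).ne' (fwt_prod_pos h h' l).ne', ih, fwt,
      Real.log_mul (Real.exp_pos _).ne' (tau_pos h h' c).ne', Real.log_exp]
    have e : (lamL Si (c :: l) : ℝ) = wordLength (Si c.1) c.2 + lamL Si l := by
      simp [lamL]
    rw [e, List.count_cons, List.count_cons]
    by_cases h1 : c = A
    · subst h1
      simp [tau, hAB]; ring
    · by_cases h2 : c = B
      · subst h2
        simp [tau, h1]; ring
      · simp [tau, h1, h2]; ring

theorem ofReal_list_prod (f : (Σ i, M i) → ℝ) (hf : ∀ c, 0 ≤ f c) (l : List (Σ i, M i)) :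
    ENNReal.ofReal ((l.map f).prod) = (l.map fun c => ENNReal.ofReal (f c)).prod := by
  induction l with
  | nil => simp
  | cons c l ih => simp [ENNReal.ofReal_mul (hf c), ih]

theorem exp_lam (s : ℝ) (l : List (Σ i, M i)) : Real.exp (-s * lamL Si l) =
    (l.map fun c => Real.exp (-s * wordLength (Si c.1) c.2)).prod := by
  induction l with
  | nil => simp [lamL]
  | cons c l ih =>
    rw [List.map_cons, List.prod_cons, ← ih, ← Real.exp_add]
    congr 1
    simp [lamL]; ring

theorem dv_part (hSgen : ∀ i, Subgroup.closure (Si i) = ⊤)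
    (hS : S = ⋃ i, (CoprodI.of : M i →* CoprodI M) '' Si i) {s : ℝ} {i : ι} {a b : M i}
    (ha : a ≠ 1) (hb : b ≠ 1) (hab : a ≠ b) {δ δ' : ℝ} (h : 0 ≤ δ) (h0' : 0 ≤ δ') (h' : δ' < 1)
    (heq : δ * Real.exp (-s * wordLength (Si i) a) = δ' * Real.exp (-s * wordLength (Si i) b)) :
    ∑' g : CoprodI M, ENNReal.ofReal (((lett g).map (fwt Si s ⟨i, a⟩ ⟨i, b⟩ δ δ')).prod) =
      zf S s := by
  have e1 : ∀ g : CoprodI M, ENNReal.ofReal (((lett g).map (fwt Si s ⟨i, a⟩ ⟨i, b⟩ δ δ')).prod) =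
      ((lett g).map fun c => ENNReal.ofReal (fwt Si s ⟨i, a⟩ ⟨i, b⟩ δ δ' c)).prod :=
    fun g => ofReal_list_prod _ (fun c => (fwt_pos h h' c).le) _
  have e2 : ∀ g : CoprodI M, ENNReal.ofReal (Real.exp (-s * wordLength S g)) =
      ((lett g).map fun c => ENNReal.ofReal (Real.exp (-s * wordLength (Si c.1) c.2))).prod :=
    fun g => by
      rw [fp_len hSgen hS, exp_lam]
      exact ofReal_list_prod (fun c => Real.exp (-s * wordLength (Si c.1) c.2))
        (fun c => (Real.exp_pos _).le) _
  rw [zf]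
  simp only [e1, e2]
  apply part_congr
  intro j
  by_cases hj : j = i
  · subst hj
    set D := ENNReal.ofReal (δ * Real.exp (-s * wordLength (Si j) a)) with hD
    have hsa : ∑' x : M j, (if x = a then D else 0) = D := by rw [tsum_ite_eq]
    have hsb : ∑' x : M j, (if x = b then D else 0) = D := by rw [tsum_ite_eq]
    have key : ∀ x : M j,
        (if x ≠ 1 then ENNReal.ofReal (fwt Si s ⟨j, a⟩ ⟨j, b⟩ δ δ' ⟨j, x⟩) else 0) +
          (if x = b then D else 0) =
        (if x ≠ 1 then ENNReal.ofReal (Real.exp (-s * wordLength (Si j) x)) else 0) +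
          (if x = a then D else 0) := by
      intro x
      by_cases h1 : x = a
      · subst h1
        rw [if_pos ha, if_neg hab, if_pos ha, if_pos rfl, add_zero, hD,
          ← ENNReal.ofReal_add (Real.exp_pos _).le (mul_nonneg h (Real.exp_pos _).le)]
        congr 1
        simp [fwt, tau]; ring
      · by_cases h2 : x = b
        · subst h2
          rw [if_pos hb, if_pos rfl, if_pos hb, if_neg h1, add_zero, hD, heq,
            ← ENNReal.ofReal_add (fwt_pos h h' _).le (mul_nonneg h0' (Real.exp_pos _).le)]
          congr 1
          simp [fwt, tau, h1]; ring
        · simp [h1, h2, fwt, tau]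
    have := tsum_congr (L := .unconditional _) key
    rw [ENNReal.tsum_add, ENNReal.tsum_add, hsa, hsb] at this
    exact (ENNReal.add_left_inj ENNReal.ofReal_ne_top).1 this
  · refine tsum_congr fun x => ?_
    have n1 : (⟨j, x⟩ : Σ i, M i) ≠ ⟨i, a⟩ := fun e => hj (congrArg Sigma.fst e)
    have n2 : (⟨j, x⟩ : Σ i, M i) ≠ ⟨i, b⟩ := fun e => hj (congrArg Sigma.fst e)
    simp [fwt, tau, n1, n2]

theorem dv (hSgen : ∀ i, Subgroup.closure (Si i) = ⊤)
    (hS : S = ⋃ i, (CoprodI.of : M i →* CoprodI M) '' Si i) {s : ℝ} (hs : 0 ≤ s)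
    (hZ : zf S s ≠ ∞) {i : ι} {a b : M i}
    (ha : a ≠ 1) (hb : b ≠ 1) (hab : a ≠ b) {δ δ' : ℝ} (h : 0 ≤ δ) (h0' : 0 ≤ δ') (h' : δ' < 1)
    (heq : δ * Real.exp (-s * wordLength (Si i) a) = δ' * Real.exp (-s * wordLength (Si i) b))
    {p : CoprodI M → ℝ≥0∞} (hp : ∑' g, p g = 1) :
    entropy p + ENNReal.ofReal (Real.log (1 + δ)) * ∑' g, p g * nlet a g ≤
      ENNReal.ofReal s * drf S p + ENNReal.ofReal (Real.log (zf S s).toReal) +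
      ENNReal.ofReal (-Real.log (1 - δ')) * ∑' g, p g * nlet b g := by
  set Z := (zf S s).toReal with hZd
  have hZ1 : 1 ≤ Z := by
    have := ENNReal.toReal_mono hZ (one_le_zf (S := S) s)
    simpa using this
  have hZ0 : 0 < Z := by linarith
  set Q : CoprodI M → ℝ := fun g => ((lett g).map (fwt Si s ⟨i, a⟩ ⟨i, b⟩ δ δ')).prod with hQ
  have hQ0 : ∀ g, 0 < Q g := fun g => fwt_prod_pos h h' _
  have hq0 : ∀ g, 0 < Q g / Z := fun g => div_pos (hQ0 g) hZ0
  have hsum : ∑' g, ENNReal.ofReal (Q g / Z) ≤ 1 := by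
    have : ∀ g, ENNReal.ofReal (Q g / Z) = ENNReal.ofReal (Q g) * (ENNReal.ofReal Z)⁻¹ := by
      intro g
      rw [ENNReal.ofReal_div_of_pos hZ0, div_eq_mul_inv]
    simp only [this]
    rw [ENNReal.tsum_mul_right, hQ, dv_part hSgen hS ha hb hab h h0' h' heq, hZd,
      ENNReal.ofReal_toReal hZ]
    exact ENNReal.mul_inv_le_one _
  have hg := gibbs hp _ hq0 hsum
  have hq1 : ∀ g, Q g / Z ≤ 1 := fun g =>
    ENNReal.ofReal_le_one.1 ((ENNReal.le_tsum (f := fun g => ENNReal.ofReal (Q g / Z)) g).trans hsum)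
  have hl1 : 0 ≤ Real.log (1 + δ) := Real.log_nonneg (by linarith)
  have hl2 : 0 ≤ -Real.log (1 - δ') := by
    have := Real.log_nonpos (x := 1 - δ') (by linarith) (by linarith)
    linarith
  have hAB : (⟨i, a⟩ : Σ i, M i) ≠ ⟨i, b⟩ := by
    intro e; exact hab (by simpa using e)
  have hterm : ∀ g, ENNReal.ofReal (-Real.log (Q g / Z)) +
      ENNReal.ofReal (Real.log (1 + δ)) * nlet a g =
      ENNReal.ofReal s * (wordLength S g : ℝ≥0∞) + ENNReal.ofReal (Real.log Z) +
        ENNReal.ofReal (-Real.log (1 - δ')) * nlet b g := by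
    intro g
    have hn : 0 ≤ -Real.log (Q g / Z) := by
      have := Real.log_nonpos (hq0 g).le (hq1 g)
      linarith
    have e1 : (nlet a g : ℝ≥0∞) = ENNReal.ofReal ((lett g).count ⟨i, a⟩ : ℝ) := by
      rw [ENNReal.ofReal_natCast]; rfl
    have e2 : (nlet b g : ℝ≥0∞) = ENNReal.ofReal ((lett g).count ⟨i, b⟩ : ℝ) := by
      rw [ENNReal.ofReal_natCast]; rfl
    have e3 : (wordLength S g : ℝ≥0∞) = ENNReal.ofReal (wordLength S g : ℝ) := by
      rw [ENNReal.ofReal_natCast]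
    rw [e1, e2, e3, ← ENNReal.ofReal_mul hl1, ← ENNReal.ofReal_mul hl2, ← ENNReal.ofReal_mul hs,
      ← ENNReal.ofReal_add hn (by positivity), ← ENNReal.ofReal_add (by positivity)
        (Real.log_nonneg hZ1), ← ENNReal.ofReal_add (add_nonneg (by positivity)
        (Real.log_nonneg hZ1)) (by positivity)]
    congr 1
    rw [Real.log_div (hQ0 g).ne' hZ0.ne', hQ]
    simp only
    rw [log_fwt hAB h h', ← fp_len hSgen hS]
    ring
  calc entropy p + ENNReal.ofReal (Real.log (1 + δ)) * ∑' g, p g * nlet a g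
      ≤ (∑' g, p g * ENNReal.ofReal (-Real.log (Q g / Z))) +
        ENNReal.ofReal (Real.log (1 + δ)) * ∑' g, p g * nlet a g := by gcongr
    _ = ∑' g, p g * (ENNReal.ofReal (-Real.log (Q g / Z)) +
      ENNReal.ofReal (Real.log (1 + δ)) * nlet a g) := by
        rw [← ENNReal.tsum_mul_left, ← ENNReal.tsum_add]
        refine tsum_congr fun g => ?_
        ring
    _ = _ := by
        simp only [hterm, mul_add]
        rw [ENNReal.tsum_add, ENNReal.tsum_add, ENNReal.tsum_mul_right, hp, one_mul, drf,
          ← ENNReal.tsum_mul_left, ← ENNReal.tsum_mul_left]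
        congr 1
        · congr 1
          refine tsum_congr fun g => ?_
          ring
        · refine tsum_congr fun g => ?_
          ring

theorem nlet_le_len (hSgen : ∀ i, Subgroup.closure (Si i) = ⊤)
    (hS : S = ⋃ i, (CoprodI.of : M i →* CoprodI M) '' Si i) {i : ι} {a : M i} (ha : a ≠ 1)
    (g : CoprodI M) : nlet a g ≤ (wordLength S g : ℝ≥0∞) := by
  have key : ∀ l : List (Σ i, M i), l.count ⟨i, a⟩ ≤ lamL Si l := by
    intro l
    induction l with
    | nil => simp [lamL]
    | cons c l ih =>
      have e : lamL Si (c :: l) = wordLength (Si c.1) c.2 + lamL Si l := by simp [lamL]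
      rw [e, List.count_cons]
      by_cases h1 : c = ⟨i, a⟩
      · subst h1
        have : 0 < wordLength (Si i) a := wl_pos (hSgen i) ha
        simp only [beq_self_eq_true, if_true]
        omega
      · simp only [beq_iff_eq, h1, if_false]; omega
  rw [fp_len hSgen hS]
  have := key (lett g)
  unfold nlet
  exact_mod_cast this

end DV

section Asym
open Monoid
variable {ι : Type*} {M : ι → Type*} [∀ i, Group (M i)] {Si : ∀ i, Set (M i)}
  {S : Set (CoprodI M)}

/-- expected number of letters -/
noncomputable def EN {i : ι} (μ : CoprodI M → ℝ≥0∞) (a : M i) (n : ℕ) : ℝ :=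
  (Ew μ n (nlet a) 1).toReal

theorem EN_nonneg {i : ι} (μ : CoprodI M → ℝ≥0∞) (a : M i) (n : ℕ) : 0 ≤ EN μ a n :=
  ENNReal.toReal_nonneg

theorem Ew_nlet_ne_top (hSgen : ∀ i, Subgroup.closure (Si i) = ⊤)
    (hS : S = ⋃ i, (CoprodI.of : M i →* CoprodI M) '' Si i) {μ : CoprodI M → ℝ≥0∞}
    (hμ : ∑' g, μ g = 1) (hL : drf S μ ≠ ∞) {i : ι} {a : M i} (ha : a ≠ 1) (n : ℕ) :
    Ew μ n (nlet a) 1 ≠ ∞ := by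
  rw [← Ew_one_eq]
  refine ne_top_of_le_ne_top (drf_pow_ne_top (fp_gen hSgen hS) hμ hL n) ?_
  exact ENNReal.tsum_le_tsum fun g => mul_le_mul_right (nlet_le_len hSgen hS ha g) _

theorem dv_real (hSgen : ∀ i, Subgroup.closure (Si i) = ⊤)
    (hS : S = ⋃ i, (CoprodI.of : M i →* CoprodI M) '' Si i) (hf : S.Finite)
    {μ : CoprodI M → ℝ≥0∞}
    (hμ : ∑' g, μ g = 1) (hL : drf S μ ≠ ∞) {s : ℝ} (hs : 0 ≤ s)
    (hZ : zf S s ≠ ∞) {i : ι} {a b : M i}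
    (ha : a ≠ 1) (hb : b ≠ 1) (hab : a ≠ b) {δ δ' : ℝ} (h : 0 ≤ δ) (h0' : 0 ≤ δ') (hδ : δ ≤ 1)
    (h' : δ' ≤ 1 / 2)
    (heq : δ * Real.exp (-s * wordLength (Si i) a) = δ' * Real.exp (-s * wordLength (Si i) b))
    (n : ℕ) :
    (entropy (convPow μ n)).toReal + δ / 2 * EN μ a n ≤ s * (drf S (convPow μ n)).toReal +
      Real.log (zf S s).toReal + 2 * δ' * EN μ b n := by
  have h1 := dv hSgen hS hs hZ ha hb hab h h0' (by linarith) heq (convPow_sum hμ n)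
  rw [Ew_one_eq, Ew_one_eq] at h1
  have fH := entropy_ne_top (fp_gen hSgen hS) hf (convPow_sum hμ n)
    (drf_pow_ne_top (fp_gen hSgen hS) hμ hL n)
  have fL := drf_pow_ne_top (fp_gen hSgen hS) hμ hL n
  have fa := Ew_nlet_ne_top hSgen hS hμ hL ha n
  have fb := Ew_nlet_ne_top hSgen hS hμ hL hb n
  have hZ1 : 1 ≤ (zf S s).toReal := by
    have := ENNReal.toReal_mono hZ (one_le_zf (S := S) s)
    simpa using this
  have l1 : δ / 2 ≤ Real.log (1 + δ) := by
    have := Real.one_sub_inv_le_log_of_pos (x := 1 + δ) (by linarith)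
    refine le_trans ?_ this
    have e : 1 - (1 + δ)⁻¹ = δ / (1 + δ) := by field_simp; ring
    rw [e]
    exact div_le_div_of_nonneg_left h (by linarith) (by linarith)
  have l2 : -Real.log (1 - δ') ≤ 2 * δ' := by
    have := Real.one_sub_inv_le_log_of_pos (x := 1 - δ') (by linarith)
    have e : (1 - δ')⁻¹ - 1 = δ' / (1 - δ') := by
      have : 1 - δ' ≠ 0 := by linarith
      field_simp; ring
    have e2 : δ' / (1 - δ') ≤ δ' / (1 / 2) :=
      div_le_div_of_nonneg_left h0' (by norm_num) (by linarith)
    have e3 : δ' / (1 / 2) = 2 * δ' := by ring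
    linarith
  have l3 : 0 ≤ Real.log (1 + δ) := by linarith
  have l4 : 0 ≤ -Real.log (1 - δ') := by
    have := Real.log_nonpos (x := 1 - δ') (by linarith) (by linarith)
    linarith
  have t1 : ENNReal.ofReal s * drf S (convPow μ n) ≠ ∞ := ENNReal.mul_ne_top ENNReal.ofReal_ne_top fL
  have t2 : ENNReal.ofReal (-Real.log (1 - δ')) * Ew μ n (nlet b) 1 ≠ ∞ :=
    ENNReal.mul_ne_top ENNReal.ofReal_ne_top fb
  have t3 : ENNReal.ofReal (Real.log (1 + δ)) * Ew μ n (nlet a) 1 ≠ ∞ :=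
    ENNReal.mul_ne_top ENNReal.ofReal_ne_top fa
  have t4 : ENNReal.ofReal s * drf S (convPow μ n) + ENNReal.ofReal (Real.log (zf S s).toReal) ≠ ∞ :=
    ENNReal.add_ne_top.2 ⟨t1, ENNReal.ofReal_ne_top⟩
  have h2 := ENNReal.toReal_mono (ENNReal.add_ne_top.2 ⟨t4, t2⟩) h1
  rw [ENNReal.toReal_add fH t3, ENNReal.toReal_add t4 t2, ENNReal.toReal_add t1 ENNReal.ofReal_ne_top,
    ENNReal.toReal_mul, ENNReal.toReal_mul, ENNReal.toReal_mul, ENNReal.toReal_ofReal l3,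
    ENNReal.toReal_ofReal l4, ENNReal.toReal_ofReal hs,
    ENNReal.toReal_ofReal (Real.log_nonneg hZ1)] at h2
  have m1 := mul_le_mul_of_nonneg_right l1 (EN_nonneg μ a n)
  have m2 := mul_le_mul_of_nonneg_right l2 (EN_nonneg μ b n)
  unfold EN at *
  linarith

theorem dv_asymp (hSgen : ∀ i, Subgroup.closure (Si i) = ⊤)
    (hS : S = ⋃ i, (CoprodI.of : M i →* CoprodI M) '' Si i) (hf : S.Finite)
    {μ : CoprodI M → ℝ≥0∞}
    (hμ : ∑' g, μ g = 1) (hL : drf S μ ≠ ∞) {h l v : ℝ} (hl0 : 0 ≤ l) (hv0 : 0 ≤ v)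
    (hh : Tendsto (fun n : ℕ => (entropy (convPow μ n)).toReal / n) atTop (nhds h))
    (hl : Tendsto (fun n : ℕ => (drf S (convPow μ n)).toReal / n) atTop (nhds l))
    (hv : Tendsto (fun n : ℕ => Real.log ((wball S n).ncard : ℝ) / n) atTop (nhds v))
    (hge : l * v ≤ h) {i : ι} {a b : M i} (ha : a ≠ 1) (hb : b ≠ 1) {ε : ℝ} (hε : 0 < ε) :
    ∀ᶠ n : ℕ in atTop, EN μ a n ≤ 12 * Real.exp (v * ((wordLength (Si i) b : ℝ) - wordLength (Si i) a)) *
      EN μ b n + ε * n := by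
  by_cases hab : a = b
  · subst hab
    refine Eventually.of_forall fun n => ?_
    have := EN_nonneg μ a n
    have : 0 ≤ ε * n := by positivity
    simp only [sub_self, mul_zero, Real.exp_zero]
    linarith
  set A : ℝ := (wordLength (Si i) a : ℝ) with hA
  set B : ℝ := (wordLength (Si i) b : ℝ) with hB
  have hA0 : 0 ≤ A := by positivity
  have hB0 : 0 ≤ B := by positivity
  set δ : ℝ := 1 / 2 * Real.exp (-(v + 1) * (A + B)) with hδd
  have hδ0 : 0 < δ := by positivity
  have hδ1 : δ ≤ 1 / 2 := by
    have : Real.exp (-(v + 1) * (A + B)) ≤ 1 := by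
      rw [Real.exp_le_one_iff]
      have : 0 ≤ (v + 1) * (A + B) := by positivity
      linarith
    linarith
  obtain ⟨η, hη0, hη1, hη2, hη3⟩ : ∃ η : ℝ, 0 < η ∧ η ≤ 1 ∧ η * (A + B) ≤ 1 ∧ η * l ≤ δ * ε / 4 := by
    refine ⟨min 1 (min (1 / (A + B + 1)) (δ * ε / 4 / (l + 1))), ?_, min_le_left _ _, ?_, ?_⟩
    · refine lt_min one_pos (lt_min (by positivity) (by positivity))
    · calc _ ≤ 1 / (A + B + 1) * (A + B) := by
            gcongr
            exact (min_le_right _ _).trans (min_le_left _ _)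
        _ ≤ 1 := by
            rw [div_mul_eq_mul_div, div_le_one (by positivity)]; linarith
    · calc _ ≤ δ * ε / 4 / (l + 1) * l := by
            gcongr
            exact (min_le_right _ _).trans (min_le_right _ _)
        _ ≤ δ * ε / 4 := by
            rw [div_mul_eq_mul_div, div_le_iff₀ (by positivity)]
            have : 0 < δ * ε / 4 := by positivity
            nlinarith
  set s := v + η with hs
  have hZ := zf_ne_top (fp_gen hSgen hS) hf hv (show v < s by linarith)
  set δ' := δ * Real.exp (s * (B - A)) with hδ'd
  have hδ'0 : 0 ≤ δ' := by positivity
  have hδ'1 : δ' ≤ 1 / 2 := by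
    rw [hδ'd, hδd, mul_assoc, ← Real.exp_add]
    have : Real.exp (-(v + 1) * (A + B) + s * (B - A)) ≤ 1 := by
      rw [Real.exp_le_one_iff]
      nlinarith
    linarith
  have heq : δ * Real.exp (-s * A) = δ' * Real.exp (-s * B) := by
    rw [hδ'd, mul_assoc δ, ← Real.exp_add]
    congr 2; ring
  have key := dv_real hSgen hS hf hμ hL (show 0 ≤ s by linarith) hZ ha hb hab hδ0.le hδ'0
    (by linarith) hδ'1 heq
  have hexp : Real.exp (s * (B - A)) ≤ 3 * Real.exp (v * (B - A)) := by
    have e : s * (B - A) = η * (B - A) + v * (B - A) := by rw [hs]; ring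
    rw [e, Real.exp_add]
    gcongr
    have : η * (B - A) ≤ 1 := by nlinarith
    exact (Real.exp_le_exp.2 this).trans (Real.exp_one_lt_d9.le.trans (by norm_num))
  -- the limit
  have hlim : Tendsto (fun n : ℕ => s * ((drf S (convPow μ n)).toReal / n) -
      (entropy (convPow μ n)).toReal / n + Real.log (zf S s).toReal / n) atTop
      (nhds (s * l - h + 0)) :=
    ((hl.const_mul s).sub hh).add (tendsto_const_div_atTop_nhds_zero_nat _)
  have hlt : s * l - h + 0 < δ * ε / 2 := by
    have : 0 < δ * ε := by positivity
    have : s * l = l * v + η * l := by rw [hs]; ring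
    linarith
  filter_upwards [hlim.eventually_lt_const hlt, eventually_gt_atTop 0] with n hn hn0
  have hn0' : (0 : ℝ) < n := by exact_mod_cast hn0
  have k := key n
  have hn' : s * (drf S (convPow μ n)).toReal - (entropy (convPow μ n)).toReal +
      Real.log (zf S s).toReal < δ * ε / 2 * n := by
    rw [← mul_div_assoc, ← sub_div, ← add_div, div_lt_iff₀ hn0'] at hn
    exact hn
  have k2 : δ / 2 * EN μ a n ≤ δ / 2 * (ε * n + 4 * Real.exp (s * (B - A)) * EN μ b n) := by
    rw [hδ'd] at k
    nlinarith
  have k3 := le_of_mul_le_mul_left k2 (by positivity)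
  have k4 := mul_le_mul_of_nonneg_right hexp (EN_nonneg μ b n)
  linarith

theorem gr_compare_aux {x y : ℝ} {k : ℕ} (h : ∀ᶠ J : ℕ in atTop, x * (J + 1) ≤ y * (J + k)) :
    x ≤ y := by
  have h1 : Tendsto (fun J : ℕ => ((J : ℝ) + k) / (J + 1)) atTop (nhds 1) := by
    have : Tendsto (fun J : ℕ => 1 + ((k : ℝ) - 1) / ((J : ℝ) + 1)) atTop (nhds (1 + 0)) := by
      refine tendsto_const_nhds.add ?_
      refine Tendsto.div_atTop tendsto_const_nhds ?_
      exact tendsto_atTop_add_const_right _ _ tendsto_natCast_atTop_atTop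
    rw [add_zero] at this
    refine this.congr fun J => ?_
    have : (J : ℝ) + 1 ≠ 0 := by positivity
    field_simp
    ring
  have h2 : Tendsto (fun J : ℕ => y * (((J : ℝ) + k) / (J + 1))) atTop (nhds (y * 1)) :=
    h1.const_mul y
  rw [mul_one] at h2
  refine ge_of_tendsto h2 ?_
  filter_upwards [h] with J hJ
  rw [← mul_div_assoc, le_div_iff₀ (by positivity)]
  exact hJ

theorem gr_compare (hSgen : ∀ i, Subgroup.closure (Si i) = ⊤)
    (hS : S = ⋃ i, (CoprodI.of : M i →* CoprodI M) '' Si i) (hf : S.Finite)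
    {μ : CoprodI M → ℝ≥0∞}
    (hμ : ∑' g, μ g = 1) (hadm : ∀ g, ∃ n, 0 < convPow μ n g)
    (hmom : ∀ c : ℝ, 1 < c → ∑' g, μ g * ENNReal.ofReal (c ^ wordLength S g) ≠ ∞)
    (hfin : ∀ t, gr μ t ≠ ∞)
    {h l v : ℝ} (hl0 : 0 ≤ l) (hv0 : 0 ≤ v)
    (hh : Tendsto (fun n : ℕ => (entropy (convPow μ n)).toReal / n) atTop (nhds h))
    (hl : Tendsto (fun n : ℕ => (drf S (convPow μ n)).toReal / n) atTop (nhds l))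
    (hv : Tendsto (fun n : ℕ => Real.log ((wball S n).ncard : ℝ) / n) atTop (nhds v))
    (hge : l * v ≤ h) {i j : ι} (hij : j ≠ i) (hnj : ∃ b : M j, b ≠ 1) :
    ∃ D : ℝ, 0 < D ∧ ∀ a b : M i, a ≠ 1 → b ≠ 1 →
      (gr μ (CoprodI.of a)).toReal ≤ D *
        Real.exp (v * ((wordLength (Si i) b : ℝ) - wordLength (Si i) a)) *
          (gr μ (CoprodI.of b)).toReal := by
  obtain ⟨z, hz⟩ := hnj
  obtain ⟨m, hm⟩ := hadm (CoprodI.of z)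
  have hgen := fp_gen hSgen hS
  obtain ⟨κ, hκ, hH⟩ := harnack hgen hf μ hμ hadm
  have hL : drf S μ ≠ ∞ := moment_len hgen hf μ hmom
  set C := (1 + ∑' g, μ g * (((wball S (wordLength S g)).ncard : ℝ≥0∞) *
        (κ : ℝ≥0∞) ^ wordLength S g)) ^ 2 with hC
  have hCt : C ≠ ∞ := ENNReal.pow_ne_top (ENNReal.add_ne_top.2
    ⟨ENNReal.one_ne_top, moment_ball hgen hf μ hmom κ⟩)
  have hC1 : 1 ≤ C := by
    rw [hC]; exact one_le_pow_of_one_le' (le_self_add) 2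
  have hC1' : 1 ≤ C.toReal := by
    have := ENNReal.toReal_mono hCt hC1
    simpa using this
  set K := (convPow μ m (CoprodI.of z)).toReal ^ 2 with hK
  have hmt : convPow μ m (CoprodI.of z) ≠ ∞ :=
    ne_top_of_le_ne_top ENNReal.one_ne_top (convPow_le_one hμ m _)
  have hK0 : 0 < K := pow_pos (ENNReal.toReal_pos hm.ne' hmt) 2
  set g1 := (gr μ (1 : CoprodI M)).toReal with hg1
  have hg1' : 1 ≤ g1 := by
    have := ENNReal.toReal_mono (hfin 1) (one_le_gr μ)
    simpa using this
  refine ⟨48 * g1 ^ 2 * C.toReal / K, by positivity, fun a b ha hb => ?_⟩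
  set E := Real.exp (v * ((wordLength (Si i) b : ℝ) - wordLength (Si i) a)) with hE
  set Gb := (gr μ (CoprodI.of b)).toReal with hGb
  have hGb0 : 0 ≤ Gb := ENNReal.toReal_nonneg
  have hE0 : 0 < E := Real.exp_pos _
  have hup : ∀ n : ℕ, EN μ b n ≤ (n + 1) * (C.toReal * Gb) := by
    intro n
    have := nlet_upper hSgen hS hf hμ hκ hH b hb n
    have ht : ((n : ℝ≥0∞) + 1) * (C * gr μ (CoprodI.of b)) ≠ ∞ :=
      ENNReal.mul_ne_top (ENNReal.add_ne_top.2 ⟨ENNReal.natCast_ne_top n, ENNReal.one_ne_top⟩)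
        (ENNReal.mul_ne_top hCt (hfin _))
    have h2 := ENNReal.toReal_mono ht this
    rw [ENNReal.toReal_mul, ENNReal.toReal_mul,
      ENNReal.toReal_add (ENNReal.natCast_ne_top n) ENNReal.one_ne_top] at h2
    simpa [EN, hGb] using h2
  have hcf : ∀ l, convPow μ l (CoprodI.of a) ≠ ∞ := fun l =>
    ne_top_of_le_ne_top ENNReal.one_ne_top (convPow_le_one hμ l _)
  have hpart : ∀ I : ℕ, K * (∑ l ∈ Finset.range (I + 1), (convPow μ l (CoprodI.of a)).toReal) ≤
      48 * g1 ^ 2 * C.toReal * E * Gb := by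
    intro I
    set P := ∑ l ∈ Finset.range (I + 1), (convPow μ l (CoprodI.of a)).toReal with hP
    have hlow : ∀ J : ℕ, K * ((J + 1) * P) ≤
        2 * g1 ^ 2 * (EN μ a (J + m + I) + EN μ a (J + m + I + m)) := by
      intro J
      have h1 := nlet_lower hμ hij hz m ha J I
      have ea := Ew_nlet_ne_top hSgen hS hμ hL ha (J + m + I)
      have eb := Ew_nlet_ne_top hSgen hS hμ hL ha (J + m + I + m)
      have ht : 2 * gr μ 1 ^ 2 * (Ew μ (J + m + I) (nlet a) 1 + Ew μ (J + m + I + m) (nlet a) 1) ≠ ∞ :=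
        ENNReal.mul_ne_top (ENNReal.mul_ne_top (by norm_num) (ENNReal.pow_ne_top (hfin 1)))
          (ENNReal.add_ne_top.2 ⟨ea, eb⟩)
      have h2 := ENNReal.toReal_mono ht h1
      rw [ENNReal.toReal_mul, ENNReal.toReal_mul, ENNReal.toReal_mul, ENNReal.toReal_mul,
        ENNReal.toReal_add ea eb, ENNReal.toReal_pow, ENNReal.toReal_pow,
        ENNReal.toReal_sum (fun l _ => hcf l),
        ENNReal.toReal_add (ENNReal.natCast_ne_top J) ENNReal.one_ne_top] at h2
      simpa [EN, hK, hP, hg1] using h2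
    refine le_of_forall_pos_le_add fun ε' hε' => ?_
    set ε := ε' / (4 * g1 ^ 2) with hε
    have hε0 : 0 < ε := by positivity
    have hev := dv_asymp hSgen hS hf hμ hL hl0 hv0 hh hl hv hge ha hb hε0
    have t1 : Tendsto (fun J : ℕ => J + m + I) atTop atTop :=
      tendsto_atTop_mono (fun J => by simp only [id]; omega) tendsto_id
    have t2 : Tendsto (fun J : ℕ => J + m + I + m) atTop atTop :=
      tendsto_atTop_mono (fun J => by simp only [id]; omega) tendsto_id
    have e1 := t1.eventually hev
    have e2 := t2.eventually hev
    have fin : ∀ᶠ J : ℕ in atTop, K * P * ((J : ℝ) + 1) ≤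
        4 * g1 ^ 2 * (12 * E * (C.toReal * Gb) + ε) * ((J : ℝ) + ((2 * m + I + 1 : ℕ) : ℝ)) := by
      filter_upwards [e1, e2] with J h1 h2
      have h3 := hlow J
      have u1 := hup (J + m + I)
      have u2 := hup (J + m + I + m)
      have hX : 0 ≤ C.toReal * Gb := by positivity
      set X := C.toReal * Gb with hXd
      set T : ℝ := (J : ℝ) + ((2 * m + I + 1 : ℕ) : ℝ) with hT
      have b1 : EN μ a (J + m + I) ≤ (12 * E * X + ε) * T := by
        have : (((J + m + I : ℕ) : ℝ) + 1) ≤ T := by rw [hT]; push_cast; linarith [(Nat.cast_nonneg m : (0:ℝ) ≤ m)]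
        have w1 : EN μ b (J + m + I) ≤ T * X := u1.trans (mul_le_mul_of_nonneg_right this hX)
        have w2 : ε * ((J + m + I : ℕ) : ℝ) ≤ ε * T := by gcongr; linarith
        calc _ ≤ _ := h1
          _ ≤ 12 * E * (T * X) + ε * T := by gcongr
          _ = _ := by ring
      have b2 : EN μ a (J + m + I + m) ≤ (12 * E * X + ε) * T := by
        have : (((J + m + I + m : ℕ) : ℝ) + 1) ≤ T := by rw [hT]; push_cast; linarith
        have w1 : EN μ b (J + m + I + m) ≤ T * X := u2.trans (mul_le_mul_of_nonneg_right this hX)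
        have w2 : ε * ((J + m + I + m : ℕ) : ℝ) ≤ ε * T := by gcongr; linarith
        calc _ ≤ _ := h2
          _ ≤ 12 * E * (T * X) + ε * T := by gcongr
          _ = _ := by ring
      calc K * P * ((J : ℝ) + 1) = K * ((J + 1) * P) := by ring
        _ ≤ _ := h3
        _ ≤ 2 * g1 ^ 2 * ((12 * E * X + ε) * T + (12 * E * X + ε) * T) := by gcongr
        _ = _ := by ring
    have := gr_compare_aux fin
    refine this.trans (le_of_eq ?_)
    rw [hε]
    have : g1 ≠ 0 := by linarith
    field_simp
    ring
  have hsum : (gr μ (CoprodI.of a)).toReal ≤ 48 * g1 ^ 2 * C.toReal * E * Gb / K := by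
    apply ENNReal.toReal_le_of_le_ofReal (by positivity)
    rw [gr]
    refine ENNReal.tsum_le_of_sum_range_le fun I => ?_
    have h1 := hpart I
    rw [mul_comm, ← le_div_iff₀ hK0] at h1
    refine le_trans (Finset.sum_le_sum_of_subset (Finset.range_mono (Nat.le_succ I))) ?_
    rw [← ENNReal.ofReal_toReal (a := ∑ l ∈ Finset.range (I + 1), convPow μ l (CoprodI.of a))
      (ENNReal.sum_ne_top.2 fun l _ => hcf l), ENNReal.toReal_sum (fun l _ => hcf l)]
    exact ENNReal.ofReal_le_ofReal h1
  refine hsum.trans (le_of_eq ?_)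
  ring

theorem gr_two_sided (hSgen : ∀ i, Subgroup.closure (Si i) = ⊤)
    (hS : S = ⋃ i, (CoprodI.of : M i →* CoprodI M) '' Si i) (hf : S.Finite)
    {μ : CoprodI M → ℝ≥0∞}
    (hμ : ∑' g, μ g = 1) (hadm : ∀ g, ∃ n, 0 < convPow μ n g)
    (hmom : ∀ c : ℝ, 1 < c → ∑' g, μ g * ENNReal.ofReal (c ^ wordLength S g) ≠ ∞)
    (hfin : ∀ t, gr μ t ≠ ∞)
    {h l v : ℝ} (hl0 : 0 ≤ l) (hv0 : 0 ≤ v)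
    (hh : Tendsto (fun n : ℕ => (entropy (convPow μ n)).toReal / n) atTop (nhds h))
    (hl : Tendsto (fun n : ℕ => (drf S (convPow μ n)).toReal / n) atTop (nhds l))
    (hv : Tendsto (fun n : ℕ => Real.log ((wball S n).ncard : ℝ) / n) atTop (nhds v))
    (hge : l * v ≤ h) {i j : ι} (hij : j ≠ i) (hnj : ∃ b : M j, b ≠ 1) (hni : ∃ b : M i, b ≠ 1) :
    ∃ c C : ℝ, 0 < c ∧ 0 < C ∧ ∀ x : M i,
      c * Real.exp (-v * wordLength (Si i) x) ≤ (gr μ (CoprodI.of x)).toReal ∧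
      (gr μ (CoprodI.of x)).toReal ≤ C * Real.exp (-v * wordLength (Si i) x) := by
  obtain ⟨D, hD, hcmp⟩ := gr_compare hSgen hS hf hμ hadm hmom hfin hl0 hv0 hh hl hv hge hij hnj
  obtain ⟨b, hb⟩ := hni
  have hgen := fp_gen hSgen hS
  obtain ⟨κ, hκ, hH⟩ := harnack hgen hf μ hμ hadm
  set Gb := (gr μ (CoprodI.of b)).toReal with hGb
  have hGb0 : 0 < Gb := by
    refine ENNReal.toReal_pos ?_ (hfin _)
    intro h0
    have := one_le_kgr hgen hH (CoprodI.of b)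
    rw [h0, mul_zero] at this
    exact absurd this (by simp)
  set B : ℝ := (wordLength (Si i) b : ℝ) with hB
  set g1 := (gr μ (1 : CoprodI M)).toReal with hg1
  have hg1' : 1 ≤ g1 := by
    have := ENNReal.toReal_mono (hfin 1) (one_le_gr μ)
    simpa using this
  refine ⟨min 1 (Gb * Real.exp (v * B) / D), max g1 (D * Gb * Real.exp (v * B)),
    lt_min one_pos (by positivity), lt_of_lt_of_le (by linarith) (le_max_left _ _), fun x => ?_⟩
  by_cases hx : x = 1
  · subst hx
    rw [wl_one, map_one]
    simp only [Nat.cast_zero, mul_zero, Real.exp_zero, mul_one]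
    exact ⟨(min_le_left _ _).trans hg1', le_max_left _ _⟩
  · constructor
    · calc _ ≤ Gb * Real.exp (v * B) / D * Real.exp (-v * wordLength (Si i) x) := by
            gcongr; exact min_le_right _ _
        _ ≤ _ := by
            have h1 := hcmp b x hb hx
            rw [div_mul_eq_mul_div, div_le_iff₀ hD]
            calc Gb * Real.exp (v * B) * Real.exp (-v * wordLength (Si i) x) ≤
                (D * Real.exp (v * (wordLength (Si i) x - B)) * (gr μ (CoprodI.of x)).toReal) *
                  Real.exp (v * B) * Real.exp (-v * wordLength (Si i) x) := by gcongr
              _ = (gr μ (CoprodI.of x)).toReal * D * (Real.exp (v * (wordLength (Si i) x - B)) *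
                  Real.exp (v * B) * Real.exp (-v * wordLength (Si i) x)) := by ring
              _ = _ := by
                rw [← Real.exp_add, ← Real.exp_add]
                have : v * (wordLength (Si i) x - B) + v * B + -v * wordLength (Si i) x = 0 := by ring
                rw [this, Real.exp_zero, mul_one]
    · calc _ ≤ _ := hcmp x b hx hb
        _ = D * Gb * Real.exp (v * B) * Real.exp (-v * wordLength (Si i) x) := by
            have : v * (B - wordLength (Si i) x) = v * B + -v * wordLength (Si i) x := by ring
            rw [this, Real.exp_add]; ring
        _ ≤ _ := by gcongr; exact le_max_right _ _

end Asym

section Green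
variable {G : Type*} [Group G] {S : Set G}

theorem tsum_antidiag (f : ℕ → ℝ≥0∞) :
    ∑' m : ℕ, ∑' n : ℕ, f (m + n) = ∑' n : ℕ, ((n : ℝ≥0∞) + 1) * f n := by
  rw [← ENNReal.tsum_prod (f := fun m n => f (m + n)),
    ← Finset.HasAntidiagonal.sigmaAntidiagonalEquivProd.tsum_eq, ENNReal.tsum_sigma']
  refine tsum_congr fun n => ?_
  rw [tsum_fintype]
  have : ∀ b : Finset.HasAntidiagonal.antidiagonal n, f (((Finset.HasAntidiagonal.sigmaAntidiagonalEquivProd ⟨n, b⟩ : ℕ × ℕ)).1 +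
      ((Finset.HasAntidiagonal.sigmaAntidiagonalEquivProd ⟨n, b⟩ : ℕ × ℕ)).2) = f n := by
    rintro ⟨b, hb⟩
    congr 1
    exact Finset.HasAntidiagonal.mem_antidiagonal.1 hb
  rw [Finset.sum_congr rfl (fun b _ => this b)]
  simp

theorem gr_conv_le (μ : G → ℝ≥0∞) (a : G) (X : Finset G) :
    ∑ x ∈ X, gr μ x * gr μ (x⁻¹ * a) ≤ ∑' n : ℕ, ((n : ℝ≥0∞) + 1) * convPow μ n a := by
  rw [← tsum_antidiag]
  calc ∑ x ∈ X, gr μ x * gr μ (x⁻¹ * a) ≤ ∑' x, gr μ x * gr μ (x⁻¹ * a) := ENNReal.sum_le_tsum X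
    _ = ∑' x, ∑' m, ∑' n, convPow μ m x * convPow μ n (x⁻¹ * a) := by
        refine tsum_congr fun x => ?_
        simp only [gr]
        rw [← ENNReal.tsum_mul_right]
        refine tsum_congr fun m => ?_
        rw [ENNReal.tsum_mul_left]
    _ = ∑' m, ∑' n, ∑' x, convPow μ m x * convPow μ n (x⁻¹ * a) := by
        rw [ENNReal.tsum_comm]
        refine tsum_congr fun m => ?_
        rw [ENNReal.tsum_comm]
    _ ≤ _ := by
        simp only [← convPow_add]; exact le_rfl

theorem gr_ne_top {μ : G → ℝ≥0∞} {C ρ : ℝ≥0∞} (hC : C ≠ ∞) (hρ : ρ < 1)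
    (hdec : ∀ n a, convPow μ n a ≤ C * ρ ^ n) (t : G) : gr μ t ≠ ∞ := by
  refine ne_top_of_le_ne_top ?_ (ENNReal.tsum_le_tsum fun n => hdec n t)
  rw [ENNReal.tsum_mul_left, ENNReal.tsum_geometric]
  exact ENNReal.mul_ne_top hC (ENNReal.inv_ne_top.2 (tsub_pos_of_lt hρ).ne')

theorem quad_split {f : ℕ → ℝ≥0∞} {C ρ g C3 : ℝ≥0∞}
    (hdec : ∀ n, f n ≤ C * ρ ^ n) (hg : ∑' n, f n = g)
    (hC3 : ∑' n : ℕ, ((n : ℝ≥0∞) + 1) * ρ ^ n = C3) (T : ℕ) (hρT : ρ ^ T ≤ g) :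
    ∑' n : ℕ, ((n : ℝ≥0∞) + 1) * f n ≤ ((T : ℝ≥0∞) + 1) * ((1 + C * C3) * g) := by
  rw [← Summable.sum_add_tsum_nat_add' (f := fun n : ℕ => ((n : ℝ≥0∞) + 1) * f n) (k := T) ENNReal.summable]
  have p1 : ∑ n ∈ Finset.range T, ((n : ℝ≥0∞) + 1) * f n ≤ ((T : ℝ≥0∞) + 1) * g := by
    calc _ ≤ ∑ n ∈ Finset.range T, ((T : ℝ≥0∞) + 1) * f n := by
          refine Finset.sum_le_sum fun n hn => ?_
          have : (n : ℝ≥0∞) ≤ T := by exact_mod_cast (Finset.mem_range.1 hn).le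
          gcongr
      _ ≤ ∑' n, ((T : ℝ≥0∞) + 1) * f n := ENNReal.sum_le_tsum _
      _ = _ := by rw [ENNReal.tsum_mul_left, hg]
  have p2 : ∑' k : ℕ, (((k + T : ℕ) : ℝ≥0∞) + 1) * f (k + T) ≤
      ((T : ℝ≥0∞) + 1) * (g * (C * C3)) := by
    calc _ ≤ ∑' k : ℕ, (((T : ℝ≥0∞) + 1) * (g * C)) * (((k : ℝ≥0∞) + 1) * ρ ^ k) := by
          refine ENNReal.tsum_le_tsum fun k => ?_
          have h1 : (((k + T : ℕ) : ℝ≥0∞) + 1) ≤ ((T : ℝ≥0∞) + 1) * ((k : ℝ≥0∞) + 1) := by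
            have : (k + T) + 1 ≤ (T + 1) * (k + 1) := by nlinarith
            exact_mod_cast this
          calc _ ≤ ((T : ℝ≥0∞) + 1) * ((k : ℝ≥0∞) + 1) * (C * (ρ ^ k * g)) := by
                refine mul_le_mul' h1 ((hdec _).trans ?_)
                rw [pow_add]
                gcongr
            _ = _ := by ring
      _ = _ := by rw [ENNReal.tsum_mul_left, hC3]; ring
  calc _ ≤ ((T : ℝ≥0∞) + 1) * g + ((T : ℝ≥0∞) + 1) * (g * (C * C3)) := add_le_add p1 p2
    _ = ((T : ℝ≥0∞) + 1) * ((1 + C * C3) * g) := by ring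

theorem green_quad (hS : Subgroup.closure S = ⊤) {μ : G → ℝ≥0∞} {C ρ : ℝ≥0∞} (hC : C ≠ ∞)
    (hρ : ρ < 1) (hdec : ∀ n a, convPow μ n a ≤ C * ρ ^ n) {κ : ℕ}
    (hH : ∀ h t, gr μ (h * t) ≤ (κ : ℝ≥0∞) ^ wordLength S h * gr μ t ∧
      gr μ (t * h) ≤ (κ : ℝ≥0∞) ^ wordLength S h * gr μ t) :
    ∃ C2 : ℝ≥0∞, C2 ≠ ∞ ∧ ∀ a, ∑' n : ℕ, ((n : ℝ≥0∞) + 1) * convPow μ n a ≤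
      C2 * (wordLength S a + 1) * gr μ a := by
  obtain ⟨q, hq⟩ : ∃ q : ℕ, ρ ^ q * κ ≤ 1 := by
    have h1 := ENNReal.Tendsto.mul_const (b := (κ : ℝ≥0∞))
      (ENNReal.tendsto_pow_atTop_nhds_zero_of_lt_one hρ) (Or.inr (ENNReal.natCast_ne_top κ))
    rw [zero_mul] at h1
    exact ((h1.eventually (ge_mem_nhds (by norm_num : (0 : ℝ≥0∞) < 1)))).exists
  obtain ⟨C3, hC3⟩ : ∃ C3, ∑' n : ℕ, ((n : ℝ≥0∞) + 1) * ρ ^ n = C3 := ⟨_, rfl⟩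
  have hC3t : C3 ≠ ∞ := by
    rw [← hC3, ← tsum_antidiag]
    simp only [pow_add, ENNReal.tsum_mul_left, ENNReal.tsum_mul_right, ENNReal.tsum_geometric]
    have := ENNReal.inv_ne_top.2 (tsub_pos_of_lt hρ).ne'
    exact ENNReal.mul_ne_top this this
  refine ⟨((q : ℝ≥0∞) + 1) * (1 + C * C3), ENNReal.mul_ne_top
    (ENNReal.add_ne_top.2 ⟨ENNReal.natCast_ne_top q, ENNReal.one_ne_top⟩)
    (ENNReal.add_ne_top.2 ⟨ENNReal.one_ne_top, ENNReal.mul_ne_top hC hC3t⟩), fun a => ?_⟩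
  have hρT : ρ ^ (q * wordLength S a) ≤ gr μ a := by
    have h1 := one_le_kgr hS hH a
    calc ρ ^ (q * wordLength S a) = ρ ^ (q * wordLength S a) * 1 := (mul_one _).symm
      _ ≤ ρ ^ (q * wordLength S a) * ((κ : ℝ≥0∞) ^ wordLength S a * gr μ a) := by gcongr
      _ = (ρ ^ q * κ) ^ wordLength S a * gr μ a := by
          rw [pow_mul, mul_pow, mul_assoc]
      _ ≤ 1 * gr μ a := mul_le_mul' (pow_le_one' hq _) le_rfl
      _ = gr μ a := one_mul _
  have hTb : ((q * wordLength S a : ℕ) : ℝ≥0∞) + 1 ≤ ((q : ℝ≥0∞) + 1) * (wordLength S a + 1) := by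
    have : q * wordLength S a + 1 ≤ (q + 1) * (wordLength S a + 1) := by nlinarith
    exact_mod_cast this
  calc _ ≤ _ := quad_split (hdec · a) rfl hC3 _ hρT
    _ ≤ (((q : ℝ≥0∞) + 1) * (wordLength S a + 1)) * ((1 + C * C3) * gr μ a) := by
        exact mul_le_mul' hTb le_rfl
    _ = _ := by ring

end Green

section Contra
open Monoid
variable {ι : Type*} {M : ι → Type*} [∀ i, Group (M i)] {Si : ∀ i, Set (M i)}
  {S : Set (CoprodI M)}

theorem strict_ineq (hSgen : ∀ i, Subgroup.closure (Si i) = ⊤)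
    (hS : S = ⋃ i, (CoprodI.of : M i →* CoprodI M) '' Si i) (hf : S.Finite)
    {μ : CoprodI M → ℝ≥0∞}
    (hμ : ∑' g, μ g = 1) (hadm : ∀ g, ∃ n, 0 < convPow μ n g)
    (hmom : ∀ c : ℝ, 1 < c → ∑' g, μ g * ENNReal.ofReal (c ^ wordLength S g) ≠ ∞)
    {h l v : ℝ} (hl0 : 0 ≤ l) (hv0 : 0 ≤ v)
    (hh : Tendsto (fun n : ℕ => (entropy (convPow μ n)).toReal / n) atTop (nhds h))
    (hl : Tendsto (fun n : ℕ => (drf S (convPow μ n)).toReal / n) atTop (nhds l))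
    (hv : Tendsto (fun n : ℕ => Real.log ((wball S n).ncard : ℝ) / n) atTop (nhds v))
    {i j : ι} (hij : j ≠ i) (hnj : ∃ b : M j, b ≠ 1) [Infinite (M i)]
    (hX : ∃ Q K : ℕ, ∀ m : ℕ, ∃ a : M i, ∃ X : Finset (M i), (m + 1) ^ 2 ≤ X.card ∧
      wordLength (Si i) a ≤ Q * m ∧ ∀ x ∈ X,
        wordLength (Si i) x + wordLength (Si i) (x⁻¹ * a) ≤ wordLength (Si i) a + K) :
    h < l * v := by
  by_contra hcon
  have hge : l * v ≤ h := not_lt.1 hcon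
  obtain ⟨z, hz⟩ := hnj
  have hgen := fp_gen hSgen hS
  obtain ⟨κ, hκ, hH⟩ := harnack hgen hf μ hμ hadm
  -- exponential decay
  obtain ⟨C, ρ, hC, hρ, hdec⟩ : ∃ C ρ : ℝ≥0∞, C ≠ ∞ ∧ ρ < 1 ∧ ∀ n a, convPow μ n a ≤ C * ρ ^ n := by
    obtain ⟨F, hF⟩ : ∃ F : Fin 9 ↪ {x : M i // x ≠ 1}, True := by
      have : Infinite {x : M i // x ≠ 1} := by
        have := (Set.finite_singleton (1 : M i)).infinite_compl
        exact this.to_subtype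
      exact ⟨(Fin.valEmbedding).trans (Infinite.natEmbedding _), trivial⟩
    refine exp_decay (fun k => CoprodI.of ((F k).1)⁻¹ * CoprodI.of z * CoprodI.of (F k).1)
      (fun k => endsW ⟨i, (F k).1⟩) ?_ ?_ μ hμ hadm
    · intro k k' hkk
      rw [Set.disjoint_left]
      intro g h1 h2
      simp only [endsW, Set.mem_setOf_eq] at h1 h2
      rw [h1] at h2
      have h3 := Option.some.inj h2
      have h4 : (F k).1 = (F k').1 := by simpa using h3
      exact hkk (F.injective (Subtype.ext h4))
    · intro k y hy
      exact endsW_mul hij hz (F k).2 hy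
  have hfin := gr_ne_top hC hρ hdec
  obtain ⟨x0, hx0⟩ := exists_ne (1 : M i)
  obtain ⟨c1, C1, hc1, hC1, hb⟩ := gr_two_sided hSgen hS hf hμ hadm hmom hfin hl0 hv0 hh hl hv hge
    hij ⟨z, hz⟩ ⟨x0, hx0⟩
  obtain ⟨C2, hC2, hquad⟩ := green_quad hgen hC hρ hdec hH
  obtain ⟨Q, K, hX⟩ := hX
  have hmain : ∀ m : ℕ, ((m : ℝ) + 1) ^ 2 * (c1 ^ 2 * Real.exp (-v * K)) ≤
      C2.toReal * (Q * m + 1) * C1 := by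
    intro m
    obtain ⟨a, X, hcard, hal, hXa⟩ := hX m
    set A := wordLength (Si i) a with hA
    have h1 := (gr_conv_le μ (CoprodI.of a) (X.map ⟨CoprodI.of, CoprodI.of_injective i⟩)).trans
      (hquad (CoprodI.of a))
    rw [Finset.sum_map, fp_len_of hSgen hS] at h1
    simp only [Function.Embedding.coeFn_mk] at h1
    have ht : C2 * ((A : ℝ≥0∞) + 1) * gr μ (CoprodI.of a) ≠ ∞ :=
      ENNReal.mul_ne_top (ENNReal.mul_ne_top hC2 (ENNReal.add_ne_top.2
        ⟨ENNReal.natCast_ne_top A, ENNReal.one_ne_top⟩)) (hfin _)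
    have h2 := ENNReal.toReal_mono ht h1
    rw [ENNReal.toReal_sum (fun x _ => ENNReal.mul_ne_top (hfin _) (hfin _)), ENNReal.toReal_mul,
      ENNReal.toReal_mul, ENNReal.toReal_add (ENNReal.natCast_ne_top A) ENNReal.one_ne_top] at h2
    simp only [ENNReal.toReal_mul, ENNReal.toReal_natCast, ENNReal.toReal_one] at h2
    have h3 : (X.card : ℝ) * (c1 ^ 2 * Real.exp (-v * (A + K))) ≤
        ∑ x ∈ X, (gr μ (CoprodI.of x)).toReal * (gr μ ((CoprodI.of x)⁻¹ * CoprodI.of a)).toReal := by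
      rw [← nsmul_eq_mul]
      refine Finset.card_nsmul_le_sum X _ _ fun x hx => ?_
      have e : ((CoprodI.of x)⁻¹ * CoprodI.of a : CoprodI M) = CoprodI.of (x⁻¹ * a) := by
        rw [map_mul, map_inv]
      rw [e]
      have b1 := (hb x).1
      have b2 := (hb (x⁻¹ * a)).1
      have hle : (wordLength (Si i) x : ℝ) + wordLength (Si i) (x⁻¹ * a) ≤ A + K := by
        exact_mod_cast hXa x hx
      calc c1 ^ 2 * Real.exp (-v * (A + K)) ≤ c1 ^ 2 * Real.exp (-v * (wordLength (Si i) x +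
            wordLength (Si i) (x⁻¹ * a))) := by
            gcongr c1 ^ 2 * Real.exp ?_
            nlinarith
        _ = (c1 * Real.exp (-v * wordLength (Si i) x)) *
            (c1 * Real.exp (-v * wordLength (Si i) (x⁻¹ * a))) := by
            rw [mul_add, Real.exp_add]; ring
        _ ≤ _ := by gcongr
    have hcr : ((m : ℝ) + 1) ^ 2 ≤ X.card := by exact_mod_cast hcard
    have hAr : (A : ℝ) ≤ Q * m := by exact_mod_cast hal
    have hup := (hb a).2
    have hEA : 0 < Real.exp (-v * A) := Real.exp_pos _
    have h4 : (((m : ℝ) + 1) ^ 2 * (c1 ^ 2 * Real.exp (-v * K))) * Real.exp (-v * A) ≤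
        (C2.toReal * (Q * m + 1) * C1) * Real.exp (-v * A) := by
      calc _ = ((m : ℝ) + 1) ^ 2 * (c1 ^ 2 * Real.exp (-v * (A + K))) := by
            rw [mul_add, Real.exp_add]; ring
        _ ≤ (X.card : ℝ) * (c1 ^ 2 * Real.exp (-v * (A + K))) := by gcongr
        _ ≤ _ := h3.trans h2
        _ ≤ C2.toReal * (Q * m + 1) * (C1 * Real.exp (-v * A)) := by gcongr
        _ = _ := by ring
    exact le_of_mul_le_mul_right h4 hEA
  set e := c1 ^ 2 * Real.exp (-v * K) with he
  have he0 : 0 < e := by positivity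
  set B := C2.toReal * C1 * (Q + 1) with hB
  have hB0 : 0 ≤ B := by positivity
  have h5 : ∀ m : ℕ, ((m : ℝ) + 1) * e ≤ B := by
    intro m
    have h6 := hmain m
    have hm : (0 : ℝ) < (m : ℝ) + 1 := by positivity
    have h7 : C2.toReal * (Q * m + 1) * C1 ≤ B * (m + 1) := by
      rw [hB]
      have : (0 : ℝ) ≤ C2.toReal * C1 := by positivity
      have hQ : (0 : ℝ) ≤ Q := by positivity
      have hm' : (0 : ℝ) ≤ m := by positivity
      calc _ = C2.toReal * C1 * (Q * m + 1) := by ring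
        _ ≤ C2.toReal * C1 * ((Q + 1) * (m + 1)) := by gcongr; nlinarith
        _ = _ := by ring
    have h8 : (((m : ℝ) + 1) * e) * (m + 1) ≤ B * (m + 1) := by nlinarith
    exact le_of_mul_le_mul_right h8 hm
  obtain ⟨m, hm⟩ := exists_nat_gt (B / e)
  rw [div_lt_iff₀ he0] at hm
  have := h5 m
  nlinarith

end Contra


section Nil
open Group Subgroup
open scoped commutatorElement

theorem schur_fin (G : Type*) [Group G] [Finite (G ⧸ center G)] : Finite (_root_.commutator G) := by
  have : Finite (commutatorSet G) := by
    have h : commutatorSet G ⊆ Set.range (fun p : (G ⧸ center G) × (G ⧸ center G) =>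
        ⁅(p.1.out : G), (p.2.out : G)⁆) := by
      rintro _ ⟨a, b, rfl⟩
      refine ⟨(QuotientGroup.mk a, QuotientGroup.mk b), ?_⟩
      obtain ⟨z, hz⟩ := QuotientGroup.mk_out_eq_mul (center G) a
      obtain ⟨w, hw⟩ := QuotientGroup.mk_out_eq_mul (center G) b
      simp only [hz, hw]
      have hz' := fun g => (mem_center_iff.1 z.2 g)
      have hw' := fun g => (mem_center_iff.1 w.2 g)
      have e1 : ⁅a * (z : G), b * (w : G)⁆ = ⁅a, b * (w : G)⁆ := by
        simp only [commutatorElement_def, mul_inv_rev]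
        have : a * (z:G) * (b * w) * ((z:G)⁻¹ * a⁻¹) = a * (b * w) * a⁻¹ := by
          rw [mul_assoc a, ← hz' (b * w)]; group
        rw [this]
      rw [e1]
      simp only [commutatorElement_def, mul_inv_rev]
      have : a * (b * (w:G)) * a⁻¹ = a * b * a⁻¹ * w := by
        rw [← mul_assoc a, mul_assoc _ (w:G), ← hw' a⁻¹, mul_assoc, mul_assoc, mul_assoc]
      rw [this]; group
    exact (Set.finite_range _).subset h
  infer_instance

theorem tors_fin (G : Type*) [Group G] [IsNilpotent G] : ∀ (T : Set G), T.Finite → closure T = ⊤ →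
    (∀ t ∈ T, IsOfFinOrder t) → Finite G := by
  apply @Group.nilpotent_center_quotient_ind _ G _ _ <;> clear! G
  · intros; infer_instance
  · intro G _ _ ih T hT hc ht
    have : Finite (G ⧸ center G) := by
      refine ih ((QuotientGroup.mk' (center G)) '' T) (hT.image _) ?_ ?_
      · rw [← MonoidHom.map_closure, hc, ← MonoidHom.range_eq_map, MonoidHom.range_eq_top]
        exact QuotientGroup.mk'_surjective _
      · rintro _ ⟨t, h, rfl⟩
        exact MonoidHom.isOfFinOrder _ (ht t h)
    have h1 := schur_fin G
    have hFG : Group.FG G := Group.fg_iff.2 ⟨T, hc, hT⟩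
    have hA : closure (Abelianization.of '' T) = (⊤ : Subgroup (Abelianization G)) := by
      rw [← MonoidHom.map_closure, hc, ← MonoidHom.range_eq_map, MonoidHom.range_eq_top]
      exact QuotientGroup.mk'_surjective _
    have hFGA : Group.FG (Abelianization G) := Group.fg_iff.2 ⟨_, hA, hT.image _⟩
    have h2 : Finite (Abelianization G) := by
      refine CommGroup.finite_of_fg_isMulTorsion _ ?_
      rw [← CommGroup.torsion_eq_top_iff, eq_top_iff, ← hA, closure_le]
      rintro _ ⟨t, h, rfl⟩
      exact MonoidHom.isOfFinOrder _ (ht t h)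
    have h3 : Finite (G ⧸ _root_.commutator G) := h2
    exact Finite.of_equiv _ (Subgroup.groupEquivQuotientProdSubgroup (s := _root_.commutator G)).symm

theorem comm_pow_of_fin (G : Type*) [Group G] [Finite (_root_.commutator G)] (g y : G) :
    ∃ q : ℕ, 0 < q ∧ Commute (g ^ q) y := by
  let f : ℕ → _root_.commutator G := fun j => ⟨⁅g ^ j, y⁆,
    Subgroup.commutator_mem_commutator (mem_top _) (mem_top _)⟩
  obtain ⟨a, b, hab, h⟩ := Finite.exists_ne_map_eq_of_infinite f
  have key : ∀ a b : ℕ, a < b → f a = f b → ∃ q : ℕ, 0 < q ∧ Commute (g ^ q) y := by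
    intro a b hlt h
    refine ⟨b - a, by omega, ?_⟩
    have h' : ⁅g ^ a, y⁆ = ⁅g ^ b, y⁆ := congrArg Subtype.val h
    have e : b = a + (b - a) := by omega
    set c := b - a
    rw [e, pow_add] at h'
    simp only [commutatorElement_def] at h'
    have h1 : g ^ a * y * (g ^ a)⁻¹ = g ^ a * g ^ c * y * (g ^ a * g ^ c)⁻¹ :=
      mul_right_cancel h'
    have h2 : y = g ^ c * y * (g ^ c)⁻¹ := by
      have := congrArg (fun t => (g ^ a)⁻¹ * t * g ^ a) h1
      simp only [mul_inv_rev] at this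
      calc y = (g ^ a)⁻¹ * (g ^ a * y * (g ^ a)⁻¹) * g ^ a := by group
        _ = _ := this
        _ = _ := by group
    exact (mul_inv_eq_iff_eq_mul.1 h2.symm)
  rcases lt_or_gt_of_ne hab with h3 | h3
  · exact key a b h3 h
  · exact key b a h3 h.symm

end Nil


section Nil2
open Group Subgroup
open scoped commutatorElement

theorem lift_vc {G : Type*} [Group G] [Finite (_root_.commutator G)] {g y : G} {e : ℕ} {k : ℤ}
    (he : 0 < e) (h : y ^ e * g ^ k ∈ _root_.commutator G) :
    ∃ e' : ℕ, 0 < e' ∧ ∃ k' : ℤ, y ^ e' * g ^ k' = 1 := by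
  have hmem : ∀ j : ℕ, y ^ (e * j) * g ^ (k * j) ∈ _root_.commutator G := by
    intro j
    rw [← Abelianization.ker_of, MonoidHom.mem_ker] at h ⊢
    rw [map_mul, map_pow, map_zpow] at h ⊢
    rw [pow_mul, zpow_mul, zpow_natCast, ← mul_pow, h, one_pow]
  let f : ℕ → _root_.commutator G := fun j => ⟨_, hmem j⟩
  obtain ⟨a, b, hab, h⟩ := Finite.exists_ne_map_eq_of_infinite f
  have key : ∀ a b : ℕ, a < b → f a = f b → ∃ e' : ℕ, 0 < e' ∧ ∃ k' : ℤ, y ^ e' * g ^ k' = 1 := by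
    intro a b hlt h
    have h' : y ^ (e * a) * g ^ (k * a) = y ^ (e * b) * g ^ (k * b) := congrArg Subtype.val h
    have e1 : b = a + (b - a) := by omega
    refine ⟨e * (b - a), Nat.mul_pos he (by omega), k * ((b - a : ℕ) : ℤ), ?_⟩
    have hc : 0 < b - a := by omega
    generalize b - a = c at e1 hc ⊢
    subst e1
    have e2 : e * (a + c) = e * a + e * c := by ring
    have e3 : k * ((a + c : ℕ) : ℤ) = k * c + k * a := by push_cast; ring
    rw [e2, e3, pow_add, zpow_add] at h'
    have h2 : y ^ (e * a) * (g ^ (k * a)) = y ^ (e * a) * ((y ^ (e * c) * g ^ (k * c)) * g ^ (k * a)) := by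
      rw [h']; simp only [mul_assoc]
    have h3 := mul_left_cancel h2
    have h4 : 1 * g ^ (k * (a:ℤ)) = (y ^ (e * c) * g ^ (k * c)) * g ^ (k * a) := by
      rw [one_mul]; exact h3
    exact (mul_right_cancel h4).symm
  rcases lt_or_gt_of_ne hab with h3 | h3
  · exact key a b h3 h
  · exact key b a h3 h.symm

theorem cen_pow_left {G : Type*} [Group G] {a y c : G} (hc : c ∈ center G) (h : a * y = c * (y * a))
    (e : ℕ) : a ^ e * y = c ^ e * (y * a ^ e) := by
  have hc' := fun x => mem_center_iff.1 hc x
  induction e with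
  | zero => simp
  | succ n ih =>
    calc a ^ (n + 1) * y = a ^ n * (a * y) := by rw [pow_succ, mul_assoc]
      _ = a ^ n * c * (y * a) := by rw [h, mul_assoc]
      _ = c * (a ^ n * y) * a := by rw [hc']; simp only [mul_assoc]
      _ = _ := by rw [ih, pow_succ', pow_succ]; simp only [mul_assoc]

theorem cen_pow_right {G : Type*} [Group G] {a y c : G} (hc : c ∈ center G) (h : a * y = c * (y * a))
    (e : ℕ) : a * y ^ e = c ^ e * (y ^ e * a) := by
  have hc' := fun x => mem_center_iff.1 hc x
  induction e with
  | zero => simp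
  | succ n ih =>
    calc a * y ^ (n + 1) = (a * y ^ n) * y := by rw [pow_succ, mul_assoc]
      _ = c ^ n * y ^ n * (a * y) := by rw [ih]; simp only [mul_assoc]
      _ = c ^ n * (y ^ n * c) * (y * a) := by rw [h]; simp only [mul_assoc]
      _ = _ := by rw [hc', pow_succ, pow_succ]; simp only [mul_assoc]

theorem pow_comm_fin {G : Type*} [Group G] {T : Set G} (hT : T.Finite) (hc : closure T = ⊤) {g : G}
    (h : ∀ y ∈ T, ∃ n : ℕ, 0 < n ∧ Commute (g ^ n) y) : ∃ n : ℕ, 0 < n ∧ g ^ n ∈ center G := by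
  have h1 : ∃ n : ℕ, 0 < n ∧ ∀ y ∈ T, Commute (g ^ n) y := by
    clear hc
    induction T, hT using Set.Finite.induction_on with
    | empty => exact ⟨1, one_pos, by simp⟩
    | @insert a s ha hs ih =>
      obtain ⟨n, hn, h1⟩ := ih fun y hy => h y (Set.mem_insert_of_mem _ hy)
      obtain ⟨m, hm, h2⟩ := h a (Set.mem_insert _ _)
      refine ⟨n * m, Nat.mul_pos hn hm, ?_⟩
      rintro y (rfl | hy)
      · rw [mul_comm, pow_mul]; exact h2.pow_left _
      · rw [pow_mul]; exact (h1 y hy).pow_left _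
  obtain ⟨n, hn, h1⟩ := h1
  refine ⟨n, hn, ?_⟩
  have h2 : closure T ≤ centralizer {g ^ n} := by
    rw [closure_le]
    intro y hy
    exact mem_centralizer_singleton_iff.2 (h1 y hy).symm
  rw [hc] at h2
  rw [mem_center_iff]
  intro y
  exact mem_centralizer_singleton_iff.1 (h2 (mem_top y))

theorem comm_quot {G : Type*} [Group G] {g y : G}
    (h : Commute (QuotientGroup.mk g : G ⧸ center G) (QuotientGroup.mk y)) :
    ∃ c ∈ center G, c = ⁅g, y⁆ ∧ g * y = c * (y * g) := by
  refine ⟨⁅g, y⁆, ?_, rfl, by simp only [commutatorElement_def]; group⟩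
  rw [← QuotientGroup.eq_one_iff, commutatorElement_def]
  have : (QuotientGroup.mk g : G ⧸ center G) * QuotientGroup.mk y = QuotientGroup.mk y * QuotientGroup.mk g := h
  change (QuotientGroup.mk g : G ⧸ center G) * QuotientGroup.mk y * (QuotientGroup.mk g)⁻¹ *
    (QuotientGroup.mk y)⁻¹ = 1
  rw [this]; group

theorem clos_quot {G : Type*} [Group G] {T : Set G} (hc : closure T = ⊤) (N : Subgroup G) [N.Normal] :
    closure ((QuotientGroup.mk' N) '' T) = ⊤ := by
  rw [← MonoidHom.map_closure, hc, ← MonoidHom.range_eq_map, MonoidHom.range_eq_top]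
  exact QuotientGroup.mk'_surjective _

theorem pow_tors {G : Type*} [Group G] {a b : G} {e n : ℕ} {k : ℤ} (h3 : a ^ e * b ^ k = 1)
    (h4 : b ^ n = 1) : a ^ (e * n) = 1 := by
  rw [pow_mul, eq_inv_of_mul_eq_one_left h3, ← zpow_neg, ← zpow_natCast, ← zpow_mul, mul_comm,
    zpow_mul, zpow_natCast, h4, one_zpow]

theorem vc_comm_fin (G : Type*) [Group G] [IsNilpotent G] : ∀ (T : Set G), T.Finite → closure T = ⊤ →
    (∃ g : G, ∀ y : G, ∃ e : ℕ, 0 < e ∧ ∃ k : ℤ, y ^ e * g ^ k ∈ _root_.commutator G) →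
    Finite (_root_.commutator G) := by
  apply @Group.nilpotent_center_quotient_ind _ G _ _ <;> clear! G
  · intros; infer_instance
  · intro G _ _ ih T hT hc ⟨g, hg⟩
    have hQ : Finite (_root_.commutator (G ⧸ center G)) := by
      refine ih ((QuotientGroup.mk' (center G)) '' T) (hT.image _) (clos_quot hc _) ⟨QuotientGroup.mk g, ?_⟩
      intro y
      obtain ⟨y, rfl⟩ := QuotientGroup.mk_surjective y
      obtain ⟨e, he, k, h⟩ := hg y
      refine ⟨e, he, k, ?_⟩
      have := Subgroup.mem_map_of_mem (QuotientGroup.mk' (center G)) h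
      rw [_root_.commutator_def, Subgroup.map_commutator] at this
      exact Subgroup.commutator_mono le_top le_top this
    have h1 : ∀ y : G, ∃ e : ℕ, 0 < e ∧ ∃ k : ℤ, y ^ e * g ^ k ∈ center G := by
      intro y
      obtain ⟨e, he, k, h⟩ := hg y
      have := Subgroup.mem_map_of_mem (QuotientGroup.mk' (center G)) h
      rw [_root_.commutator_def, Subgroup.map_commutator] at this
      have := Subgroup.commutator_mono le_top le_top this
      obtain ⟨e', he', k', h'⟩ := lift_vc (g := (QuotientGroup.mk g : G ⧸ center G))
        (y := QuotientGroup.mk y) he (k := k) this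
      exact ⟨e', he', k', (QuotientGroup.eq_one_iff _).1 h'⟩
    have h2 : ∃ n : ℕ, 0 < n ∧ g ^ n ∈ center G := by
      refine pow_comm_fin hT hc fun y _ => ?_
      obtain ⟨e, he, k, h⟩ := h1 y
      obtain ⟨q, hq, hcm⟩ := comm_pow_of_fin (G ⧸ center G) (QuotientGroup.mk g) (QuotientGroup.mk y)
      obtain ⟨c, hcz, -, hcc⟩ := comm_quot (g := g ^ q) (y := y) hcm
      have hgy : Commute (g ^ q) (y ^ e) := by
        have : y ^ e = (y ^ e * g ^ k) * g ^ (-k) := by group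
        rw [this]
        refine Commute.mul_right (mem_center_iff.1 h _) ?_
        exact ((Commute.refl g).pow_left _).zpow_right _
      have hce : c ^ e = 1 := by
        have := cen_pow_right hcz hcc e
        rw [hgy.eq] at this
        have h3 : 1 * (y ^ e * g ^ q) = c ^ e * (y ^ e * g ^ q) := by rw [one_mul]; exact this
        exact (mul_right_cancel h3).symm
      refine ⟨q * e, Nat.mul_pos hq he, ?_⟩
      have := cen_pow_left hcz hcc e
      rw [hce, one_mul, ← pow_mul] at this
      exact this
    obtain ⟨n, hn, hgn⟩ := h2
    have : Finite (G ⧸ center G) := by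
      refine tors_fin _ ((QuotientGroup.mk' (center G)) '' T) (hT.image _) (clos_quot hc _) ?_
      rintro _ ⟨t, -, rfl⟩
      obtain ⟨e, he, k, h⟩ := h1 t
      rw [isOfFinOrder_iff_pow_eq_one]
      refine ⟨e * n, Nat.mul_pos he hn, ?_⟩
      have h3 : (QuotientGroup.mk' (center G)) t ^ e * (QuotientGroup.mk' (center G)) g ^ k = 1 :=
        (QuotientGroup.eq_one_iff _).2 h
      have h4 : (QuotientGroup.mk' (center G)) g ^ n = 1 := (QuotientGroup.eq_one_iff _).2 hgn
      exact pow_tors h3 h4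
    exact schur_fin G

theorem vc_cyc (G : Type*) [Group G] [IsNilpotent G] (T : Set G) (hT : T.Finite) (hc : closure T = ⊤)
    (h : ∃ g : G, ∀ y : G, ∃ e : ℕ, 0 < e ∧ ∃ k : ℤ, y ^ e * g ^ k ∈ _root_.commutator G) :
    ∃ H : Subgroup G, H.FiniteIndex ∧ IsCyclic H := by
  have := vc_comm_fin G T hT hc h
  obtain ⟨g, hg⟩ := h
  obtain ⟨n, hn, hgn⟩ := pow_comm_fin hT hc (g := g) fun y _ => comm_pow_of_fin G g y
  have hle : zpowers (g ^ n) ≤ center G := by rwa [zpowers_le]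
  have hN : (zpowers (g ^ n)).Normal := by
    refine ⟨fun x hx y => ?_⟩
    rw [mem_center_iff.1 (hle hx) y, mul_inv_cancel_right]
    exact hx
  refine ⟨zpowers (g ^ n), ?_, inferInstance⟩
  have : Finite (G ⧸ zpowers (g ^ n)) := by
    refine tors_fin _ ((QuotientGroup.mk' _) '' T) (hT.image _) (clos_quot hc _) ?_
    rintro _ ⟨t, -, rfl⟩
    obtain ⟨e0, he0, k0, h0⟩ := hg t
    obtain ⟨e, he, k, h⟩ := lift_vc he0 h0
    rw [isOfFinOrder_iff_pow_eq_one]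
    refine ⟨e * n, Nat.mul_pos he hn, ?_⟩
    have h3 : (QuotientGroup.mk' (zpowers (g ^ n))) t ^ e * (QuotientGroup.mk' (zpowers (g ^ n))) g ^ k = 1 := by
      rw [← map_pow, ← map_zpow, ← map_mul, h, map_one]
    have h4 : (QuotientGroup.mk' (zpowers (g ^ n))) g ^ n = 1 :=
      (QuotientGroup.eq_one_iff _).2 (mem_zpowers _)
    exact pow_tors h3 h4
  exact Subgroup.finiteIndex_of_finite_quotient

end Nil2


section Nil3
open Group Subgroup
open scoped commutatorElement

theorem ofo_coe {G : Type*} [Group G] {H : Subgroup G} {x : H} :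
    IsOfFinOrder x ↔ IsOfFinOrder (x : G) :=
  (Submonoid.isOfFinOrder_coe (H := H.toSubmonoid) (x := x)).symm

theorem tors_clos {R : Type*} [Group R] [IsNilpotent R] {W : Set R} (hW : W.Finite)
    (ht : ∀ t ∈ W, IsOfFinOrder t) : Finite (Subgroup.closure W) := by
  have h1 : Subgroup.closure ((Subtype.val : Subgroup.closure W → R) ⁻¹' W) = ⊤ :=
    Subgroup.closure_closure_coe_preimage
  have h2 : ((Subtype.val : Subgroup.closure W → R) ⁻¹' W).Finite :=
    hW.preimage Subtype.val_injective.injOn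
  refine tors_fin (Subgroup.closure W) _ h2 h1 ?_
  intro t h
  exact ofo_coe.2 (ht _ h)

theorem half_comm {R : Type*} [Group R] [IsNilpotent R] [Finite (_root_.commutator (R ⧸ center R))]
    {x y : R} (h : IsOfFinOrder ⁅x, y⁆) : ∃ n : ℕ, 0 < n ∧ Commute (x ^ n) y := by
  obtain ⟨q, hq, hcm⟩ := comm_pow_of_fin (R ⧸ center R) (QuotientGroup.mk x) (QuotientGroup.mk y)
  obtain ⟨c, hcz, hce, hcc⟩ := comm_quot (g := x ^ q) (y := y) hcm
  let W : Set R := (fun i : ℕ => x ^ i * ⁅x, y⁆ * (x ^ i)⁻¹) '' (Set.Iio q)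
  have hW : W.Finite := (Set.finite_Iio q).image _
  have hmem : ∀ n : ℕ, n ≤ q → ⁅x ^ n, y⁆ ∈ Subgroup.closure W := by
    intro n
    induction n with
    | zero => intro _; simp
    | succ n ih =>
      intro hn
      have e : ⁅x ^ (n + 1), y⁆ = (x ^ n * ⁅x, y⁆ * (x ^ n)⁻¹) * ⁅x ^ n, y⁆ := by
        simp only [commutatorElement_def]; group
      rw [e]
      exact mul_mem (subset_closure ⟨n, by simp; omega, rfl⟩) (ih (by omega))
  have hfin : Finite (Subgroup.closure W) := by
    refine tors_clos hW ?_
    rintro _ ⟨i, hi, rfl⟩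
    exact (MulAut.conj (x ^ i)).toMonoidHom.isOfFinOrder h
  have hco : IsOfFinOrder c := by
    have h1 := isOfFinOrder_of_finite (⟨c, by rw [hce]; exact hmem q le_rfl⟩ : Subgroup.closure W)
    exact ofo_coe.1 h1
  obtain ⟨e, he, h1⟩ := isOfFinOrder_iff_pow_eq_one.1 hco
  refine ⟨q * e, Nat.mul_pos hq he, ?_⟩
  have := cen_pow_left hcz hcc e
  rw [h1, one_mul, ← pow_mul] at this
  exact this

theorem two_gen_fin (R : Type*) [Group R] [IsNilpotent R] : ∀ x y : R, closure {x, y} = ⊤ →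
    IsOfFinOrder ⁅x, y⁆ → Finite (_root_.commutator R) := by
  apply @Group.nilpotent_center_quotient_ind _ R _ _ <;> clear! R
  · intros; infer_instance
  · intro R _ _ ih x y hc hxy
    have hc' := clos_quot hc (center R)
    rw [Set.image_pair] at hc'
    have : Finite (_root_.commutator (R ⧸ center R)) := by
      refine ih _ _ hc' ?_
      rw [← map_commutatorElement]
      exact MonoidHom.isOfFinOrder _ hxy
    obtain ⟨n, hn, h1⟩ := half_comm hxy
    obtain ⟨m, hm, h2⟩ := half_comm (x := y) (y := x) (by rw [← commutatorElement_inv]; exact hxy.inv)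
    have hF : ({x, y} : Set R).Finite := by simp
    obtain ⟨n, hn, hx⟩ := pow_comm_fin hF hc (g := x) (by
      rintro z (rfl | rfl)
      · exact ⟨1, one_pos, (Commute.refl z).pow_left 1⟩
      · exact ⟨n, hn, h1⟩)
    obtain ⟨m, hm, hy⟩ := pow_comm_fin hF hc (g := y) (by
      rintro z (rfl | rfl)
      · exact ⟨m, hm, h2⟩
      · exact ⟨1, one_pos, (Commute.refl z).pow_left 1⟩)
    have : Finite (R ⧸ center R) := by
      refine tors_fin _ _ (by simp) hc' ?_
      rintro z (rfl | rfl)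
      · exact isOfFinOrder_iff_pow_eq_one.2 ⟨n, hn, (QuotientGroup.eq_one_iff _).2 hx⟩
      · exact isOfFinOrder_iff_pow_eq_one.2 ⟨m, hm, (QuotientGroup.eq_one_iff _).2 hy⟩
    exact schur_fin R

/-- subgroup version -/
theorem two_gen_fin' {P : Type*} [Group P] [IsNilpotent P] {x y : P} (h : IsOfFinOrder ⁅x, y⁆) :
    ∃ N : Subgroup P, Finite N ∧ (∀ a ∈ closure {x, y}, ∀ b ∈ closure {x, y}, ⁅a, b⁆ ∈ N) ∧
      (∀ a ∈ closure {x, y}, ∀ n ∈ N, a * n * a⁻¹ ∈ N) := by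
  set R := closure {x, y} with hR
  have hx : x ∈ R := subset_closure (by simp)
  have hy : y ∈ R := subset_closure (by simp)
  have hfin : Finite (_root_.commutator R) := by
    refine two_gen_fin R ⟨x, hx⟩ ⟨y, hy⟩ ?_ ?_
    · have : ({⟨x, hx⟩, ⟨y, hy⟩} : Set R) = (↑) ⁻¹' ({x, y} : Set P) := by
        ext ⟨z, hz⟩; simp [Subtype.ext_iff]
      rw [this]
      exact Subgroup.closure_closure_coe_preimage
    · rw [ofo_coe]; exact h
  refine ⟨(_root_.commutator R).map R.subtype, ?_, ?_, ?_⟩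
  · exact Set.Finite.to_subtype ((Set.toFinite (_root_.commutator R : Set R)).image _)
  · intro a ha b hb
    exact ⟨⁅⟨a, ha⟩, ⟨b, hb⟩⁆, commutator_mem_commutator (mem_top _) (mem_top _), rfl⟩
  · rintro a ha _ ⟨n, hn, rfl⟩
    exact ⟨⟨a, ha⟩ * n * ⟨a, ha⟩⁻¹, (inferInstance : (_root_.commutator R).Normal).conj_mem n hn _, rfl⟩

end Nil3


section Nil4
open Group Subgroup
open scoped commutatorElement

theorem two_homs (P : Type*) [Group P] [IsNilpotent P] {S : Set P} (hf : S.Finite)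
    (hS : Subgroup.closure S = ⊤) (hnvc : ¬ ∃ H : Subgroup P, H.FiniteIndex ∧ IsCyclic H) :
    ∃ f1 f2 : P → ℤ, (∀ a b, f1 (a * b) = f1 a + f1 b) ∧ (∀ a b, f2 (a * b) = f2 a + f2 b) ∧
      ∃ x y, f1 x ≠ 0 ∧ f2 x = 0 ∧ f2 y ≠ 0 := by
  have hFG : Group.FG P := Group.fg_iff.2 ⟨S, hS, hf⟩
  have hFGA : Group.FG (Abelianization P) :=
    Group.fg_of_surjective (f := Abelianization.of) (QuotientGroup.mk'_surjective _)
  obtain ⟨ι, j, _, _, p, hp, e, ⟨E⟩⟩ := CommGroup.equiv_free_prod_prod_multiplicative_zmod (Abelianization P)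
  have hsurj : ∀ z, ∃ g : P, E (Abelianization.of g) = z := by
    intro z
    obtain ⟨g, hg⟩ := QuotientGroup.mk_surjective (E.symm z)
    exact ⟨g, by rw [show Abelianization.of g = E.symm z from hg, E.apply_symm_apply]⟩
  by_cases hj : ∃ a b : j, a ≠ b
  · obtain ⟨a, b, hab⟩ := hj
    refine ⟨fun g => Multiplicative.toAdd ((E (Abelianization.of g)).1 a),
      fun g => Multiplicative.toAdd ((E (Abelianization.of g)).1 b), ?_, ?_, ?_⟩
    · intro g h; simp
    · intro g h; simp
    · obtain ⟨x, hx⟩ := hsurj (Pi.mulSingle a (Multiplicative.ofAdd 1), 1)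
      obtain ⟨y, hy⟩ := hsurj (Pi.mulSingle b (Multiplicative.ofAdd 1), 1)
      refine ⟨x, y, ?_, ?_, ?_⟩
      · simp [hx]
      · simp [hx, Pi.mulSingle_eq_of_ne hab.symm]
      · simp [hy]
  · exfalso
    push Not at hj
    apply hnvc
    refine vc_cyc P S hf hS ?_
    have : ∀ i, NeZero (p i ^ e i) := fun i => ⟨pow_ne_zero _ (hp i).ne_zero⟩
    obtain ⟨g, hg⟩ := hsurj (fun _ => Multiplicative.ofAdd 1, 1)
    refine ⟨g, fun y => ?_⟩
    have hk : ∃ k : ℤ, ∀ a, Multiplicative.toAdd ((E (Abelianization.of y)).1 a) = k := by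
      by_cases hne : Nonempty j
      · obtain ⟨a0⟩ := hne
        exact ⟨_, fun a => by rw [hj a a0]⟩
      · exact ⟨0, fun a => (hne ⟨a⟩).elim⟩
    obtain ⟨k, hk⟩ := hk
    have hfinF : Finite ((i : ι) → Multiplicative (ZMod (p i ^ e i))) := by
      have : ∀ i, Finite (Multiplicative (ZMod (p i ^ e i))) := fun i => inferInstance
      infer_instance
    set c := Nat.card ((i : ι) → Multiplicative (ZMod (p i ^ e i))) with hcdef
    refine ⟨c, Nat.card_pos, -(k * c), ?_⟩
    rw [← Abelianization.ker_of, MonoidHom.mem_ker, ← E.map_eq_one_iff, map_mul, map_mul, map_pow,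
      map_pow, map_zpow, map_zpow, hg]
    refine Prod.ext ?_ ?_
    · funext a
      apply Multiplicative.toAdd.injective
      simp only [Prod.fst_mul, Prod.pow_fst, Pi.mul_apply, Pi.pow_apply, toAdd_mul, toAdd_pow, hk,
        Prod.fst_one, Pi.one_apply, toAdd_one, toAdd_zpow, toAdd_ofAdd]
      simp
      ring
    · simp only [Prod.snd_mul, Prod.pow_snd, Prod.snd_one, one_zpow, mul_one]
      rw [hcdef]
      exact pow_card_eq_one'

theorem addf_one {P : Type*} [Group P] {A : Type*} [AddGroup A] {f : P → A}
    (h : ∀ a b, f (a * b) = f a + f b) : f 1 = 0 := by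
  have := h 1 1
  rw [mul_one] at this
  exact left_eq_add.1 this

theorem addf_inv {P : Type*} [Group P] {A : Type*} [AddGroup A] {f : P → A}
    (h : ∀ a b, f (a * b) = f a + f b) (a : P) : f a⁻¹ = - f a := by
  have := h a⁻¹ a
  rw [inv_mul_cancel, addf_one h] at this
  exact eq_neg_of_add_eq_zero_left this.symm

theorem addf_pow {P : Type*} [Group P] {f : P → ℝ}
    (h : ∀ a b, f (a * b) = f a + f b) (a : P) (n : ℕ) : f (a ^ n) = n * f a := by
  induction n with
  | zero => simp [addf_one h]
  | succ n ih => rw [pow_succ, h, ih]; push_cast; ring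

theorem add_zero_of_gen {P : Type*} [Group P] {A : Type*} [AddCommGroup A] {f : P → A} {S : Set P}
    (hS : Subgroup.closure S = ⊤)
    (h : ∀ a b, f (a * b) = f a + f b) (h0 : ∀ s ∈ S, f s = 0) (g : P) : f g = 0 := by
  have hg : g ∈ Subgroup.closure S := by rw [hS]; trivial
  induction hg using Subgroup.closure_induction with
  | mem x hx => exact h0 x hx
  | one => exact addf_one h
  | mul x y _ _ hx hy => rw [h, hx, hy, add_zero]
  | inv x _ hx => rw [addf_inv h, hx, neg_zero]

/-- the face lemma -/
theorem face (P : Type*) [Group P] [IsNilpotent P] {S : Set P} (hf : S.Finite)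
    (hS : Subgroup.closure S = ⊤) (hnvc : ¬ ∃ H : Subgroup P, H.FiniteIndex ∧ IsCyclic H) :
    ∃ (φ : P → ℝ) (f : P → ℤ) (s t : P), (∀ a b, φ (a * b) = φ a + φ b) ∧
      (∀ a b, f (a * b) = f a + f b) ∧ (s ∈ S ∨ s⁻¹ ∈ S) ∧ (t ∈ S ∨ t⁻¹ ∈ S) ∧ φ t = φ s ∧ f s ≠ f t ∧
      0 < φ s ∧ ∀ r, (r ∈ S ∨ r⁻¹ ∈ S) → φ r ≤ φ s := by
  obtain ⟨f1, f2', h1, h2', x, y, hx1, hx2', hy'⟩ := two_homs P hf hS hnvc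
  let D : Set P := {r | r ∈ S ∨ r⁻¹ ∈ S}
  have hDf : D.Finite := (hf.union hf.inv).subset fun r hr => hr
  have hDi : ∀ r ∈ D, r⁻¹ ∈ D := by
    intro r hr
    rcases hr with h | h
    · exact Or.inr (by simpa using h)
    · exact Or.inl h
  have hDn : D.Nonempty := by
    by_contra hne
    rw [Set.not_nonempty_iff_eq_empty] at hne
    apply hx1
    refine add_zero_of_gen hS h1 (fun s hs => ?_) x
    have : s ∈ D := Or.inl hs
    rw [hne] at this; exact this.elim
  obtain ⟨s, hsD, hsmax⟩ := hDf.exists_maximalFor f1 D hDn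
  have hsmax' : ∀ r ∈ D, f1 r ≤ f1 s := by
    intro r hr
    by_contra hlt
    push Not at hlt
    exact absurd (hsmax hr hlt.le) (not_le.2 hlt)
  have hf2 : ∃ f2 : P → ℤ, (∀ a b, f2 (a * b) = f2 a + f2 b) ∧ f2 x = 0 ∧ ∃ t ∈ D, f2 s < f2 t := by
    by_cases hcase : ∃ t ∈ D, f2' s < f2' t
    · exact ⟨f2', h2', hx2', hcase⟩
    · refine ⟨fun g => - f2' g, fun a b => by simp only [h2']; ring, by simp [hx2'], ?_⟩
      push Not at hcase
      by_contra hcase2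
      push Not at hcase2
      have hconst : ∀ t ∈ D, f2' t = f2' s := fun t ht =>
        le_antisymm (hcase t ht) (by have := hcase2 t ht; omega)
      have hs0 : f2' s = 0 := by
        have := hconst _ (hDi s hsD)
        rw [addf_inv h2'] at this
        omega
      exact hy' (add_zero_of_gen hS h2' (fun r hr => by rw [hconst r (Or.inl hr), hs0]) y)
  obtain ⟨f2, h2, hx2, t0, ht0D, ht0⟩ := hf2
  let D' : Set P := {r ∈ D | f2 s < f2 r}
  have hD'f : D'.Finite := hDf.subset fun r hr => hr.1
  let q : P → ℝ := fun r => ((f1 s - f1 r : ℤ) : ℝ) / ((f2 r - f2 s : ℤ) : ℝ)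
  obtain ⟨t, htD, htmin⟩ := hD'f.exists_minimalFor q D' ⟨t0, ht0D, ht0⟩
  have htmin' : ∀ r ∈ D', q t ≤ q r := by
    intro r hr
    by_contra hlt
    push Not at hlt
    exact absurd (htmin hr hlt.le) (not_le.2 hlt)
  have hq0 : 0 ≤ q t := by
    refine div_nonneg ?_ ?_
    · have := hsmax' t htD.1; exact_mod_cast (by omega : 0 ≤ f1 s - f1 t)
    · have := htD.2; exact_mod_cast (by omega : 0 ≤ f2 t - f2 s)
  let φ : P → ℝ := fun g => f1 g + q t * f2 g
  have hφ : ∀ a b, φ (a * b) = φ a + φ b := by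
    intro a b; simp only [φ, h1, h2]; push_cast; ring
  have hmax : ∀ r ∈ D, φ r ≤ φ s := by
    intro r hr
    simp only [φ]
    have e1 : (f1 r : ℝ) ≤ f1 s := by exact_mod_cast hsmax' r hr
    by_cases hlt : f2 s < f2 r
    · have h3 := htmin' r ⟨hr, hlt⟩
      have h4 : (0 : ℝ) < ((f2 r - f2 s : ℤ) : ℝ) := by exact_mod_cast (by omega : 0 < f2 r - f2 s)
      rw [show q r = ((f1 s - f1 r : ℤ) : ℝ) / ((f2 r - f2 s : ℤ) : ℝ) from rfl, le_div_iff₀ h4] at h3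
      push_cast at h3
      nlinarith
    · push Not at hlt
      have : (f2 r : ℝ) ≤ f2 s := by exact_mod_cast hlt
      nlinarith
  have heq : φ t = φ s := by
    have h4 : (0 : ℝ) < ((f2 t - f2 s : ℤ) : ℝ) := by
      have := htD.2; exact_mod_cast (by omega : 0 < f2 t - f2 s)
    have h3 : q t * ((f2 t - f2 s : ℤ) : ℝ) = ((f1 s - f1 t : ℤ) : ℝ) := div_mul_cancel₀ _ h4.ne'
    push_cast at h3
    simp only [φ]
    nlinarith
  refine ⟨φ, f2, s, t, hφ, h2, hsD, htD.1, heq, htD.2.ne, ?_, hmax⟩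
  by_contra hle
  push Not at hle
  have hz : ∀ r ∈ S, φ r = 0 := by
    intro r hr
    have a1 := hmax r (Or.inl hr)
    have a2 := hmax _ (hDi r (Or.inl hr))
    rw [addf_inv hφ] at a2
    linarith
  have := add_zero_of_gen hS hφ hz x
  simp only [φ, hx2] at this
  apply hx1
  simpa using this

end Nil4


section Nil5
open Group Subgroup
open scoped commutatorElement

/-- Thue-Morse pairs -/
def tmp {P : Type*} [Group P] (s t : P) : ℕ → P × P
  | 0 => (s, t)
  | k + 1 => ((tmp s t k).1 * (tmp s t k).2, (tmp s t k).2 * (tmp s t k).1)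

theorem tmp_succ_z {P : Type*} [Group P] (s t : P) (k : ℕ) :
    (tmp s t (k + 1)).1⁻¹ * (tmp s t (k + 1)).2 =
      ⁅((tmp s t k).1⁻¹ * (tmp s t k).2)⁻¹, (tmp s t k).1⁻¹⁆ := by
  simp only [tmp, commutatorElement_def]; group

theorem tmp_lcs {P : Type*} [Group P] (s t : P) (k : ℕ) :
    (tmp s t k).1⁻¹ * (tmp s t k).2 ∈ (⊤ : Subgroup P).lowerCentralSeries k := by
  induction k with
  | zero => exact mem_top _
  | succ k ih =>
    rw [tmp_succ_z, Subgroup.lowerCentralSeries_succ]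
    exact commutator_mem_commutator (inv_mem ih) (mem_top _)

theorem tmp_stop {P : Type*} [Group P] [IsNilpotent P] {s t : P}
    (h0 : ¬ IsOfFinOrder (s⁻¹ * t)) : ∃ k : ℕ,
      ¬ IsOfFinOrder ((tmp s t k).1⁻¹ * (tmp s t k).2) ∧
      IsOfFinOrder ⁅((tmp s t k).1⁻¹ * (tmp s t k).2)⁻¹, (tmp s t k).1⁻¹⁆ := by
  by_contra hcon
  push Not at hcon
  have hall : ∀ k, ¬ IsOfFinOrder ((tmp s t k).1⁻¹ * (tmp s t k).2) := by
    intro k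
    induction k with
    | zero => exact h0
    | succ k ih => rw [tmp_succ_z]; exact hcon k ih
  obtain ⟨n, hn⟩ := Subgroup.nilpotent_iff_lowerCentralSeries.1 (inferInstance : IsNilpotent P)
  have := tmp_lcs s t n
  rw [hn, Subgroup.mem_bot] at this
  apply hall n
  rw [this]
  exact IsOfFinOrder.one

theorem tmp_wl {P : Type*} [Group P] {S : Set P} (hS : Subgroup.closure S = ⊤) {s t : P}
    (hs : s ∈ S ∨ s⁻¹ ∈ S) (ht : t ∈ S ∨ t⁻¹ ∈ S) (k : ℕ) :
    wordLength S (tmp s t k).1 ≤ 2 ^ k ∧ wordLength S (tmp s t k).2 ≤ 2 ^ k := by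
  induction k with
  | zero => exact ⟨wl_gen hs, wl_gen ht⟩
  | succ k ih =>
    have h1 := wl_mul_le hS (tmp s t k).1 (tmp s t k).2
    have h2 := wl_mul_le hS (tmp s t k).2 (tmp s t k).1
    simp only [tmp, pow_succ]
    omega

theorem tmp_phi {P : Type*} [Group P] {φ : P → ℝ} (hφ : ∀ a b, φ (a * b) = φ a + φ b) {s t : P}
    (h : φ t = φ s) (k : ℕ) :
    φ (tmp s t k).1 = 2 ^ k * φ s ∧ φ (tmp s t k).2 = 2 ^ k * φ s := by
  induction k with
  | zero => simp [tmp, h]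
  | succ k ih =>
    simp only [tmp, hφ, ih.1, ih.2, pow_succ]
    constructor <;> ring

theorem phi_le_wl {P : Type*} [Group P] {S : Set P} (hS : Subgroup.closure S = ⊤) {φ : P → ℝ}
    (hφ : ∀ a b, φ (a * b) = φ a + φ b) {c : ℝ} (hc : ∀ r, (r ∈ S ∨ r⁻¹ ∈ S) → φ r ≤ c) (g : P) :
    φ g ≤ wordLength S g * c := by
  obtain ⟨l, h1, h2, rfl⟩ := wl_exists hS g
  rw [← h1]
  clear h1
  induction l with
  | nil => simp [addf_one hφ]
  | cons a l ih =>
    rw [List.prod_cons, hφ, List.length_cons]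
    have h3 := hc a (h2 a (by simp))
    have h4 := ih fun x hx => h2 x (by simp [hx])
    push_cast
    linarith

theorem pow_split {P : Type*} [Group P] {R N : Subgroup P}
    (hc : ∀ a ∈ R, ∀ b ∈ R, ⁅a, b⁆ ∈ N) (hn : ∀ a ∈ R, ∀ n ∈ N, a * n * a⁻¹ ∈ N)
    {u z : P} (hu : u ∈ R) (hz : z ∈ R) (d : ℕ) : ∃ n ∈ N, (u * z) ^ d = n * u ^ d * z ^ d := by
  induction d with
  | zero => exact ⟨1, one_mem _, by simp⟩
  | succ d ih =>
    obtain ⟨n, hnN, h⟩ := ih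
    refine ⟨n * (u ^ d * ⁅z ^ d, u⁆ * (u ^ d)⁻¹),
      mul_mem hnN (hn _ (pow_mem hu d) _ (hc _ (pow_mem hz d) _ hu)), ?_⟩
    rw [pow_succ, h, commutatorElement_def, pow_succ u, pow_succ z]
    group

theorem nilp_main (P : Type*) [Group P] [IsNilpotent P] {S : Set P} (hf : S.Finite)
    (hS : Subgroup.closure S = ⊤) (hnvc : ¬ ∃ H : Subgroup P, H.FiniteIndex ∧ IsCyclic H) :
    ∃ Q K : ℕ, ∀ m : ℕ, ∃ a : P, ∃ X : Finset P, (m + 1) ^ 2 ≤ X.card ∧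
      wordLength S a ≤ Q * m ∧
      ∀ x ∈ X, wordLength S x + wordLength S (x⁻¹ * a) ≤ wordLength S a + K := by
  obtain ⟨φ, f, s, t, hφ, hfa, hs, ht, hst, hfst, hpos, hmax⟩ := face P hf hS hnvc
  have h0 : ¬ IsOfFinOrder (s⁻¹ * t) := by
    intro h
    obtain ⟨n, hn, h1⟩ := isOfFinOrder_iff_pow_eq_one.1 h
    have hF : ∀ a b, (fun g => (f g : ℝ)) (a * b) = (fun g => (f g : ℝ)) a + (fun g => (f g : ℝ)) b := by
      intro a b; simp only [hfa]; push_cast; ring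
    have h2 := addf_pow (f := fun g => (f g : ℝ)) hF (s⁻¹ * t) n
    rw [h1, addf_one (f := fun g => (f g : ℝ)) hF] at h2
    have h3 : (f (s⁻¹ * t) : ℝ) = 0 := by
      have hn' : (n : ℝ) ≠ 0 := by positivity
      rcases mul_eq_zero.1 h2.symm with h | h
      · exact absurd h hn'
      · exact h
    have h4 : f (s⁻¹ * t) = 0 := by exact_mod_cast h3
    rw [hfa, addf_inv hfa] at h4
    omega
  obtain ⟨k, hk1, hk2⟩ := tmp_stop h0
  obtain ⟨hwu, hwv⟩ := tmp_wl hS hs ht k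
  obtain ⟨hpu, hpv⟩ := tmp_phi hφ hst k
  generalize hu : (tmp s t k).1 = u at hk1 hk2 hwu hpu
  generalize hv : (tmp s t k).2 = v at hk1 hk2 hwv hpv
  generalize hz : u⁻¹ * v = z at hk1 hk2
  obtain ⟨N, hNf, hNc, hNn⟩ := two_gen_fin' hk2
  have hvz : v = u * z := by rw [← hz]; group
  set R := Subgroup.closure {z⁻¹, u⁻¹} with hR
  have huR : u ∈ R := by
    have : u⁻¹ ∈ R := subset_closure (by simp)
    simpa using this
  have hzR : z ∈ R := by
    have : z⁻¹ ∈ R := subset_closure (by simp)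
    simpa using this
  have hvR : v ∈ R := by rw [hvz]; exact mul_mem huR hzR
  obtain ⟨K, hK⟩ : ∃ K : ℕ, ∀ n ∈ N, wordLength S n ≤ K := by
    have hfin : ((fun n => wordLength S n) '' (N : Set P)).Finite := (Set.toFinite (N : Set P)).image _
    obtain ⟨K, hK⟩ := hfin.bddAbove
    exact ⟨K, fun n hn => hK ⟨n, hn, rfl⟩⟩
  set M : ℕ := 2 ^ k with hM
  have hMφ : (0 : ℝ) < (M : ℝ) * φ s := by
    have : (0 : ℝ) < M := by rw [hM]; positivity
    positivity
  have hpu' : φ u = M * φ s := by rw [hpu, hM]; push_cast; rfl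
  have hpv' : φ v = M * φ s := by rw [hpv, hM]; push_cast; rfl
  have hphi : ∀ i j : ℕ, φ (u ^ i * v ^ j) = ((i + j : ℕ) : ℝ) * (M * φ s) := by
    intro i j
    rw [hφ, addf_pow hφ, addf_pow hφ, hpu', hpv']; push_cast; ring
  have hlen : ∀ i j : ℕ, wordLength S (u ^ i * v ^ j) ≤ (i + j) * M := by
    intro i j
    calc _ ≤ wordLength S (u ^ i) + wordLength S (v ^ j) := wl_mul_le hS _ _
      _ ≤ i * wordLength S u + j * wordLength S v := add_le_add (wl_pow_le hS _ _) (wl_pow_le hS _ _)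
      _ ≤ i * M + j * M := by gcongr
      _ = _ := by ring
  have hinj : ∀ i j i' j' : ℕ, i ≤ i' → u ^ i * v ^ j = u ^ i' * v ^ j' → i = i' ∧ j = j' := by
    intro i j i' j' hii h
    have h1 := hphi i j
    rw [h, hphi i' j'] at h1
    have h2 : i' + j' = i + j := by exact_mod_cast mul_right_cancel₀ hMφ.ne' h1
    obtain ⟨d, rfl⟩ := Nat.exists_eq_add_of_le hii
    obtain rfl : j = d + j' := by omega
    rcases Nat.eq_zero_or_pos d with rfl | hd
    · simp
    · exfalso
      rw [pow_add, pow_add, mul_assoc] at h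
      have h3 : v ^ d = u ^ d := mul_right_cancel (mul_left_cancel h)
      obtain ⟨n, hn, h4⟩ := pow_split hNc hNn huR hzR d
      rw [← hvz, h3] at h4
      have h5 : z ^ d = (u ^ d)⁻¹ * n⁻¹ * ((u ^ d)⁻¹)⁻¹ := by
        have : z ^ d = (n * u ^ d)⁻¹ * u ^ d := by
          rw [eq_inv_mul_iff_mul_eq]; exact h4.symm
        rw [this]; group
      have h6 : z ^ d ∈ N := by
        rw [h5]
        exact hNn _ (inv_mem (pow_mem huR d)) _ (inv_mem hn)
      have h7 : IsOfFinOrder (z ^ d) := by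
        have := isOfFinOrder_of_finite (⟨z ^ d, h6⟩ : N)
        exact ofo_coe.1 this
      exact hk1 (h7.of_pow hd.ne')
  refine ⟨2 * M, K, fun m => ?_⟩
  refine ⟨u ^ m * v ^ m, (Finset.range (m + 1) ×ˢ Finset.range (m + 1)).image
    (fun p => u ^ p.1 * v ^ p.2), ?_, ?_, ?_⟩
  · rw [Finset.card_image_of_injOn]
    · simp [sq]
    · rintro ⟨i, j⟩ - ⟨i', j'⟩ - h
      simp only at h
      rcases le_total i i' with hle | hle
      · obtain ⟨h1, h2⟩ := hinj i j i' j' hle h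
        rw [h1, h2]
      · obtain ⟨h1, h2⟩ := hinj i' j' i j hle h.symm
        rw [h1, h2]
  · calc _ ≤ (m + m) * M := hlen m m
      _ = _ := by ring
  · intro x hx
    rw [Finset.mem_image] at hx
    obtain ⟨⟨i, j⟩, hij, rfl⟩ := hx
    rw [Finset.mem_product, Finset.mem_range, Finset.mem_range] at hij
    simp only at hij ⊢
    obtain ⟨i', hi'⟩ := Nat.exists_eq_add_of_le (Nat.lt_succ_iff.1 hij.1)
    obtain ⟨j', hj'⟩ := Nat.exists_eq_add_of_le (Nat.lt_succ_iff.1 hij.2)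
    have hlow : (m + m) * M ≤ wordLength S (u ^ m * v ^ m) := by
      have h1 := phi_le_wl hS hφ hmax (u ^ m * v ^ m)
      rw [hphi, ← mul_assoc] at h1
      have h2 := le_of_mul_le_mul_right h1 hpos
      exact_mod_cast h2
    have e : (u ^ i * v ^ j)⁻¹ * (u ^ m * v ^ m) = ⁅(v ^ j)⁻¹, u ^ i'⁆ * (u ^ i' * v ^ j') := by
      have e1 : u ^ m = u ^ i * u ^ i' := by rw [hi', pow_add]
      have e2 : v ^ m = v ^ j * v ^ j' := by rw [hj', pow_add]
      rw [e1, e2, commutatorElement_def]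
      group
    rw [e]
    have h1 := wl_mul_le hS ⁅(v ^ j)⁻¹, u ^ i'⁆ (u ^ i' * v ^ j')
    have h2 := hK _ (hNc _ (inv_mem (pow_mem hvR j)) _ (pow_mem huR i'))
    have h3 := hlen i j
    have h4 := hlen i' j'
    have h5 : (i + j) * M + (i' + j') * M = (m + m) * M := by
      rw [← add_mul]; congr 1; omega
    omega

theorem nvc_inf (P : Type*) [Group P] (hnvc : ¬ ∃ H : Subgroup P, H.FiniteIndex ∧ IsCyclic H) :
    Infinite P := by
  by_contra h
  rw [not_infinite_iff_finite] at h
  exact hnvc ⟨⊥, inferInstance, inferInstance⟩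

end Nil5

/-- **Strict Guivarc'h inequality for free products with a nilpotent factor.**
Let `Γ = Γ₁ * ⋯ * Γ_N` (`N ≥ 2`) be a free product of nontrivial finitely generated
groups with `Γ₁` nilpotent and not virtually cyclic, `S` an adapted generating set,
and `μ` an admissible probability measure with finite super-exponential moment.
Then the asymptotic entropy `h`, drift `l` and volume growth `v` exist and `h < l·v`. -/
theorem free_product_nilpotent_factor_strict_guivarch
    (N : ℕ) (hN : 2 ≤ N) (Γi : Fin N → Type*) [∀ i, Group (Γi i)]
    [∀ i, Nontrivial (Γi i)] [∀ i, Group.FG (Γi i)]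
    (hnilp : Group.IsNilpotent (Γi ⟨0, by omega⟩))
    (hnvc : ¬ ∃ H : Subgroup (Γi ⟨0, by omega⟩), H.FiniteIndex ∧ IsCyclic H)
    (Si : ∀ i, Set (Γi i)) (hSfin : ∀ i, (Si i).Finite)
    (hSgen : ∀ i, Subgroup.closure (Si i) = ⊤)
    (S : Set (Monoid.CoprodI Γi))
    (hS : S = ⋃ i, (Monoid.CoprodI.of : Γi i →* Monoid.CoprodI Γi) '' Si i)
    (μ : Monoid.CoprodI Γi → ℝ≥0∞)
    (hprob : ∑' g, μ g = 1)
    (hadm : ∀ g, ∃ n, 0 < convPow μ n g)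
    (hmom : ∀ c : ℝ, 1 < c → ∑' g, μ g * ENNReal.ofReal (c ^ wordLength S g) ≠ ∞) :
    ∃ h l v : ℝ, 0 ≤ h ∧ 0 ≤ l ∧ 0 ≤ v ∧
      Tendsto (fun n : ℕ => (entropy (convPow μ n)).toReal / n) atTop (nhds h) ∧
      Tendsto (fun n : ℕ =>
        (∑' g, convPow μ n g * (wordLength S g : ℝ≥0∞)).toReal / n) atTop (nhds l) ∧
      Tendsto (fun n : ℕ =>
        Real.log (Set.ncard {g : Monoid.CoprodI Γi | wordLength S g ≤ n}) / n) atTop (nhds v) ∧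
      h < l * v := by
  have hgen := fp_gen hSgen hS
  have hfin := fp_fin hS hSfin
  have hL : drf S μ ≠ ∞ := moment_len hgen hfin μ hmom
  obtain ⟨h, hh0, hh⟩ := entropy_tendsto hgen hfin hprob hL
  obtain ⟨l, hl0, hl⟩ := drf_tendsto hgen hprob hL
  obtain ⟨v, hv0, hv⟩ := growth_tendsto hgen hfin
  refine ⟨h, l, v, hh0, hl0, hv0, hh, hl, hv, ?_⟩
  have hinf : Infinite (Γi ⟨0, by omega⟩) := nvc_inf _ hnvc
  exact strict_ineq (i := _) (j := ⟨1, by omega⟩) hSgen hS hfin hprob hadm hmom hl0 hv0 hh hl hv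
    (by simp) (exists_ne 1) (nilp_main _ (hSfin _) (hSgen _) hnvc)
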